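/- arXiv:2601.01553 — 4 statements merged into one kernel-verified Lean document; each statement's English description precedes it below -/
import Mathlib

section
/- Let Ω ⊆ ℂ be a domain and let T : ℂ → ℂ^{n×n} be analytic on Ω with det T not identically zero on Ω. Suppose the zero set of z ↦ det T(z) in Ω consists of exactly m distinct points λ_1, …, λ_m, each a zero of order 1, and suppose for each j there are nonzero vectors v_j, w_j ∈ ℂ^n with T(λ_j) v_j = 0 and w_j^* T(λ_j) = 0, normalized so that w_j^* T'(λ_j) v_j = 1. Then there exists a function N : ℂ → ℂ^{n×n} analytic on Ω such that for every z ∈ Ω with det T(z) ≠ 0, T(z)^{-1} = Σ_{j=1}^m (z − λ_j)^{-1} v_j w_j^* + N(z). -/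
open Matrix

/-- `g` has a zero of order `k` at `z₀`: near `z₀`, `g z = (z - z₀)^k * h z` with `h`
analytic near `z₀` and `h z₀ ≠ 0`. -/
def ZeroOrder (g : ℂ → ℂ) (z₀ : ℂ) (k : ℕ) : Prop :=
  ∃ h : ℂ → ℂ, AnalyticAt ℂ h z₀ ∧ h z₀ ≠ 0 ∧ ∀ᶠ z in nhds z₀, g z = (z - z₀) ^ k * h z

open Filter Topology

/-- The kernel of a matrix with nonzero adjugate is at most one-dimensional; hence the adjugate
of a singular matrix is `v yᵀ` for any nonzero kernel vector `v`. -/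
lemma adjugate_eq_of_kernel {n : ℕ} (M : Matrix (Fin n) (Fin n) ℂ) (v : Fin n → ℂ)
    (hv : v ≠ 0) (hMv : M *ᵥ v = 0) (hdet : M.det = 0) :
    ∃ y : Fin n → ℂ, ∀ k l, M.adjugate k l = v k * y l := by
  by_cases hA : M.adjugate = 0
  · exact ⟨0, fun k l => by simp [hA]⟩
  obtain ⟨i, j, hij⟩ : ∃ i j, M.adjugate i j ≠ 0 := by
    by_contra! h
    exact hA (by ext i j; simpa using h i j)
  rw [Matrix.adjugate_apply] at hij
  have key : ∀ u : Fin n → ℂ, M *ᵥ u = 0 → u i = 0 → u = 0 := by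
    intro u hu hui
    apply Matrix.eq_zero_of_mulVec_eq_zero hij
    ext k
    by_cases hk : k = j
    · subst hk
      simp [Matrix.mulVec, hui]
    · have := congrFun hu k
      simpa [Matrix.mulVec, Matrix.updateRow_ne hk] using this
  have hvi : v i ≠ 0 := fun h => hv (key v hMv h)
  refine ⟨fun l => M.adjugate i l / v i, fun k l => ?_⟩
  have hcol : M *ᵥ (fun k => M.adjugate k l) = 0 := by
    ext r
    have := congrFun (congrFun (Matrix.mul_adjugate M) r) l
    rw [hdet, zero_smul] at this
    simpa [Matrix.mul_apply, Matrix.mulVec, dotProduct] using this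
  have := key ((fun k => M.adjugate k l) - (M.adjugate i l / v i) • v)
    (by rw [Matrix.mulVec_sub, Matrix.mulVec_smul, hcol, hMv]; simp)
    (by simp [hvi])
  have := congrFun this k
  simp only [Pi.sub_apply, Pi.smul_apply, smul_eq_mul, Pi.zero_apply] at this
  linear_combination this

lemma analyticAt_det {n : ℕ} (T : ℂ → Matrix (Fin n) (Fin n) ℂ) (z : ℂ)
    (hT : ∀ i j, AnalyticAt ℂ (fun z => T z i j) z) :
    AnalyticAt ℂ (fun z => (T z).det) z := by
  simp only [Matrix.det_apply']
  refine Finset.analyticAt_fun_sum _ fun σ _ => ?_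
  exact analyticAt_const.mul (Finset.analyticAt_fun_prod _ fun i _ => hT _ _)

lemma analyticAt_adjugate {n : ℕ} (T : ℂ → Matrix (Fin n) (Fin n) ℂ) (z : ℂ)
    (hT : ∀ i j, AnalyticAt ℂ (fun z => T z i j) z) (k l : Fin n) :
    AnalyticAt ℂ (fun z => (T z).adjugate k l) z := by
  simp only [Matrix.adjugate_apply]
  refine analyticAt_det (fun z => (T z).updateRow l (Pi.single k 1)) z fun i j => ?_
  by_cases h : i = l
  · subst h
    simpa using analyticAt_const
  · simpa [Matrix.updateRow_ne h] using hT i j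

/-- Patching removable singularities. -/
lemma exists_analytic_patch (Ω : Set ℂ) (f : ℂ → ℂ)
    (hf : ∀ z ∈ Ω, ∃ g : ℂ → ℂ, AnalyticAt ℂ g z ∧ f =ᶠ[𝓝[≠] z] g) :
    ∃ F : ℂ → ℂ, AnalyticOnNhd ℂ F Ω ∧ ∀ z, ContinuousAt f z → F z = f z := by
  refine ⟨fun z => limUnder (𝓝[≠] z) f, fun z hz => ?_, fun z hz => ?_⟩
  · obtain ⟨g, hg, hfg⟩ := hf z hz
    refine hg.congr ?_
    have h1 := hg.eventually_analyticAt
    have h2 := eventually_eventually_nhdsWithin.2 hfg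
    rw [eventually_nhdsWithin_iff] at h2
    have h3 : ∀ᶠ y in 𝓝 z, f =ᶠ[𝓝[≠] y] g := by
      have h4 := eventually_eventually_nhds.2 (eventually_nhdsWithin_iff.1 hfg)
      filter_upwards [h4] with y hy
      by_cases hyz : y = z
      · subst hyz; exact hfg
      · have : ∀ᶠ x in 𝓝 y, x ∈ ({z}ᶜ : Set ℂ) := isOpen_compl_singleton.mem_nhds hyz
        exact (by filter_upwards [hy, this] with x hx hx' using hx hx' :
          ∀ᶠ x in 𝓝 y, f x = g x).filter_mono nhdsWithin_le_nhds
    filter_upwards [h1, h3] with y hy1 hy2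
    have : Tendsto f (𝓝[≠] y) (𝓝 (g y)) :=
      (hy1.continuousAt.tendsto.mono_left nhdsWithin_le_nhds).congr' hy2.symm
    exact this.limUnder_eq.symm
  · exact (hz.tendsto.mono_left nhdsWithin_le_nhds).limUnder_eq

lemma analyticAt_div_sub (q : ℂ → ℂ) (a : ℂ) (hq : AnalyticAt ℂ q a) (h0 : q a = 0) :
    ∃ g : ℂ → ℂ, AnalyticAt ℂ g a ∧ ∀ z, z ≠ a → (z - a)⁻¹ * q z = g z := by
  refine ⟨dslope q a, ?_, fun z hz => ?_⟩
  · obtain ⟨p, hp⟩ := hq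
    exact ⟨_, hp.has_fpower_series_dslope_fslope⟩
  · rw [dslope_of_ne _ hz, slope_def_field, h0]
    rw [sub_zero, div_eq_inv_mul]

/-- The adjugate at a simple eigenvalue. -/
lemma adjugate_at_simple {n : ℕ} (T : ℂ → Matrix (Fin n) (Fin n) ℂ) (a : ℂ)
    (hT : ∀ i j, AnalyticAt ℂ (fun z => T z i j) a)
    (h : ℂ → ℂ) (hh : AnalyticAt ℂ h a)
    (hd : ∀ᶠ z in 𝓝 a, (T z).det = (z - a) ^ 1 * h z)
    (v w : Fin n → ℂ) (hv : v ≠ 0)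
    (hTv : T a *ᵥ v = 0) (hwT : star w ᵥ* T a = 0)
    (hnorm : ∑ i, ∑ k, (starRingEnd ℂ) (w i) * deriv (fun z => T z i k) a * v k = 1)
    (k l : Fin n) : (T a).adjugate k l = h a * (v k * star (w l)) := by
  have hdet : (T a).det = 0 := by simpa using hd.self_of_nhds
  obtain ⟨y, hy⟩ := adjugate_eq_of_kernel (T a) v hv hTv hdet
  have hT' : ∀ i j, HasDerivAt (fun z => T z i j) (deriv (fun z => T z i j) a) a :=
    fun i j => (hT i j).differentiableAt.hasDerivAt
  have hA' : ∀ i j, HasDerivAt (fun z => (T z).adjugate i j)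
      (deriv (fun z => (T z).adjugate i j) a) a :=
    fun i j => (analyticAt_adjugate T a hT i j).differentiableAt.hasDerivAt
  have hL : HasDerivAt (fun z => ∑ i, star (w i) * ∑ k, T z i k * (T z).adjugate k l)
      (∑ i, star (w i) * ∑ k, (deriv (fun z => T z i k) a * (T a).adjugate k l
        + T a i k * deriv (fun z => (T z).adjugate k l) a)) a :=
    HasDerivAt.fun_sum fun i _ => (HasDerivAt.fun_sum fun k _ =>
      (hT' i k).mul (hA' k l)).const_mul _
  have hid : (fun z => ∑ i, star (w i) * ∑ k, T z i k * (T z).adjugate k l)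
      = fun z => (T z).det * star (w l) := by
    funext z
    have : ∀ i, ∑ k, T z i k * (T z).adjugate k l = if i = l then (T z).det else 0 := by
      intro i
      have := congrFun (congrFun (Matrix.mul_adjugate (T z)) i) l
      simpa [Matrix.mul_apply, Matrix.one_apply] using this
    simp [this, mul_comm]
  have hR : HasDerivAt (fun z => (T z).det * star (w l)) (h a * star (w l)) a := by
    refine HasDerivAt.mul_const ?_ _
    have h1 : HasDerivAt (fun z => (z - a) ^ 1 * h z) (h a) a := by
      have := ((hasDerivAt_id a).sub_const a).mul hh.differentiableAt.hasDerivAt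
      simpa [Pi.mul_def] using this
    exact h1.congr_of_eventuallyEq hd
  rw [hid] at hL
  have heq := hL.unique hR
  have hz : ∑ i, star (w i) * ∑ k, T a i k * deriv (fun z => (T z).adjugate k l) a = 0 := by
    simp only [Finset.mul_sum]
    rw [Finset.sum_comm]
    refine Finset.sum_eq_zero fun k _ => ?_
    have := congrFun hwT k
    simp only [Matrix.vecMul, dotProduct, Pi.star_apply, Pi.zero_apply] at this
    simp only [← mul_assoc, ← Finset.sum_mul, this, zero_mul]
  simp only [Finset.sum_add_distrib, mul_add, hz, add_zero] at heq
  have hy' : ∑ i, star (w i) * ∑ k, deriv (fun z => T z i k) a * (T a).adjugate k l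
      = (∑ i, ∑ k, (starRingEnd ℂ) (w i) * deriv (fun z => T z i k) a * v k) * y l := by
    simp only [Finset.mul_sum, Finset.sum_mul, hy]
    refine Finset.sum_congr rfl fun i _ => Finset.sum_congr rfl fun k _ => ?_
    simp only [starRingEnd_apply]
    ring
  rw [hy', hnorm, one_mul] at heq
  rw [hy, heq]
  ring

/-- **Keldysh's theorem** for analytic matrix-valued functions with simple eigenvalues. -/
theorem keldysh_simple_eigenvalues
    (n m : ℕ) (Ω : Set ℂ) (hΩo : IsOpen Ω) (hΩc : IsConnected Ω)
    (T : ℂ → Matrix (Fin n) (Fin n) ℂ)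
    (hT : ∀ i j, AnalyticOnNhd ℂ (fun z => T z i j) Ω)
    (hdet : ∃ z ∈ Ω, (T z).det ≠ 0)
    (lam : Fin m → ℂ) (hmem : ∀ j, lam j ∈ Ω) (hinj : Function.Injective lam)
    (hzeros : ∀ z ∈ Ω, (T z).det = 0 ↔ ∃ j, z = lam j)
    (horder : ∀ j, ZeroOrder (fun z => (T z).det) (lam j) 1)
    (v w : Fin m → Fin n → ℂ)
    (hv : ∀ j, v j ≠ 0) (hw : ∀ j, w j ≠ 0)
    (hTv : ∀ j, T (lam j) *ᵥ v j = 0)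
    (hwT : ∀ j, star (w j) ᵥ* T (lam j) = 0)
    (hnorm : ∀ j, ∑ i, ∑ k,
      (starRingEnd ℂ) (w j i) * deriv (fun z => T z i k) (lam j) * v j k = 1) :
    ∃ N : ℂ → Matrix (Fin n) (Fin n) ℂ,
      (∀ i j, AnalyticOnNhd ℂ (fun z => N z i j) Ω) ∧
      ∀ z ∈ Ω, (T z).det ≠ 0 →
        (T z)⁻¹ = (∑ j, (z - lam j)⁻¹ • vecMulVec (v j) (star (w j))) + N z := by
  have hA : ∀ z ∈ Ω, ∀ k l, AnalyticAt ℂ (fun z => (T z).adjugate k l) z :=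
    fun z hz => analyticAt_adjugate T z fun i j => hT i j z hz
  have hD : ∀ z ∈ Ω, AnalyticAt ℂ (fun z => (T z).det) z :=
    fun z hz => analyticAt_det T z fun i j => hT i j z hz
  let f : Fin n → Fin n → ℂ → ℂ := fun k l z =>
    ((T z).det)⁻¹ * (T z).adjugate k l - ∑ j, (z - lam j)⁻¹ * (v j k * star (w j l))
  have hreg : ∀ z ∈ Ω, (T z).det ≠ 0 → ∀ k l, AnalyticAt ℂ (f k l) z := by
    intro z hz hdz k l
    refine (((hD z hz).fun_inv hdz).fun_mul (hA z hz k l)).fun_sub ?_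
    refine Finset.analyticAt_fun_sum _ fun j _ => ?_
    have : z - lam j ≠ 0 := fun h => hdz ((hzeros z hz).2 ⟨j, sub_eq_zero.1 h⟩)
    exact ((analyticAt_id.fun_sub analyticAt_const).fun_inv this).fun_mul analyticAt_const
  have hloc : ∀ k l, ∀ z ∈ Ω, ∃ g : ℂ → ℂ, AnalyticAt ℂ g z ∧ f k l =ᶠ[𝓝[≠] z] g := by
    intro k l z hz
    by_cases hdz : (T z).det = 0
    swap
    · exact ⟨f k l, hreg z hz hdz k l, EventuallyEq.rfl⟩
    obtain ⟨j, rfl⟩ := (hzeros z hz).1 hdz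
    obtain ⟨h, hh, hh0, hd⟩ := horder j
    have hadj := adjugate_at_simple T (lam j) (fun i k => hT i k _ hz) h hh hd (v j) (w j)
      (hv j) (hTv j) (hwT j) (hnorm j) k l
    obtain ⟨g, hg, hgq⟩ := analyticAt_div_sub
      (fun z => (h z)⁻¹ * (T z).adjugate k l - v j k * star (w j l)) (lam j)
      (((hh.fun_inv hh0).fun_mul (hA _ hz k l)).fun_sub analyticAt_const)
      (by rw [hadj]; field_simp; simp)
    refine ⟨fun z => g z - ∑ i ∈ Finset.univ.erase j, (z - lam i)⁻¹ * (v i k * star (w i l)),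
      hg.fun_sub (Finset.analyticAt_fun_sum _ fun i hi => ?_), ?_⟩
    · have : lam j - lam i ≠ 0 := fun h =>
        (Finset.ne_of_mem_erase hi) (hinj (sub_eq_zero.1 h)).symm
      exact ((analyticAt_id.fun_sub analyticAt_const).fun_inv this).fun_mul analyticAt_const
    · filter_upwards [hd.filter_mono nhdsWithin_le_nhds, self_mem_nhdsWithin] with x hx hne
      simp only [f]
      rw [← hgq x hne, ← Finset.add_sum_erase _ _ (Finset.mem_univ j), hx, pow_one, mul_inv]
      ring
  choose F hF1 hF2 using fun k l => exists_analytic_patch Ω (f k l) (hloc k l)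
  refine ⟨fun z => Matrix.of fun k l => F k l z, fun k l => hF1 k l, fun z hz hdz => ?_⟩
  ext k l
  rw [Matrix.add_apply]
  change _ = _ + F k l z
  rw [hF2 k l z (hreg z hz hdz k l).continuousAt,
    Matrix.inv_def, Matrix.sum_apply]
  simp [f, Matrix.vecMulVec_apply]
end

section
/- Let Ω, Π ⊆ ℂ be domains and let T : ℂ×ℂ → ℂ^{n×n} be analytic on Ω×Π. Assume that for every p ∈ Π, det T(·,p) is not identically zero on Ω and T(·,p) has exactly m eigenvalues in Ω counting algebraic multiplicity. Then there exist functions α_0, …, α_{m−1} : ℂ → ℂ analytic on Π and matrix-valued functions R, N : ℂ×ℂ → ℂ^{n×n} analytic on Ω×Π such that, setting u(z,p) = z^m + α_{m−1}(p) z^{m−1} + ⋯ + α_1(p) z + α_0(p): (i) for every p ∈ Π every root of the polynomial u(·,p) lies in Ω, and for every λ ∈ Ω the multiplicity of λ as a root of u(·,p) equals the order of vanishing of det T(·,p) at λ; (ii) for every p ∈ Π, each entry of z ↦ R(z,p) is a polynomial in z of degree at most m−1; (iii) for every (z,p) ∈ Ω×Π with det T(z,p) ≠ 0, T(z,p)^{-1}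 = R(z,p)/u(z,p) + N(z,p). -/
open Matrix

/-- `g` has a finite zero set in `Ω`, with the orders of vanishing summing to `m`. -/
def EigCount (g : ℂ → ℂ) (Ω : Set ℂ) (m : ℕ) : Prop :=
  ∃ (Z : Finset ℂ) (ord : ℂ → ℕ),
    (↑Z ⊆ Ω) ∧ (∀ z ∈ Ω, g z = 0 ↔ z ∈ Z) ∧
    (∀ z ∈ Z, ZeroOrder g z (ord z)) ∧ ∑ z ∈ Z, ord z = m

/-- The monic degree-`m` polynomial in `z` with coefficients `α j p`. -/
noncomputable def wpoly (m : ℕ) (α : ℕ → ℂ → ℂ) (z p : ℂ) : ℂ :=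
  z ^ m + ∑ j ∈ Finset.range m, α j p * z ^ j

/-- `r` is a polynomial function of degree at most `m - 1`. -/
def PolyDegLt (r : ℂ → ℂ) (m : ℕ) : Prop :=
  ∃ q : Polynomial ℂ, q.degree < (m : WithBot ℕ) ∧ ∀ z, r z = q.eval z

open MeasureTheory Metric Set Filter Topology BoundedContinuousFunction in
lemma pk_K {S : Type*} [TopologicalSpace S] [MeasurableSpace S] [OpensMeasurableSpace S]
    (μ : Measure S) [IsFiniteMeasure μ] (g A B : S →ᵇ ℂ) (z₀ p₀ : ℂ) (ε δ : ℝ) (hε : 0 < ε)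
    (hδ : 0 < δ) (hA : ∀ s, ε ≤ ‖A s - z₀‖) (hB : ∀ s, δ ≤ ‖B s - p₀‖) :
    AnalyticAt ℂ (fun x : ℂ × ℂ => ∫ s, g s * (A s - x.1)⁻¹ * (B s - x.2)⁻¹ ∂μ) (z₀, p₀) := by
  have unit : ∀ (A : S →ᵇ ℂ) (z₀ : ℂ) (ε : ℝ), 0 < ε → (∀ s, ε ≤ ‖A s - z₀‖) →
      IsUnit (A - z₀ • (1 : S →ᵇ ℂ)) := by
    intro A z₀ ε hε hA
    have hne : ∀ s, A s - z₀ ≠ 0 := fun s h => by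
      have := hA s; rw [h, norm_zero] at this; linarith
    let A' : S →ᵇ ℂ := BoundedContinuousFunction.ofNormedAddCommGroup (fun s => (A s - z₀)⁻¹)
      ((A.continuous.sub continuous_const).inv₀ hne) ε⁻¹ (fun s => by
        rw [norm_inv]; exact inv_anti₀ hε (hA s))
    refine IsUnit.of_mul_eq_one A' ?_
    ext s
    simp [A', mul_inv_cancel₀ (hne s)]
  have inv_apply : ∀ (D : S →ᵇ ℂ), IsUnit D → ∀ s, (Ring.inverse D) s = (D s)⁻¹ := by
    intro D hD s
    have h := Ring.mul_inverse_cancel D hD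
    have h2 := congrArg (fun k : S →ᵇ ℂ => k s) h
    simp at h2
    exact eq_inv_of_mul_eq_one_right h2
  let Λ : (S →ᵇ ℂ) →L[ℂ] ℂ := LinearMap.mkContinuous
    { toFun := fun φ => ∫ s, φ s ∂μ
      map_add' := fun φ ψ => by
        simpa using integral_add (φ.integrable μ) (ψ.integrable μ)
      map_smul' := fun c φ => by
        simpa using integral_const_mul c (fun s => φ s) } (μ.real univ) (fun φ => by
      have := norm_integral_le_of_norm_le_const (μ := μ) (f := fun s => φ s) (C := ‖φ‖)
        (Eventually.of_forall fun s => φ.norm_coe_le_norm s)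
      simpa [mul_comm] using this)
  have hΛ : ∀ φ, Λ φ = ∫ s, φ s ∂μ := fun φ => rfl
  have h1 : AnalyticAt ℂ (fun x : ℂ × ℂ => Ring.inverse (A - x.1 • (1 : S →ᵇ ℂ))) (z₀, p₀) := by
    obtain ⟨u, hu⟩ := unit A z₀ ε hε hA
    refine AnalyticAt.fun_comp (g := Ring.inverse) (f := fun x : ℂ × ℂ => A - x.1 • (1 : S →ᵇ ℂ)) ?_ ?_
    · show AnalyticAt ℂ Ring.inverse (A - z₀ • (1 : S →ᵇ ℂ))
      rw [← hu]; exact analyticAt_inverse u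
    · exact analyticAt_const.sub (analyticAt_fst.smul analyticAt_const)
  have h2 : AnalyticAt ℂ (fun x : ℂ × ℂ => Ring.inverse (B - x.2 • (1 : S →ᵇ ℂ))) (z₀, p₀) := by
    obtain ⟨u, hu⟩ := unit B p₀ δ hδ hB
    refine AnalyticAt.fun_comp (g := Ring.inverse) (f := fun x : ℂ × ℂ => B - x.2 • (1 : S →ᵇ ℂ)) ?_ ?_
    · show AnalyticAt ℂ Ring.inverse (B - p₀ • (1 : S →ᵇ ℂ))
      rw [← hu]; exact analyticAt_inverse u
    · exact analyticAt_const.sub (analyticAt_snd.smul analyticAt_const)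
  have h3 : AnalyticAt ℂ (fun x : ℂ × ℂ => Λ (g * Ring.inverse (A - x.1 • (1 : S →ᵇ ℂ)) *
      Ring.inverse (B - x.2 • (1 : S →ᵇ ℂ)))) (z₀, p₀) := by
    have := (analyticAt_const (v := g)).mul h1 |>.mul h2
    exact (Λ.analyticAt _).fun_comp this
  have near : ∀ (A : S →ᵇ ℂ) (z₀ : ℂ) (ε : ℝ), 0 < ε → (∀ s, ε ≤ ‖A s - z₀‖) →
      ∀ᶠ z in 𝓝 z₀, IsUnit (A - z • (1 : S →ᵇ ℂ)) := by
    intro A z₀ ε hε hA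
    filter_upwards [Metric.ball_mem_nhds z₀ (half_pos hε)] with z hz
    refine unit A z (ε / 2) (half_pos hε) fun s => ?_
    have h4 := hA s
    rw [mem_ball, dist_eq_norm] at hz
    have h5 : ‖A s - z₀‖ ≤ ‖A s - z‖ + ‖z - z₀‖ := by
      simpa using norm_add_le (A s - z) (z - z₀)
    linarith
  refine h3.congr ?_
  have e1 : ∀ᶠ x : ℂ × ℂ in 𝓝 (z₀, p₀), IsUnit (A - x.1 • (1 : S →ᵇ ℂ)) :=
    (continuous_fst.tendsto (z₀, p₀)).eventually (near A z₀ ε hε hA)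
  have e2 : ∀ᶠ x : ℂ × ℂ in 𝓝 (z₀, p₀), IsUnit (B - x.2 • (1 : S →ᵇ ℂ)) :=
    (continuous_snd.tendsto (z₀, p₀)).eventually (near B p₀ δ hδ hB)
  filter_upwards [e1, e2] with x hx1 hx2
  rw [hΛ]
  refine integral_congr_ae (Eventually.of_forall fun s => ?_)
  simp [inv_apply _ hx1, inv_apply _ hx2]

open MeasureTheory Metric Set Filter Topology BoundedContinuousFunction in
lemma pk_J (F : ℂ × ℂ → ℂ) (c p₀ z₀ : ℂ) (r : ℝ) (hr : 0 < r) (hz₀ : z₀ ∈ ball c r)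
    (hF : ∀ ζ ∈ sphere c r, AnalyticAt ℂ F (ζ, p₀)) :
    AnalyticAt ℂ (fun x : ℂ × ℂ => ∮ ζ in C(c, r), (ζ - x.1)⁻¹ * F (ζ, x.2)) (z₀, p₀) := by
  obtain ⟨ρ, hρ, hA⟩ : ∃ ρ > 0, ∀ ζ ∈ sphere c r, ∀ p ∈ closedBall p₀ ρ, AnalyticAt ℂ F (ζ, p) := by
    have hop : IsOpen {x | AnalyticAt ℂ F x} := isOpen_analyticAt ℂ F
    obtain ⟨u, v, hu, hv, hsu, hpv, huv⟩ := generalized_tube_lemma (isCompact_sphere c r)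
      (isCompact_singleton (x := p₀)) hop (by
        rintro ⟨ζ, p⟩ ⟨h1, h2⟩
        rw [mem_singleton_iff] at h2
        simp only at h2; subst h2; exact hF ζ h1)
    obtain ⟨ρ, hρ, hb⟩ := Metric.nhds_basis_closedBall.mem_iff.1 (hv.mem_nhds (hpv rfl))
    exact ⟨ρ, hρ, fun ζ hζ p hp => huv ⟨hsu hζ, hb hp⟩⟩
  have hcont : ContinuousOn F (sphere c r ×ˢ closedBall p₀ ρ) := fun x hx =>
    (hA x.1 hx.1 x.2 hx.2).continuousAt.continuousWithinAt
  obtain ⟨M, hM⟩ := ((isCompact_sphere c r).prod (isCompact_closedBall p₀ ρ)).exists_bound_of_continuousOn hcont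
  have hs1 : ∀ t, circleMap c r t ∈ sphere c r := fun t => circleMap_mem_sphere c hr.le t
  have hs2 : ∀ t, circleMap p₀ ρ t ∈ sphere p₀ ρ := fun t => circleMap_mem_sphere p₀ hρ.le t
  have hs2' : ∀ t, circleMap p₀ ρ t ∈ closedBall p₀ ρ := fun t => sphere_subset_closedBall (hs2 t)
  have hcF : Continuous (fun s : ℝ × ℝ => F (circleMap c r s.1, circleMap p₀ ρ s.2)) :=
    hcont.comp_continuous (by fun_prop) (fun s => ⟨hs1 _, hs2' _⟩)
  let A : ℝ × ℝ →ᵇ ℂ := BoundedContinuousFunction.ofNormedAddCommGroup (fun s => circleMap c r s.1)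
      (by fun_prop) (‖c‖ + r) (fun s => by
        have := mem_sphere_iff_norm.1 (hs1 s.1)
        calc ‖circleMap c r s.1‖ = ‖c + (circleMap c r s.1 - c)‖ := by ring_nf
          _ ≤ _ := norm_add_le _ _
          _ = _ := by rw [this])
  let B : ℝ × ℝ →ᵇ ℂ := BoundedContinuousFunction.ofNormedAddCommGroup (fun s => circleMap p₀ ρ s.2)
      (by fun_prop) (‖p₀‖ + ρ) (fun s => by
        have := mem_sphere_iff_norm.1 (hs2 s.2)
        calc ‖circleMap p₀ ρ s.2‖ = ‖p₀ + (circleMap p₀ ρ s.2 - p₀)‖ := by ring_nf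
          _ ≤ _ := norm_add_le _ _
          _ = _ := by rw [this])
  let g : ℝ × ℝ →ᵇ ℂ := BoundedContinuousFunction.ofNormedAddCommGroup
      (fun s => (circleMap 0 r s.1 * Complex.I) * (circleMap 0 ρ s.2 * Complex.I) *
        F (circleMap c r s.1, circleMap p₀ ρ s.2))
      (Continuous.mul (by fun_prop) hcF) (r * ρ * M) (fun s => by
        have := hM (circleMap c r s.1, circleMap p₀ ρ s.2) ⟨hs1 _, hs2' _⟩
        simp only [norm_mul, norm_circleMap_zero, Complex.norm_I, mul_one, abs_of_pos hr, abs_of_pos hρ]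
        gcongr)
  let μ : Measure ℝ := volume.restrict (Ioc 0 (2 * Real.pi))
  have key := pk_K (μ.prod μ) g A B z₀ p₀ (r - dist z₀ c) ρ (by simpa using hz₀) hρ
    (fun s => by
      have h1 : dist (circleMap c r s.1) c = r := hs1 s.1
      have h2 := dist_triangle (circleMap c r s.1) z₀ c
      rw [← dist_eq_norm]
      show _ ≤ dist (circleMap c r s.1) z₀
      linarith)
    (fun s => by
      have h1 : dist (circleMap p₀ ρ s.2) p₀ = ρ := hs2 s.2
      rw [← dist_eq_norm]; exact h1.ge)
  have key2 := (analyticAt_const (v := (2 * Real.pi * Complex.I : ℂ)⁻¹)).mul key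
  refine key2.congr ?_
  have e1 : ∀ᶠ x : ℂ × ℂ in 𝓝 (z₀, p₀), x.1 ∈ ball c r :=
    (continuous_fst.tendsto (z₀, p₀)).eventually (isOpen_ball.mem_nhds hz₀)
  have e2 : ∀ᶠ x : ℂ × ℂ in 𝓝 (z₀, p₀), x.2 ∈ ball p₀ ρ :=
    (continuous_snd.tendsto (z₀, p₀)).eventually (ball_mem_nhds p₀ hρ)
  filter_upwards [e1, e2] with x hx1 hx2
  have hcau : ∀ ζ ∈ sphere c r, (∮ q in C(p₀, ρ), (q - x.2)⁻¹ • F (ζ, q)) =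
      (2 * Real.pi * Complex.I : ℂ) • F (ζ, x.2) := by
    intro ζ hζ
    have : DifferentiableOn ℂ (fun q => F (ζ, q)) (closedBall p₀ ρ) := fun q hq =>
      ((hA ζ hζ q hq).differentiableAt.comp q
        (by fun_prop : DifferentiableAt ℂ (fun q : ℂ => (ζ, q)) q)).differentiableWithinAt
    exact this.circleIntegral_sub_inv_smul hx2
  have hne1 : ∀ t, circleMap c r t - x.1 ≠ 0 := fun t h => by
    have h1 : dist (circleMap c r t) c = r := hs1 t
    rw [sub_eq_zero.1 h] at h1
    exact absurd hx1 (by simp [h1])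
  have hne2 : ∀ t, circleMap p₀ ρ t - x.2 ≠ 0 := fun t h => by
    have h1 : dist (circleMap p₀ ρ t) p₀ = ρ := hs2 t
    rw [sub_eq_zero.1 h] at h1
    exact absurd hx2 (by simp [h1])
  have hint : Integrable (fun s => g s * (A s - x.1)⁻¹ * (B s - x.2)⁻¹) (μ.prod μ) := by
    have hc : Continuous (fun s => g s * (A s - x.1)⁻¹ * (B s - x.2)⁻¹) := by
      refine (g.continuous.mul ((A.continuous.sub continuous_const).inv₀ fun s => hne1 _)).mul
        ((B.continuous.sub continuous_const).inv₀ fun s => hne2 _)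
    have : μ.prod μ = (volume : Measure (ℝ × ℝ)).restrict (Ioc 0 (2 * Real.pi) ×ˢ Ioc 0 (2 * Real.pi)) := by
      rw [Measure.prod_restrict]; rfl
    rw [this]
    refine (hc.continuousOn.integrableOn_compact
      ((isCompact_Icc (a := (0:ℝ)) (b := 2 * Real.pi)).prod (isCompact_Icc (a := (0:ℝ)) (b := 2 * Real.pi)))).mono_set ?_
    exact Set.prod_mono Ioc_subset_Icc_self Ioc_subset_Icc_self
  rw [Pi.mul_apply, integral_prod _ hint]
  have h2pi : (2 * Real.pi * Complex.I : ℂ) ≠ 0 := Complex.two_pi_I_ne_zero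
  rw [inv_mul_eq_iff_eq_mul₀ h2pi]
  unfold circleIntegral
  rw [intervalIntegral.integral_of_le (by positivity), ← integral_const_mul]
  refine integral_congr_ae (Eventually.of_forall fun t => ?_)
  have h := hcau _ (hs1 t)
  unfold circleIntegral at h
  rw [intervalIntegral.integral_of_le (by positivity)] at h
  simp only [deriv_circleMap, smul_eq_mul] at h ⊢
  rw [show 2 * (Real.pi : ℂ) * Complex.I * (circleMap 0 r t * Complex.I * ((circleMap c r t - x.1)⁻¹ * F (circleMap c r t, x.2)))
    = (circleMap 0 r t * Complex.I * (circleMap c r t - x.1)⁻¹) * (2 * (Real.pi : ℂ) * Complex.I * F (circleMap c r t, x.2)) by ring, ← h, ← integral_const_mul]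
  refine integral_congr_ae (Eventually.of_forall fun t' => ?_)
  simp only [g, A, B, BoundedContinuousFunction.coe_ofNormedAddCommGroup]
  ring

open Polynomial in
lemma pk_dslope {Ω : Set ℂ} (hΩ : IsOpen Ω) {G : ℂ → ℂ} (hG : AnalyticOnNhd ℂ G Ω) {a : ℂ}
    (ha : a ∈ Ω) : ∃ G₁ : ℂ → ℂ, AnalyticOnNhd ℂ G₁ Ω ∧ ∀ z, G z = G a + (z - a) * G₁ z := by
  refine ⟨dslope G a, ?_, fun z => ?_⟩
  · have := (Complex.differentiableOn_dslope (hΩ.mem_nhds ha)).2 hG.differentiableOn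
    exact this.analyticOnNhd hΩ
  · have := sub_smul_dslope G a z
    rw [smul_eq_mul] at this
    rw [this]; ring

open Topology Filter in
lemma pk_split {Ω : Set ℂ} {h : ℂ → ℂ} (hh : AnalyticOnNhd ℂ h Ω) {a : ℂ} {k : ℕ}
    (hz : ZeroOrder h a k) :
    ∃ h' : ℂ → ℂ, AnalyticOnNhd ℂ h' Ω ∧ h' a ≠ 0 ∧ ∀ z ∈ Ω, h z = (z - a) ^ k * h' z := by
  obtain ⟨g, hg, hga, hge⟩ := hz
  classical
  let h' : ℂ → ℂ := fun z => if z = a then g a else h z / (z - a) ^ k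
  have hne : ∀ z, z ≠ a → h' z = h z / (z - a) ^ k := fun z hz => by simp [h', hz]
  have haa : h' a = g a := by simp [h']
  refine ⟨h', ?_, by rwa [haa], ?_⟩
  · intro z hz
    by_cases hza : z = a
    · subst hza
      refine hg.congr ?_
      filter_upwards [hge] with w hw
      by_cases hwz : w = z
      · rw [hwz, haa]
      · rw [hne w hwz, hw, mul_div_cancel_left₀ _ (pow_ne_zero _ (sub_ne_zero.2 hwz))]
    · have h1 : AnalyticAt ℂ (fun w => h w / (w - a) ^ k) z :=
        (hh z hz).div ((analyticAt_id.sub analyticAt_const).pow k)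
          (pow_ne_zero _ (sub_ne_zero.2 hza))
      refine h1.congr ?_
      filter_upwards [isOpen_ne.mem_nhds hza] with w hw
      rw [hne w hw]
  · intro z hz
    by_cases hza : z = a
    · subst hza; rw [haa]; exact hge.self_of_nhds
    · rw [hne z hza, mul_div_cancel₀ _ (pow_ne_zero _ (sub_ne_zero.2 hza))]

open Topology Filter Polynomial in
lemma pk_fact {Ω : Set ℂ} {f : ℂ → ℂ} {m : ℕ} (hΩ : IsOpen Ω)
    (hf : AnalyticOnNhd ℂ f Ω) (hc : EigCount f Ω m) :
    ∃ (U : ℂ[X]) (h : ℂ → ℂ), U.Monic ∧ U.natDegree = m ∧ (∀ z, U.eval z = 0 → z ∈ Ω) ∧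
      AnalyticOnNhd ℂ h Ω ∧ (∀ z ∈ Ω, h z ≠ 0) ∧ (∀ z ∈ Ω, f z = U.eval z * h z) ∧
      ∃ Z : Finset ℂ, ↑Z ⊆ Ω ∧ (∀ z ∈ Ω, f z = 0 ↔ z ∈ Z) := by
  classical
  obtain ⟨Z, ord, hZΩ, hZ, hord, hsum⟩ := hc
  have main : ∀ W : Finset ℂ, W ⊆ Z → ∃ h : ℂ → ℂ, AnalyticOnNhd ℂ h Ω ∧ (∀ z ∈ W, h z ≠ 0) ∧
      ∀ z ∈ Ω, f z = (∏ a ∈ W, (z - a) ^ ord a) * h z := by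
    intro W
    induction W using Finset.induction_on with
    | empty => intro _; exact ⟨f, hf, by simp, by simp⟩
    | insert a W haW ih =>
      intro hW
      obtain ⟨h, hh, hne, he⟩ := ih (fun x hx => hW (Finset.mem_insert_of_mem hx))
      have haZ : a ∈ Z := hW (Finset.mem_insert_self _ _)
      have haΩ : a ∈ Ω := hZΩ haZ
      have hP : AnalyticAt ℂ (fun z => ∏ b ∈ W, (z - b) ^ ord b) a :=
        Finset.analyticAt_fun_prod _ fun b _ => (analyticAt_id.sub analyticAt_const).pow _
      have hPa : (∏ b ∈ W, (a - b) ^ ord b) ≠ 0 :=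
        Finset.prod_ne_zero_iff.2 fun b hb => pow_ne_zero _ (sub_ne_zero.2 (by
          rintro rfl; exact haW hb))
      have hzo : ZeroOrder h a (ord a) := by
        obtain ⟨g, hg, hga, hge⟩ := hord a haZ
        refine ⟨fun z => g z / ∏ b ∈ W, (z - b) ^ ord b, hg.div hP hPa, div_ne_zero hga hPa, ?_⟩
        filter_upwards [hge, hΩ.mem_nhds haΩ, hP.continuousAt.eventually_ne hPa] with z h1 h2 h3
        rw [he z h2] at h1
        rw [← mul_div_assoc, ← h1, mul_div_cancel_left₀ _ h3]
      obtain ⟨h', hh', ha', he'⟩ := pk_split hh hzo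
      refine ⟨h', hh', ?_, ?_⟩
      · intro z hz
        rcases Finset.mem_insert.1 hz with rfl | hz
        · exact ha'
        · intro h0
          have := he' z (hZΩ (hW (Finset.mem_insert_of_mem hz)))
          rw [h0, mul_zero] at this
          exact hne z hz this
      · intro z hz
        rw [Finset.prod_insert haW, he z hz, he' z hz]; ring
  obtain ⟨h, hh, hne, he⟩ := main Z subset_rfl
  have hev : ∀ z, (∏ a ∈ Z, (X - C a) ^ ord a : ℂ[X]).eval z = ∏ a ∈ Z, (z - a) ^ ord a := by
    intro z; simp [eval_prod]
  refine ⟨∏ a ∈ Z, (X - C a) ^ ord a, h, ?_, ?_, ?_, hh, ?_, ?_, Z, hZΩ, hZ⟩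
  · exact monic_prod_of_monic _ _ fun a _ => (monic_X_sub_C a).pow _
  · rw [natDegree_prod_of_monic _ _ fun a _ => (monic_X_sub_C a).pow _, ← hsum]
    refine Finset.sum_congr rfl fun a _ => ?_
    rw [natDegree_pow, natDegree_X_sub_C, mul_one]
  · intro z hz
    rw [hev] at hz
    obtain ⟨a, ha, h0⟩ := Finset.prod_eq_zero_iff.1 hz
    have := sub_eq_zero.1 (eq_zero_of_pow_eq_zero h0)
    rw [this]; exact hZΩ ha
  · intro z hz h0
    have h1 := he z hz
    rw [h0, mul_zero] at h1
    exact hne z ((hZ z hz).1 h1) h0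
  · intro z hz; rw [hev]; exact he z hz

open Polynomial in
lemma pk_div {Ω : Set ℂ} (hΩ : IsOpen Ω) (s : Multiset ℂ) : ∀ (_ : ∀ a ∈ s, a ∈ Ω) {G : ℂ → ℂ}
    (_ : AnalyticOnNhd ℂ G Ω),
    ∃ (r : ℂ[X]) (N : ℂ → ℂ), r.degree < (Multiset.card s : WithBot ℕ) ∧ AnalyticOnNhd ℂ N Ω ∧
      ∀ z, G z = (s.map (fun a => X - C a)).prod.eval z * N z + r.eval z := by
  induction s using Multiset.induction_on with
  | empty => 
    intro _ G hG
    exact ⟨0, G, by simp, hG, by simp⟩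
  | cons a s ih =>
    intro hs G hG
    obtain ⟨G₁, hG₁, he⟩ := pk_dslope hΩ hG (hs a (Multiset.mem_cons_self a s))
    obtain ⟨r, N, hr, hN, hrN⟩ := ih (fun b hb => hs b (Multiset.mem_cons_of_mem hb)) hG₁
    refine ⟨(X - C a) * r + C (G a), N, ?_, hN, fun z => ?_⟩
    · rw [Multiset.card_cons]
      refine (degree_add_le _ _).trans_lt (max_lt ?_ ?_)
      · rw [degree_mul, degree_X_sub_C]
        by_cases h0 : r = 0
        · subst h0; simp
        · rw [degree_eq_natDegree h0] at hr ⊢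
          norm_cast at hr ⊢
          omega
      · exact degree_C_le.trans_lt (by exact_mod_cast Nat.succ_pos _)
    · rw [he z, hrN z]
      simp
      ring

open Polynomial in
lemma pk_div' {Ω : Set ℂ} (hΩ : IsOpen Ω) {U : ℂ[X]} (hU : U.Monic)
    (hroot : ∀ z, U.eval z = 0 → z ∈ Ω) {G : ℂ → ℂ}
    (hG : AnalyticOnNhd ℂ G Ω) :
    ∃ (r : ℂ[X]) (N : ℂ → ℂ), r.degree < (U.natDegree : WithBot ℕ) ∧ AnalyticOnNhd ℂ N Ω ∧
      ∀ z, G z = U.eval z * N z + r.eval z := by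
  have hs := IsAlgClosed.splits U
  have h1 := hs.eq_prod_roots_of_monic hU
  have h2 := hs.natDegree_eq_card_roots
  obtain ⟨r, N, hr, hN, h⟩ := pk_div hΩ U.roots (fun a ha => hroot a (isRoot_of_mem_roots ha)) hG
  rw [← h1] at h
  rw [← h2] at hr
  exact ⟨r, N, hr, hN, h⟩

open Polynomial in
lemma pk_poly_an (g : ℂ[X]) (Ω : Set ℂ) : AnalyticOnNhd ℂ (fun z => g.eval z) Ω :=
  AnalyticOnNhd.eval_polynomial g |>.mono (Set.subset_univ _)

/-- Sum of circle integrals around the points of `Z`. -/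
noncomputable def pkL (Z : Finset ℂ) (r : ℝ) (g : ℂ → ℂ) : ℂ := ∑ a ∈ Z, ∮ z in C(a, r), g z

/-- The circles are admissible. -/
def PkGood (Ω : Set ℂ) (Z : Finset ℂ) (r : ℝ) : Prop :=
  0 < r ∧ ∀ a ∈ Z, Metric.closedBall a r ⊆ Ω ∧ ∀ b ∈ Z, b ∈ Metric.closedBall a r → b = a

/-- The union of the circles. -/
def pkS (Z : Finset ℂ) (r : ℝ) : Set ℂ := {z | ∃ a ∈ Z, z ∈ Metric.sphere a r}

open Filter Topology Metric in
lemma pk_good {Ω : Set ℂ} (hΩ : IsOpen Ω) (Z : Finset ℂ) (hZ : ↑Z ⊆ Ω) :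
    ∃ r, PkGood Ω Z r := by
  have h1 : ∀ a ∈ Z, ∀ᶠ r : ℝ in 𝓝[>] 0, closedBall a r ⊆ Ω ∧ ∀ b ∈ Z, b ∈ closedBall a r → b = a := by
    intro a ha
    refine Filter.Eventually.and ?_ ?_
    · obtain ⟨ε, hε, hb⟩ := Metric.nhds_basis_closedBall.mem_iff.1 (hΩ.mem_nhds (hZ ha))
      filter_upwards [Ioo_mem_nhdsGT hε] with r hr
      exact (closedBall_subset_closedBall hr.2.le).trans hb
    · rw [Filter.eventually_all_finset]
      intro b hb
      by_cases hab : b = a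
      · exact Eventually.of_forall fun _ _ => hab
      · filter_upwards [Ioo_mem_nhdsGT (dist_pos.2 hab)] with r hr hbr
        exact absurd (mem_closedBall.1 hbr) (not_le.2 hr.2)
  have h2 := (Filter.eventually_all_finset Z).2 h1
  obtain ⟨r, hr1, hr2⟩ := (h2.and self_mem_nhdsWithin).exists
  exact ⟨r, hr2, hr1⟩

lemma pkS_sub {Ω : Set ℂ} {Z : Finset ℂ} {r : ℝ} (hg : PkGood Ω Z r) {z : ℂ} (hz : z ∈ pkS Z r) :
    z ∈ Ω := by
  obtain ⟨a, ha, hz⟩ := hz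
  exact (hg.2 a ha).1 (Metric.sphere_subset_closedBall hz)

lemma pkS_notMem {Ω : Set ℂ} {Z : Finset ℂ} {r : ℝ} (hg : PkGood Ω Z r) {z : ℂ} (hz : z ∈ pkS Z r) :
    z ∉ Z := by
  obtain ⟨a, ha, hz⟩ := hz
  intro hzZ
  have := (hg.2 a ha).2 z hzZ (Metric.sphere_subset_closedBall hz)
  subst this
  have h := hg.1
  simp at hz
  linarith

lemma pkS_compact (Z : Finset ℂ) (r : ℝ) : IsCompact (pkS Z r) := by
  have : pkS Z r = ⋃ a ∈ Z, Metric.sphere a r := by ext; simp [pkS]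
  rw [this]
  exact Z.isCompact_biUnion fun a _ => isCompact_sphere a r

lemma pkL_congr {Z : Finset ℂ} {r : ℝ} (hr : 0 < r) {g₁ g₂ : ℂ → ℂ}
    (h : ∀ z ∈ pkS Z r, g₁ z = g₂ z) : pkL Z r g₁ = pkL Z r g₂ :=
  Finset.sum_congr rfl fun a ha => circleIntegral.integral_congr hr.le fun z hz => h z ⟨a, ha, hz⟩

lemma pkL_zero {Ω : Set ℂ} {Z : Finset ℂ} {r : ℝ} (hg : PkGood Ω Z r) {g : ℂ → ℂ}
    (h : AnalyticOnNhd ℂ g Ω) : pkL Z r g = 0 := by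
  refine Finset.sum_eq_zero fun a ha => ?_
  have := (h.differentiableOn.mono (hg.2 a ha).1)
  exact (this.diffContOnCl_ball subset_rfl).circleIntegral_eq_zero hg.1.le

lemma pkL_cauchy {Ω : Set ℂ} {Z : Finset ℂ} {r : ℝ} (hg : PkGood Ω Z r) {g : ℂ → ℂ}
    (h : AnalyticOnNhd ℂ g Ω) {a : ℂ} (ha : a ∈ Z) :
    pkL Z r (fun z => (z - a)⁻¹ * g z) = 2 * Real.pi * Complex.I * g a := by
  unfold pkL
  rw [Finset.sum_eq_single_of_mem a ha]
  · have := (h.differentiableOn.mono (hg.2 a ha).1)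
    simpa using this.circleIntegral_sub_inv_smul (Metric.mem_ball_self hg.1)
  · intro b hb hba
    have hd : DifferentiableOn ℂ (fun z => (z - a)⁻¹ * g z) (Metric.closedBall b r) := by
      intro z hz
      refine DifferentiableWithinAt.mul ?_ ((h.differentiableOn.mono (hg.2 b hb).1) z hz)
      refine DifferentiableWithinAt.inv (by fun_prop) (sub_ne_zero.2 ?_)
      rintro rfl
      exact hba ((hg.2 b hb).2 z ha hz).symm
    exact (hd.diffContOnCl_ball subset_rfl).circleIntegral_eq_zero hg.1.le

lemma pkL_sum {ι : Type*} {Z : Finset ℂ} {r : ℝ} (hr : 0 < r) (s : Finset ι) (c : ι → ℂ)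
    (g : ι → ℂ → ℂ) (h : ∀ i ∈ s, ContinuousOn (g i) (pkS Z r)) :
    pkL Z r (fun z => ∑ i ∈ s, c i * g i z) = ∑ i ∈ s, c i * pkL Z r (g i) := by
  unfold pkL
  simp_rw [Finset.mul_sum]
  rw [Finset.sum_comm]
  refine Finset.sum_congr rfl fun a ha => ?_
  rw [circleIntegral.integral_fun_sum]
  · simp
  · intro i hi
    refine ContinuousOn.circleIntegrable hr.le ?_
    exact continuousOn_const.mul ((h i hi).mono fun z hz => ⟨a, ha, hz⟩)

lemma pkL_add {Z : Finset ℂ} {r : ℝ} (hr : 0 < r) {g₁ g₂ : ℂ → ℂ}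
    (h₁ : ContinuousOn g₁ (pkS Z r)) (h₂ : ContinuousOn g₂ (pkS Z r)) :
    pkL Z r (fun z => g₁ z + g₂ z) = pkL Z r g₁ + pkL Z r g₂ := by
  unfold pkL
  rw [← Finset.sum_add_distrib]
  refine Finset.sum_congr rfl fun a ha => ?_
  exact circleIntegral.integral_add 
    (ContinuousOn.circleIntegrable hr.le (h₁.mono fun z hz => ⟨a, ha, hz⟩))
    (ContinuousOn.circleIntegrable hr.le (h₂.mono fun z hz => ⟨a, ha, hz⟩))

lemma pkL_param {Z : Finset ℂ} {r : ℝ} (hr : 0 < r) (F : ℂ × ℂ → ℂ) (p₀ : ℂ)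
    (hF : ∀ ζ ∈ pkS Z r, AnalyticAt ℂ F (ζ, p₀)) :
    AnalyticAt ℂ (fun p => pkL Z r (fun ζ => F (ζ, p))) p₀ := by
  unfold pkL
  refine Finset.analyticAt_fun_sum _ fun a ha => ?_
  have key := pk_J (fun x => (x.1 - a) * F x) a p₀ a r hr (Metric.mem_ball_self hr)
    (fun ζ hζ => (analyticAt_fst.sub analyticAt_const).mul (hF ζ ⟨a, ha, hζ⟩))
  have key2 := AnalyticAt.fun_comp (f := fun p : ℂ => (a, p)) (x := p₀) key
    (analyticAt_const.prod analyticAt_id)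
  refine key2.congr (Filter.Eventually.of_forall fun p => ?_)
  refine circleIntegral.integral_congr hr.le fun z hz => ?_
  have : z - a ≠ 0 := sub_ne_zero.2 (by rintro rfl; simp at hz; linarith)
  simp only
  rw [inv_mul_cancel_left₀ this]

open Polynomial in
lemma pk_nondeg {Ω : Set ℂ} {Z : Finset ℂ} {r : ℝ} (hg : PkGood Ω Z r) (w : ℂ → ℂ)
    (hw : AnalyticOnNhd ℂ w Ω) (hw0 : ∀ a ∈ Z, w a ≠ 0) (s : Multiset ℂ) :
    ∀ (_ : ∀ a ∈ s, a ∈ Z) (g : ℂ[X]), g.degree < (Multiset.card s : WithBot ℕ) →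
    (∀ P : ℂ[X], pkL Z r (fun z => P.eval z * g.eval z * w z /
      (s.map (fun a => X - C a)).prod.eval z) = 0) → g = 0 := by
  induction s using Multiset.induction_on with
  | empty =>
    intro _ g hd _
    simpa using hd
  | cons a s ih =>
    intro hs g hd h
    have haZ : a ∈ Z := hs a (Multiset.mem_cons_self a s)
    have hs' : ∀ b ∈ s, b ∈ Z := fun b hb => hs b (Multiset.mem_cons_of_mem hb)
    have hne : ∀ z ∈ pkS Z r, ∀ b ∈ Z, z - b ≠ 0 := fun z hz b hb => sub_ne_zero.2 (by
      rintro rfl; exact pkS_notMem hg hz hb)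
    have hU1 : ∀ z ∈ pkS Z r, (s.map (fun a => X - C a)).prod.eval z ≠ 0 := by
      intro z hz h0
      rw [eval_multiset_prod, Multiset.prod_eq_zero_iff, Multiset.map_map] at h0
      obtain ⟨b, hb, h1⟩ := Multiset.mem_map.1 h0
      simp at h1
      exact hne z hz b (hs' b hb) h1
    have h1 := h (s.map (fun a => X - C a)).prod
    have h2 : pkL Z r (fun z => (z - a)⁻¹ * (g.eval z * w z)) = 0 := by
      rw [← h1]
      refine pkL_congr hg.1 fun z hz => ?_
      have := hU1 z hz
      have := hne z hz a haZ
      rw [Multiset.map_cons, Multiset.prod_cons, eval_mul]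
      simp only [eval_sub, eval_X, eval_C]
      field_simp
    rw [pkL_cauchy hg ((pk_poly_an g Ω).mul hw) haZ] at h2
    have hga : g.eval a = 0 := by
      have h3 := (mul_eq_zero.1 h2).resolve_left Complex.two_pi_I_ne_zero
      simpa using (mul_eq_zero.1 h3).resolve_right (hw0 a haZ)
    obtain ⟨g₁, rfl⟩ := dvd_iff_isRoot.2 hga
    have : g₁ = 0 := by
      refine ih hs' g₁ ?_ ?_
      · by_cases h0 : g₁ = 0
        · subst h0; simp
        · rw [degree_mul, degree_X_sub_C, Multiset.card_cons] at hd
          rw [degree_eq_natDegree h0] at hd ⊢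
          norm_cast at hd ⊢
          omega
      · intro P
        rw [← h P]
        refine pkL_congr hg.1 fun z hz => ?_
        have := hU1 z hz
        have := hne z hz a haZ
        rw [Multiset.map_cons, Multiset.prod_cons, eval_mul, eval_mul]
        simp only [eval_sub, eval_X, eval_C]
        field_simp
    rw [this, mul_zero]

open Polynomial in
lemma pk_hankel {Ω : Set ℂ} {Z : Finset ℂ} {r : ℝ} (hg : PkGood Ω Z r) (w : ℂ → ℂ)
    (hw : AnalyticOnNhd ℂ w Ω) (hw0 : ∀ a ∈ Z, w a ≠ 0) {m : ℕ} {U : ℂ[X]} (hU : U.Monic)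
    (hm : U.natDegree = m) (hroot : ∀ z, U.eval z = 0 → z ∈ Z) :
    (Matrix.of fun k j : Fin m => pkL Z r (fun z => z ^ (j + k : ℕ) * w z / U.eval z)).det ≠ 0 := by
  intro hdet
  obtain ⟨v, hv, hv0⟩ := Matrix.exists_mulVec_eq_zero_iff.2 hdet
  apply hv
  have hs := IsAlgClosed.splits U
  have e1 := hs.eq_prod_roots_of_monic hU
  have e2 := hs.natDegree_eq_card_roots
  have hUS : ∀ z ∈ pkS Z r, U.eval z ≠ 0 := fun z hz h0 => pkS_notMem hg hz (hroot z h0)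
  have hwc : ContinuousOn w (pkS Z r) := fun z hz => (hw z (pkS_sub hg hz)).continuousAt.continuousWithinAt
  have hcont : ∀ P : ℂ[X], ContinuousOn (fun z => P.eval z * w z / U.eval z) (pkS Z r) := fun P =>
    (P.continuous.continuousOn.mul hwc).div U.continuous.continuousOn hUS
  let g : ℂ[X] := ∑ j : Fin m, C (v j) * X ^ (j : ℕ)
  have hgev : ∀ z, g.eval z = ∑ j : Fin m, v j * z ^ (j : ℕ) := fun z => by
    simp [g, eval_finsetSum]
  have hgdeg : g.degree < (m : WithBot ℕ) := by
    exact degree_sum_fin_lt v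
  have hk : ∀ k : Fin m, pkL Z r (fun z => (X ^ (k : ℕ) * g).eval z * w z / U.eval z) = 0 := by
    intro k
    have h1 := congrFun hv0 k
    simp only [Matrix.mulVec, dotProduct, Matrix.of_apply, Pi.zero_apply] at h1
    rw [← h1]
    have h2 := pkL_sum hg.1 Finset.univ v (fun (j : Fin m) z => z ^ (j + k : ℕ) * w z / U.eval z)
      (fun j _ => by simpa using hcont (X ^ (j + k : ℕ)))
    rw [show (∑ x : Fin m, pkL Z r (fun z => z ^ (x + k : ℕ) * w z / U.eval z) * v x) = 
      ∑ i : Fin m, v i * pkL Z r (fun z => z ^ (i + k : ℕ) * w z / U.eval z) from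
      Finset.sum_congr rfl fun _ _ => mul_comm _ _, ← h2]
    refine pkL_congr hg.1 fun z _ => ?_
    rw [eval_mul, hgev, Finset.mul_sum, Finset.sum_mul, Finset.sum_div]
    refine Finset.sum_congr rfl fun j _ => ?_
    simp; ring
  have hg0 : g = 0 := by
    refine pk_nondeg hg w hw hw0 U.roots (fun a ha => hroot a (isRoot_of_mem_roots ha)) g
      (by rw [← e2, hm]; exact hgdeg) ?_
    intro P
    rw [← e1]
    have hsplit : ∀ z ∈ pkS Z r, P.eval z * g.eval z * w z / U.eval z =
        (∑ k ∈ Finset.range m, (P %ₘ U).coeff k * ((X ^ k * g).eval z * w z / U.eval z)) +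
        (P /ₘ U).eval z * g.eval z * w z := by
      intro z hz
      have h1 : P.eval z = (P %ₘ U).eval z + U.eval z * (P /ₘ U).eval z := by
        conv_lhs => rw [← modByMonic_add_div P U]
        simp
      have h2 : (P %ₘ U).eval z = ∑ k ∈ Finset.range m, (P %ₘ U).coeff k * z ^ k := by
        by_cases hm0 : m = 0
        · have : U = 1 := by
            refine hU.natDegree_eq_zero.1 ?_
            rw [hm, hm0]
          subst this; simp [hm0]
        · refine eval_eq_sum_range' ?_ z
          rw [← hm]
          refine natDegree_modByMonic_lt _ hU ?_
          rintro rfl; simp at hm; exact hm0 hm.symm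
      rw [h1, h2]
      have := hUS z hz
      rw [add_mul, add_mul, add_div, Finset.sum_mul, Finset.sum_mul, Finset.sum_div]
      congr 1
      · refine Finset.sum_congr rfl fun k _ => ?_
        simp; ring
      · field_simp
    rw [pkL_congr hg.1 hsplit, pkL_add hg.1, pkL_sum hg.1, pkL_zero hg, add_zero]
    · refine Finset.sum_eq_zero fun k hkm => ?_
      rw [hk ⟨k, Finset.mem_range.1 hkm⟩, mul_zero]
    · exact ((pk_poly_an (P /ₘ U) Ω).mul
        (pk_poly_an g Ω)).mul hw
    · intro k _; exact hcont _
    · exact continuousOn_finsetSum _ fun k _ => continuousOn_const.mul (hcont _)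
    · exact (((P /ₘ U).continuous.mul g.continuous).continuousOn.mul hwc)
  ext j
  have h3 : g.coeff j = v j := by
    simp only [g, finsetSum_coeff, coeff_C_mul, coeff_X_pow]
    rw [Finset.sum_eq_single j]
    · simp
    · intro b _ hb
      have : (j : ℕ) ≠ b := fun h => hb (Fin.ext h.symm)
      simp [this]
    · simp
  rw [← h3, hg0]; simp

lemma pk_det_an {E : Type*} [NormedAddCommGroup E] [NormedSpace ℂ E] {n : ℕ}
    {M : E → Matrix (Fin n) (Fin n) ℂ} {x : E} (h : ∀ i j, AnalyticAt ℂ (fun e => M e i j) x) :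
    AnalyticAt ℂ (fun e => (M e).det) x := by
  simp only [Matrix.det_apply']
  exact Finset.analyticAt_fun_sum _ fun σ _ => analyticAt_const.mul
    (Finset.analyticAt_fun_prod _ fun i _ => h _ _)

lemma pk_adj_an {E : Type*} [NormedAddCommGroup E] [NormedSpace ℂ E] {n : ℕ}
    {M : E → Matrix (Fin n) (Fin n) ℂ} {x : E} (h : ∀ i j, AnalyticAt ℂ (fun e => M e i j) x)
    (i j : Fin n) : AnalyticAt ℂ (fun e => (M e).adjugate i j) x := by
  simp only [Matrix.adjugate_apply]
  refine pk_det_an fun a b => ?_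
  by_cases haj : a = j
  · subst haj
    simp only [Matrix.updateRow_self]
    exact analyticAt_const
  · simp only [Matrix.updateRow_ne haj]
    exact h a b

lemma pk_solve {n : ℕ} {M : ℂ → Matrix (Fin n) (Fin n) ℂ} {x b : ℂ → Fin n → ℂ} {p₀ : ℂ}
    (hM : ∀ i j, AnalyticAt ℂ (fun e => M e i j) p₀) (hb : ∀ i, AnalyticAt ℂ (fun e => b e i) p₀)
    (hd : (M p₀).det ≠ 0) (he : ∀ᶠ p in nhds p₀, M p *ᵥ x p = b p) (j : Fin n) :
    AnalyticAt ℂ (fun p => x p j) p₀ := by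
  have hdet := pk_det_an hM
  have h1 : AnalyticAt ℂ (fun p => ((M p).det)⁻¹ * ∑ i, (M p).adjugate j i * b p i) p₀ :=
    (hdet.inv hd).mul (Finset.analyticAt_fun_sum _ fun i _ => (pk_adj_an hM j i).mul (hb i))
  refine h1.congr ?_
  filter_upwards [he, hdet.continuousAt.eventually_ne hd] with p h2 h3
  rw [inv_mul_eq_iff_eq_mul₀ h3, ← h2]
  have h4 : (M p).adjugate *ᵥ (M p *ᵥ x p) = (M p).det • x p := by
    rw [Matrix.mulVec_mulVec, Matrix.adjugate_mul, Matrix.smul_mulVec, Matrix.one_mulVec]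
  have h5 := congrFun h4 j
  simpa [Matrix.mulVec, dotProduct] using h5

lemma pk_ev_ne {Z : Finset ℂ} {r : ℝ} {f : ℂ × ℂ → ℂ} {p₀ : ℂ}
    (hf : ∀ ζ ∈ pkS Z r, ContinuousAt f (ζ, p₀)) (h0 : ∀ ζ ∈ pkS Z r, f (ζ, p₀) ≠ 0) :
    ∀ᶠ p in nhds p₀, ∀ ζ ∈ pkS Z r, f (ζ, p) ≠ 0 := by
  refine (pkS_compact Z r).eventually_forall_of_forall_eventually fun ζ hζ => ?_
  have h1 := (hf ζ hζ).eventually_ne (h0 ζ hζ)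
  exact (continuous_swap.tendsto (p₀, ζ)).eventually h1

/-- Common data of the factorisation. -/
structure PkData (Ω P : Set ℂ) (m : ℕ) (f : ℂ × ℂ → ℂ) (U : ℂ → Polynomial ℂ)
    (h : ℂ → ℂ → ℂ) : Prop where
  hΩ : IsOpen Ω
  hP : IsOpen P
  hf : AnalyticOnNhd ℂ f (Ω ×ˢ P)
  monic : ∀ p ∈ P, (U p).Monic
  deg : ∀ p ∈ P, (U p).natDegree = m
  root : ∀ p ∈ P, ∀ z, (U p).eval z = 0 → z ∈ Ω
  han : ∀ p ∈ P, AnalyticOnNhd ℂ (h p) Ω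
  hne : ∀ p ∈ P, ∀ z ∈ Ω, h p z ≠ 0
  fac : ∀ p ∈ P, ∀ z ∈ Ω, f (z, p) = (U p).eval z * h p z
  fin : ∀ p ∈ P, ∃ Z : Finset ℂ, ↑Z ⊆ Ω ∧ ∀ z ∈ Ω, f (z, p) = 0 ↔ z ∈ Z

section
variable {Ω P : Set ℂ} {m : ℕ} {f : ℂ × ℂ → ℂ} {U : ℂ → Polynomial ℂ} {h : ℂ → ℂ → ℂ}

lemma pk_circ (D : PkData Ω P m f U h) {p₀ : ℂ} (hp₀ : p₀ ∈ P) :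
    ∃ Z r, PkGood Ω Z r ∧ (∀ z, (U p₀).eval z = 0 → z ∈ Z) ∧ (∀ a ∈ Z, a ∈ Ω) ∧
      (∀ ζ ∈ pkS Z r, f (ζ, p₀) ≠ 0) ∧
      ∀ᶠ p in nhds p₀, ∀ ζ ∈ pkS Z r, f (ζ, p) ≠ 0 := by
  obtain ⟨Z, hZ, hZ0⟩ := D.fin p₀ hp₀
  obtain ⟨r, hr⟩ := pk_good D.hΩ Z hZ
  have h0 : ∀ ζ ∈ pkS Z r, f (ζ, p₀) ≠ 0 := fun ζ hζ h0 =>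
    pkS_notMem hr hζ ((hZ0 ζ (pkS_sub hr hζ)).1 h0)
  refine ⟨Z, r, hr, ?_, fun a ha => hZ ha, h0, ?_⟩
  · intro z hz
    have hzΩ := D.root p₀ hp₀ z hz
    refine (hZ0 z hzΩ).1 ?_
    rw [D.fac p₀ hp₀ z hzΩ, hz, zero_mul]
  · exact pk_ev_ne (fun ζ hζ => (D.hf (ζ, p₀) ⟨pkS_sub hr hζ, hp₀⟩).continuousAt) h0

lemma pk_coeff (D : PkData Ω P m f U h) {p₀ : ℂ} (hp₀ : p₀ ∈ P) (j : ℕ) :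
    AnalyticAt ℂ (fun p => (U p).coeff j) p₀ := by
  rcases lt_trichotomy j m with hj | hj | hj
  rotate_left
  · refine (analyticAt_const (v := (1 : ℂ))).congr ?_
    filter_upwards [D.hP.mem_nhds hp₀] with p hp
    have := (D.monic p hp).coeff_natDegree
    rw [D.deg p hp, ← hj] at this
    exact this.symm
  · refine (analyticAt_const (v := (0 : ℂ))).congr ?_
    filter_upwards [D.hP.mem_nhds hp₀] with p hp
    exact (Polynomial.coeff_eq_zero_of_natDegree_lt (by rwa [D.deg p hp])).symm
  obtain ⟨Z, r, hg, hroot, hZΩ, hf0, hev⟩ := pk_circ D hp₀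
  have han : ∀ k : ℕ, AnalyticAt ℂ (fun p => pkL Z r (fun ζ => ζ ^ k / f (ζ, p))) p₀ := by
    intro k
    refine pkL_param hg.1 (fun x => x.1 ^ k / f x) p₀ fun ζ hζ => ?_
    exact (analyticAt_fst.pow k).div (D.hf (ζ, p₀) ⟨pkS_sub hg hζ, hp₀⟩) (hf0 ζ hζ)
  have hH : (Matrix.of fun k j : Fin m => pkL Z r (fun z => z ^ (j + k : ℕ) / f (z, p₀))).det ≠ 0 := by
    have := pk_hankel hg (fun z => (h p₀ z)⁻¹) ((D.han p₀ hp₀).inv (D.hne p₀ hp₀))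
      (fun a ha => inv_ne_zero (D.hne p₀ hp₀ a (hZΩ a ha))) (D.monic p₀ hp₀) (D.deg p₀ hp₀) hroot
    convert this using 5 with k j
    refine pkL_congr hg.1 fun z hz => ?_
    rw [D.fac p₀ hp₀ z (pkS_sub hg hz), div_mul_eq_div_div_swap, ← div_eq_mul_inv]
  refine pk_solve (M := fun p => Matrix.of fun k j : Fin m =>
      pkL Z r (fun z => z ^ (j + k : ℕ) / f (z, p)))
    (x := fun p j => (U p).coeff j)
    (b := fun p k => - pkL Z r (fun z => z ^ (m + k : ℕ) / f (z, p)))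
    (fun k j => han _) (fun k => (han _).neg) hH ?_ ⟨j, hj⟩
  filter_upwards [hev, D.hP.mem_nhds hp₀] with p hfp hp
  ext k
  simp only [Matrix.mulVec, dotProduct, Matrix.of_apply]
  rw [eq_neg_iff_add_eq_zero]
  have hcont : ∀ i : ℕ, ContinuousOn (fun z => z ^ (i + k : ℕ) / f (z, p)) (pkS Z r) := fun i z hz =>
    (((continuous_pow _).continuousAt.div
      ((D.hf (z, p) ⟨pkS_sub hg hz, hp⟩).continuousAt.comp (f := fun z => (z, p)) (by fun_prop))
      (hfp z hz)) : ContinuousAt (fun z => z ^ (i + k : ℕ) / f (z, p)) z).continuousWithinAt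
  have h1 := pkL_sum hg.1 (Finset.range (m + 1)) (fun i => (U p).coeff i)
    (fun i z => z ^ (i + k : ℕ) / f (z, p)) (fun i _ => hcont i)
  have hlead := (D.monic p hp).coeff_natDegree
  rw [D.deg p hp] at hlead
  rw [Finset.sum_range_succ, hlead, one_mul, Finset.sum_range] at h1
  rw [Finset.sum_congr rfl fun i _ => mul_comm _ _, ← h1]
  have h2 : AnalyticOnNhd ℂ (fun z => z ^ (k : ℕ) * (h p z)⁻¹) Ω :=
    (analyticOnNhd_id.pow _).mul ((D.han p hp).inv (D.hne p hp))
  rw [← pkL_zero hg h2]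
  refine pkL_congr hg.1 fun z hz => ?_
  have h3 := hfp z hz
  have h4 := D.fac p hp z (pkS_sub hg hz)
  have hu : (U p).eval z ≠ 0 := fun h0 => h3 (by rw [h4, h0, zero_mul])
  have hh := D.hne p hp z (pkS_sub hg hz)
  have h5 : (U p).eval z = ∑ i ∈ Finset.range (m + 1), (U p).coeff i * z ^ i := by
    rw [Polynomial.eval_eq_sum_range, D.deg p hp]
  rw [show ∑ i ∈ Finset.range (m + 1), (U p).coeff i * (z ^ (i + k : ℕ) / f (z, p)) =
    z ^ (k : ℕ) * (U p).eval z / f (z, p) by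
      rw [h5, Finset.mul_sum, Finset.sum_div]
      exact Finset.sum_congr rfl fun i _ => by ring, h4]
  field_simp

lemma pk_evalan (r : ℂ → Polynomial ℂ) (d : ℕ) {p₀ : ℂ} (hd : ∀ᶠ p in nhds p₀, (r p).natDegree < d)
    (hr : ∀ j, AnalyticAt ℂ (fun p => (r p).coeff j) p₀) (z : ℂ) :
    AnalyticAt ℂ (fun x : ℂ × ℂ => (r x.2).eval x.1) (z, p₀) := by
  have h1 : AnalyticAt ℂ (fun x : ℂ × ℂ => ∑ j ∈ Finset.range d, (r x.2).coeff j * x.1 ^ j) (z, p₀) :=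
    Finset.analyticAt_fun_sum _ fun j _ =>
      (AnalyticAt.fun_comp (f := fun x : ℂ × ℂ => x.2) (x := (z, p₀)) (hr j) analyticAt_snd).mul
        (analyticAt_fst.pow j)
  refine h1.congr ?_
  have : ∀ᶠ x : ℂ × ℂ in nhds (z, p₀), (r x.2).natDegree < d :=
    (continuous_snd.tendsto (z, p₀)).eventually hd
  filter_upwards [this] with x hx
  exact (Polynomial.eval_eq_sum_range' hx x.1).symm

lemma pk_Uan (D : PkData Ω P m f U h) {p₀ : ℂ} (hp₀ : p₀ ∈ P) (z : ℂ) :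
    AnalyticAt ℂ (fun x : ℂ × ℂ => (U x.2).eval x.1) (z, p₀) := by
  refine pk_evalan U (m + 1) ?_ (pk_coeff D hp₀) z
  filter_upwards [D.hP.mem_nhds hp₀] with p hp
  rw [D.deg p hp]; omega

lemma pk_rcoeff (D : PkData Ω P m f U h) {A : ℂ × ℂ → ℂ} (hA : AnalyticOnNhd ℂ A (Ω ×ˢ P))
    {R : ℂ → Polynomial ℂ} {N : ℂ → ℂ → ℂ} (hRd : ∀ p ∈ P, (R p).degree < (m : WithBot ℕ))
    (hN : ∀ p ∈ P, AnalyticOnNhd ℂ (N p) Ω)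
    (hdec : ∀ p ∈ P, ∀ z ∈ Ω, f (z, p) ≠ 0 →
      A (z, p) / f (z, p) = (R p).eval z / (U p).eval z + N p z)
    {p₀ : ℂ} (hp₀ : p₀ ∈ P) (j : ℕ) :
    AnalyticAt ℂ (fun p => (R p).coeff j) p₀ := by
  rcases Nat.lt_or_ge j m with hj | hj
  swap
  · refine (analyticAt_const (v := (0 : ℂ))).congr ?_
    filter_upwards [D.hP.mem_nhds hp₀] with p hp
    exact (Polynomial.coeff_eq_zero_of_degree_lt ((hRd p hp).trans_le (by exact_mod_cast hj))).symm
  obtain ⟨Z, r, hg, hroot, hZΩ, hf0, hev⟩ := pk_circ D hp₀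
  have hUne : ∀ p ∈ P, (∀ ζ ∈ pkS Z r, f (ζ, p) ≠ 0) → ∀ ζ ∈ pkS Z r, (U p).eval ζ ≠ 0 := by
    intro p hp hfp ζ hζ h0
    exact hfp ζ hζ (by rw [D.fac p hp ζ (pkS_sub hg hζ), h0, zero_mul])
  have han : ∀ k : ℕ, AnalyticAt ℂ (fun p => pkL Z r (fun ζ => ζ ^ k / (U p).eval ζ)) p₀ := by
    intro k
    refine pkL_param hg.1 (fun x => x.1 ^ k / (U x.2).eval x.1) p₀ fun ζ hζ => ?_
    exact (analyticAt_fst.pow k).div (pk_Uan D hp₀ ζ) (hUne p₀ hp₀ hf0 ζ hζ)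
  have hban : ∀ k : ℕ, AnalyticAt ℂ (fun p => pkL Z r (fun ζ => ζ ^ k * (A (ζ, p) / f (ζ, p)))) p₀ := by
    intro k
    refine pkL_param hg.1 (fun x => x.1 ^ k * (A x / f x)) p₀ fun ζ hζ => ?_
    exact (analyticAt_fst.pow k).mul ((hA (ζ, p₀) ⟨pkS_sub hg hζ, hp₀⟩).div
      (D.hf (ζ, p₀) ⟨pkS_sub hg hζ, hp₀⟩) (hf0 ζ hζ))
  have hH : (Matrix.of fun k j : Fin m => pkL Z r (fun z => z ^ (j + k : ℕ) / (U p₀).eval z)).det ≠ 0 := by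
    have := pk_hankel hg (fun z => 1) analyticOnNhd_const
      (fun a ha => one_ne_zero) (D.monic p₀ hp₀) (D.deg p₀ hp₀) hroot
    simpa using this
  refine pk_solve (M := fun p => Matrix.of fun k j : Fin m =>
      pkL Z r (fun z => z ^ (j + k : ℕ) / (U p).eval z))
    (x := fun p j => (R p).coeff j)
    (b := fun p k => pkL Z r (fun z => z ^ (k : ℕ) * (A (z, p) / f (z, p))))
    (fun k j => han _) (fun k => hban _) hH ?_ ⟨j, hj⟩
  filter_upwards [hev, D.hP.mem_nhds hp₀] with p hfp hp
  ext k
  simp only [Matrix.mulVec, dotProduct, Matrix.of_apply]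
  have hcont : ∀ i : ℕ, ContinuousOn (fun z => z ^ (i + k : ℕ) / (U p).eval z) (pkS Z r) := fun i =>
    (continuous_pow _).continuousOn.div (U p).continuous.continuousOn (hUne p hp hfp)
  have h1 := pkL_sum hg.1 (Finset.range m) (fun i => (R p).coeff i)
    (fun i z => z ^ (i + k : ℕ) / (U p).eval z) (fun i _ => hcont i)
  rw [Finset.sum_range] at h1
  rw [Finset.sum_congr rfl fun i _ => mul_comm _ _, ← h1]
  have h2 : AnalyticOnNhd ℂ (fun z => z ^ (k : ℕ) * N p z) Ω :=
    (analyticOnNhd_id.pow _).mul (hN p hp)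
  rw [← add_zero (pkL Z r _), ← pkL_zero hg h2, ← pkL_add hg.1]
  rotate_left
  · exact continuousOn_finsetSum _ fun i _ => continuousOn_const.mul (hcont i)
  · exact h2.continuousOn.mono fun z hz => pkS_sub hg hz
  refine pkL_congr hg.1 fun z hz => ?_
  rw [hdec p hp z (pkS_sub hg hz) (hfp z hz)]
  have h5 : (R p).eval z = ∑ i ∈ Finset.range m, (R p).coeff i * z ^ i := by
    by_cases h0 : R p = 0
    · simp [h0]
    · refine Polynomial.eval_eq_sum_range' ?_ z
      have := hRd p hp
      rw [Polynomial.degree_eq_natDegree h0] at this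
      exact_mod_cast this
  rw [h5, mul_add, Finset.sum_div, Finset.mul_sum]
  congr 1
  exact Finset.sum_congr rfl fun i _ => by ring

lemma pk_Ran (D : PkData Ω P m f U h) {A : ℂ × ℂ → ℂ} (hA : AnalyticOnNhd ℂ A (Ω ×ˢ P))
    {R : ℂ → Polynomial ℂ} {N : ℂ → ℂ → ℂ} (hRd : ∀ p ∈ P, (R p).degree < (m : WithBot ℕ))
    (hN : ∀ p ∈ P, AnalyticOnNhd ℂ (N p) Ω)
    (hdec : ∀ p ∈ P, ∀ z ∈ Ω, f (z, p) ≠ 0 →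
      A (z, p) / f (z, p) = (R p).eval z / (U p).eval z + N p z)
    {p₀ : ℂ} (hp₀ : p₀ ∈ P) (z : ℂ) :
    AnalyticAt ℂ (fun x : ℂ × ℂ => (R x.2).eval x.1) (z, p₀) := by
  refine pk_evalan R (m + 1) ?_ (pk_rcoeff D hA hRd hN hdec hp₀) z
  filter_upwards [D.hP.mem_nhds hp₀] with p hp
  have := Polynomial.natDegree_le_of_degree_le (hRd p hp).le
  omega

open Metric in
lemma pk_Nan (D : PkData Ω P m f U h) {A : ℂ × ℂ → ℂ} (hA : AnalyticOnNhd ℂ A (Ω ×ˢ P))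
    {R : ℂ → Polynomial ℂ} {N : ℂ → ℂ → ℂ} (hRd : ∀ p ∈ P, (R p).degree < (m : WithBot ℕ))
    (hN : ∀ p ∈ P, AnalyticOnNhd ℂ (N p) Ω)
    (hdec : ∀ p ∈ P, ∀ z ∈ Ω, f (z, p) ≠ 0 →
      A (z, p) / f (z, p) = (R p).eval z / (U p).eval z + N p z)
    {p₀ : ℂ} (hp₀ : p₀ ∈ P) {z₀ : ℂ} (hz₀ : z₀ ∈ Ω) :
    AnalyticAt ℂ (fun x : ℂ × ℂ => N x.2 x.1) (z₀, p₀) := by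
  classical
  obtain ⟨Z, hZ, hZ0⟩ := D.fin p₀ hp₀
  obtain ⟨r, hr⟩ := pk_good D.hΩ (insert z₀ Z) (by
    intro a ha
    rcases Finset.mem_insert.1 (Finset.mem_coe.1 ha) with rfl | ha
    · exact hz₀
    · exact hZ ha)
  have h0 : ∀ ζ ∈ pkS (insert z₀ Z) r, f (ζ, p₀) ≠ 0 := fun ζ hζ h0 =>
    pkS_notMem hr hζ (Finset.mem_insert_of_mem ((hZ0 ζ (pkS_sub hr hζ)).1 h0))
  have hev := pk_ev_ne (fun ζ hζ => (D.hf (ζ, p₀) ⟨pkS_sub hr hζ, hp₀⟩).continuousAt) h0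
  have hS : ∀ ζ ∈ sphere z₀ r, ζ ∈ pkS (insert z₀ Z) r := fun ζ hζ =>
    ⟨z₀, Finset.mem_insert_self _ _, hζ⟩
  have hb := (hr.2 z₀ (Finset.mem_insert_self _ _)).1
  have key := pk_J (fun x => A x / f x - (R x.2).eval x.1 / (U x.2).eval x.1) z₀ p₀ z₀ r hr.1
    (mem_ball_self hr.1) (fun ζ hζ => by
      have hζΩ := pkS_sub hr (hS ζ hζ)
      have hfne := h0 ζ (hS ζ hζ)
      refine ((hA _ ⟨hζΩ, hp₀⟩).div (D.hf _ ⟨hζΩ, hp₀⟩) hfne).sub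
        ((pk_Ran D hA hRd hN hdec hp₀ ζ).div (pk_Uan D hp₀ ζ) ?_)
      intro h1
      exact hfne (by rw [D.fac p₀ hp₀ ζ hζΩ, h1, zero_mul]))
  have key2 := (analyticAt_const (v := (2 * Real.pi * Complex.I : ℂ)⁻¹)).mul key
  refine key2.congr ?_
  have e1 : ∀ᶠ x : ℂ × ℂ in nhds (z₀, p₀), x.1 ∈ ball z₀ r :=
    (continuous_fst.tendsto (z₀, p₀)).eventually (ball_mem_nhds z₀ hr.1)
  have e2 : ∀ᶠ x : ℂ × ℂ in nhds (z₀, p₀), x.2 ∈ P ∧ ∀ ζ ∈ pkS (insert z₀ Z) r, f (ζ, x.2) ≠ 0 :=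
    (continuous_snd.tendsto (z₀, p₀)).eventually (Filter.Eventually.and (D.hP.mem_nhds hp₀) hev)
  filter_upwards [e1, e2] with x hx1 hx2
  obtain ⟨hxP, hxf⟩ := hx2
  rw [Pi.mul_apply, inv_mul_eq_iff_eq_mul₀ Complex.two_pi_I_ne_zero]
  have h3 := ((hN x.2 hxP).differentiableOn.mono hb).circleIntegral_sub_inv_smul hx1
  simp only [smul_eq_mul] at h3
  rw [← h3]
  refine circleIntegral.integral_congr hr.1.le fun ζ hζ => ?_
  rw [hdec x.2 hxP ζ (pkS_sub hr (hS ζ hζ)) (hxf ζ (hS ζ hζ))]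
  ring

end

/-- **Parametric Keldysh decomposition** (Theorem 3.2, decomposition part):
`T(z,p)⁻¹ = R(z,p)/u(z,p) + N(z,p)` with `u(z,p) = z^m + α_{m-1}(p) z^{m-1} + ⋯ + α_0(p)`,
the roots of `u(·,p)` lying in `Ω` with multiplicities matching the orders of vanishing
of `det T(·,p)`, and entries of `R(·,p)` polynomials of degree at most `m-1`. -/
theorem parametric_keldysh
    (n m : ℕ) (Ω Pdom : Set ℂ)
    (hΩo : IsOpen Ω) (hΩc : IsConnected Ω) (hPo : IsOpen Pdom) (hPc : IsConnected Pdom)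
    (T : ℂ → ℂ → Matrix (Fin n) (Fin n) ℂ)
    (hT : ∀ i j, AnalyticOnNhd ℂ (fun q : ℂ × ℂ => T q.1 q.2 i j) (Ω ×ˢ Pdom))
    (hdet : ∀ p ∈ Pdom, ∃ z ∈ Ω, (T z p).det ≠ 0)
    (hcount : ∀ p ∈ Pdom, EigCount (fun z => (T z p).det) Ω m) :
    ∃ (α : ℕ → ℂ → ℂ) (R N : ℂ → ℂ → Matrix (Fin n) (Fin n) ℂ),
      (∀ j < m, AnalyticOnNhd ℂ (α j) Pdom) ∧
      (∀ i j, AnalyticOnNhd ℂ (fun q : ℂ × ℂ => R q.1 q.2 i j) (Ω ×ˢ Pdom)) ∧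
      (∀ i j, AnalyticOnNhd ℂ (fun q : ℂ × ℂ => N q.1 q.2 i j) (Ω ×ˢ Pdom)) ∧
      (∀ p ∈ Pdom, ∀ z : ℂ, wpoly m α z p = 0 → z ∈ Ω) ∧
      (∀ p ∈ Pdom, ∀ l ∈ Ω, ∀ k : ℕ,
        ZeroOrder (fun z => wpoly m α z p) l k ↔ ZeroOrder (fun z => (T z p).det) l k) ∧
      (∀ p ∈ Pdom, ∀ i j, PolyDegLt (fun z => R z p i j) m) ∧
      (∀ z ∈ Ω, ∀ p ∈ Pdom, (T z p).det ≠ 0 →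
        (T z p)⁻¹ = (wpoly m α z p)⁻¹ • R z p + N z p) := by
  have hf : AnalyticOnNhd ℂ (fun x : ℂ × ℂ => (T x.1 x.2).det) (Ω ×ˢ Pdom) := fun x hx =>
    pk_det_an fun i j => hT i j x hx
  have hA : ∀ i j, AnalyticOnNhd ℂ (fun x : ℂ × ℂ => (T x.1 x.2).adjugate i j) (Ω ×ˢ Pdom) :=
    fun i j x hx => pk_adj_an (fun i j => hT i j x hx) i j
  have slice : ∀ {F : ℂ × ℂ → ℂ}, AnalyticOnNhd ℂ F (Ω ×ˢ Pdom) → ∀ p ∈ Pdom,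
      AnalyticOnNhd ℂ (fun z => F (z, p)) Ω := fun hF p hp z hz =>
    AnalyticAt.fun_comp (f := fun z : ℂ => (z, p)) (x := z) (hF (z, p) ⟨hz, hp⟩)
      (analyticAt_id.prod analyticAt_const)
  have ex1 := fun p (hp : p ∈ Pdom) => pk_fact hΩo (slice hf p hp) (hcount p hp)
  choose! U h hU1 hU2 hU3 hh1 hh2 hfac hfin using ex1
  have D : PkData Ω Pdom m (fun x : ℂ × ℂ => (T x.1 x.2).det) U h :=
    ⟨hΩo, hPo, hf, hU1, hU2, hU3, hh1, hh2, hfac, hfin⟩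
  have ex2 := fun p (hp : p ∈ Pdom) (i j : Fin n) => pk_div' hΩo (hU1 p hp) (hU3 p hp)
    ((slice (hA i j) p hp).div (hh1 p hp) (hh2 p hp))
  choose! R N hR hN hRN using ex2
  have hR' : ∀ i j, ∀ p ∈ Pdom, (R p i j).degree < (m : WithBot ℕ) := fun i j p hp => by
    rw [← hU2 p hp]; exact hR p hp i j
  have hN' : ∀ i j, ∀ p ∈ Pdom, AnalyticOnNhd ℂ (N p i j) Ω := fun i j p hp => hN p hp i j
  have hUne : ∀ p ∈ Pdom, ∀ z ∈ Ω, (T z p).det ≠ 0 → (U p).eval z ≠ 0 := fun p hp z hz h0 h1 =>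
    h0 (by rw [hfac p hp z hz, h1, zero_mul])
  have hdec : ∀ i j, ∀ p ∈ Pdom, ∀ z ∈ Ω, (T z p).det ≠ 0 →
      (T z p).adjugate i j / (T z p).det = (R p i j).eval z / (U p).eval z + N p i j z := by
    intro i j p hp z hz h0
    have h1 := hRN p hp i j z
    have h2 := hUne p hp z hz h0
    have h3 := hh2 p hp z hz
    simp only at h1
    rw [hfac p hp z hz, div_mul_eq_div_div_swap, h1]
    field_simp
    ring
  have hw : ∀ p ∈ Pdom, ∀ z, wpoly m (fun j p => (U p).coeff j) z p = (U p).eval z := by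
    intro p hp z
    have hlead := (hU1 p hp).coeff_natDegree
    rw [hU2 p hp] at hlead
    rw [Polynomial.eval_eq_sum_range, hU2 p hp, Finset.sum_range_succ, hlead, wpoly]
    ring
  refine ⟨fun j p => (U p).coeff j, fun z p => Matrix.of fun i j => (R p i j).eval z,
    fun z p => Matrix.of fun i j => N p i j z, ?_, ?_, ?_, ?_, ?_, ?_, ?_⟩
  · exact fun j _ p hp => pk_coeff D hp j
  · exact fun i j x hx => pk_Ran D (hA i j) (hR' i j) (hN' i j) (hdec i j) hx.2 x.1
  · exact fun i j x hx => pk_Nan D (hA i j) (hR' i j) (hN' i j) (hdec i j) hx.2 hx.1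
  · intro p hp z hz
    rw [hw p hp] at hz
    exact hU3 p hp z hz
  · intro p hp l hl k
    have hl1 := hh1 p hp l hl
    have hl2 := hh2 p hp l hl
    simp only [hw p hp]
    constructor
    · rintro ⟨g, hg, hgl, hge⟩
      refine ⟨fun z => g z * h p z, hg.mul hl1, mul_ne_zero hgl hl2, ?_⟩
      filter_upwards [hge, hΩo.mem_nhds hl] with z h1 h2
      rw [hfac p hp z h2, h1]; ring
    · rintro ⟨g, hg, hgl, hge⟩
      refine ⟨fun z => g z / h p z, hg.div hl1 hl2, div_ne_zero hgl hl2, ?_⟩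
      filter_upwards [hge, hΩo.mem_nhds hl] with z h1 h2
      rw [hfac p hp z h2] at h1
      have h3 := hh2 p hp z h2
      rw [← mul_div_assoc, ← h1, mul_div_cancel_right₀ _ h3]
  · exact fun p hp i j => ⟨R p i j, hR' i j p hp, fun z => rfl⟩
  · intro z hz p hp h0
    ext i j
    rw [Matrix.inv_def, Ring.inverse_eq_inv', hw p hp]
    have := hdec i j p hp z hz h0
    simp only [Matrix.smul_apply, Matrix.add_apply, Matrix.of_apply, smul_eq_mul]
    rw [inv_mul_eq_div, inv_mul_eq_div, this]
end

section
/- Let Ω, Π ⊆ ℂ be domains and let T : ℂ×ℂ → ℂ^{n×n} be analytic on Ω×Π, such that for every p ∈ Π, det T(·,p) is not identically zero on Ω and T(·,p) has exactly m eigenvalues in Ω counting algebraic multiplicity. Let α_0, …, α_{m−1} : ℂ → ℂ analytic on Π and R, N : ℂ×ℂ → ℂ^{n×n} analytic on Ω×Π realize the parametric Keldysh decomposition: with u(z,p) = z^m + Σ_{j<m} α_j(p) z^j, every root of u(·,p) lies in Ω with multiplicity equal to the order of vanishing of det T(·,p) there, each entry of R(·,p) is a polynomial in z of degree at most m−1,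 and T(z,p)^{-1} = R(z,p)/u(z,p) + N(z,p) whenever det T(z,p) ≠ 0. Suppose additionally that H(z,p) := R(z,p)/u(z,p) is a rational function of both variables, i.e., there exist an n×n matrix P(z,p) whose entries are bivariate polynomials and a bivariate polynomial Q(z,p) not identically zero on Ω×Π such that H(z,p) = P(z,p)/Q(z,p) for all (z,p) ∈ Ω×Π with Q(z,p) ≠ 0 and u(z,p) ≠ 0. Then there exist a bivariate polynomial û : ℂ×ℂ → ℂ and a function h : ℂ×ℂ → ℂ analytic on Ω×Π such that det T(z,p) = û(z,p) · h(z,p) for all (z,p) ∈ Ω×Π, and for every p ∈ Π the set of roots of the polynomial û(·,p) equals the set of zeros of det T(·,p) in Ω. -/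
open Matrix

open Filter Topology

/-- projection killing the second variable -/
noncomputable def projFst : ℂ × ℂ →L[ℂ] ℂ × ℂ :=
  (ContinuousLinearMap.inl ℂ ℂ ℂ).comp (ContinuousLinearMap.fst ℂ ℂ ℂ)

lemma norm_projFst_le : ‖projFst‖ ≤ 1 := by
  refine ContinuousLinearMap.opNorm_le_bound _ zero_le_one fun x => ?_
  simp [projFst, Prod.norm_def]

/-- divided difference of a multilinear map -/
noncomputable def ddMul {n : ℕ} (f : ContinuousMultilinearMap ℂ (fun _ : Fin (n+1) => ℂ × ℂ) ℂ) :
    ContinuousMultilinearMap ℂ (fun _ : Fin n => ℂ × ℂ) ℂ :=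
  ∑ i : Fin (n+1), (f.curryMid i ((0 : ℂ), (1 : ℂ))).compContinuousLinearMap
    (fun j => if (i.succAbove j) < i then projFst else ContinuousLinearMap.id ℂ (ℂ × ℂ))

lemma norm_ddMul_le {n : ℕ} (f : ContinuousMultilinearMap ℂ (fun _ : Fin (n+1) => ℂ × ℂ) ℂ) :
    ‖ddMul f‖ ≤ (n+1) * ‖f‖ := by
  unfold ddMul
  refine (norm_sum_le _ _).trans ?_
  have : ∀ i ∈ (Finset.univ : Finset (Fin (n+1))),
      ‖(f.curryMid i ((0 : ℂ), (1 : ℂ))).compContinuousLinearMap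
        (fun j => if (i.succAbove j) < i then projFst else ContinuousLinearMap.id ℂ (ℂ × ℂ))‖ ≤ ‖f‖ := by
    intro i _
    refine (ContinuousMultilinearMap.norm_compContinuousLinearMap_le _ _).trans ?_
    have h1 : ‖f.curryMid i ((0 : ℂ), (1 : ℂ))‖ ≤ ‖f‖ := by
      have := (f.curryMid i).le_opNorm ((0 : ℂ), (1 : ℂ))
      simpa [Prod.norm_def] using this
    have h2 : ∏ j : Fin n, ‖(if (i.succAbove j) < i then projFst else ContinuousLinearMap.id ℂ (ℂ × ℂ))‖ ≤ 1 := by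
      refine Finset.prod_le_one (fun _ _ => norm_nonneg _) fun j _ => ?_
      split_ifs
      · exact norm_projFst_le
      · exact ContinuousLinearMap.norm_id_le
    calc _ ≤ ‖f‖ * 1 := mul_le_mul h1 h2 (Finset.prod_nonneg fun _ _ => norm_nonneg _) (norm_nonneg _)
      _ = _ := mul_one _
  refine (Finset.sum_le_sum this).trans ?_
  simp

lemma ddMul_apply {n : ℕ} (f : ContinuousMultilinearMap ℂ (fun _ : Fin (n+1) => ℂ × ℂ) ℂ)
    (x : ℂ × ℂ) :
    x.2 * ddMul f (fun _ => x) = f (fun _ => x) - f (fun _ => projFst x) := by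
  set hyb : ℕ → Fin (n+1) → ℂ × ℂ := fun k j => if j.val < k then projFst x else x with hh
  have key : ∀ i : Fin (n+1), x.2 * ((f.curryMid i ((0 : ℂ), (1 : ℂ))).compContinuousLinearMap
    (fun j => if (i.succAbove j) < i then projFst else ContinuousLinearMap.id ℂ (ℂ × ℂ))) (fun _ => x)
     = f (hyb i) - f (hyb (i+1)) := by
    intro i
    have e1 : hyb i = Function.update (hyb i) i x := by
      ext1 j
      by_cases hj : j = i
      · subst hj; simp [hh]
      · simp [hj]
    have e2 : hyb (i+1) = Function.update (hyb i) i (projFst x) := by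
      ext1 j
      by_cases hj : j = i
      · subst hj; simp [hh]
      · have : (j.val < i.val + 1) ↔ j.val < i.val := by
          have : j.val ≠ i.val := fun h => hj (Fin.ext h)
          omega
        simp [hj, hh, this]
    have e3 : x - projFst x = x.2 • ((0 : ℂ), (1 : ℂ)) := by
      ext <;> simp [projFst]
    rw [e2]
    nth_rewrite 1 [e1]
    rw [← f.map_update_sub, e3, f.map_update_smul, smul_eq_mul]
    congr 1
    rw [ContinuousMultilinearMap.compContinuousLinearMap_apply, ContinuousMultilinearMap.curryMid_apply]
    congr 1
    symm
    refine Fin.eq_insertNth_iff.2 ⟨?_, ?_⟩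
    · simp
    · ext1 j
      have : i.succAbove j ≠ i := Fin.succAbove_ne i j
      simp only [Fin.removeNth, Function.update_of_ne this, hh, Fin.lt_def]
      split_ifs <;> simp
  unfold ddMul
  rw [_root_.sum_apply, Finset.mul_sum, Finset.sum_congr rfl (fun i _ => key i),
    Fin.sum_univ_eq_sum_range (fun i => f (hyb i) - f (hyb (i+1))), Finset.sum_range_sub']
  congr 2
  ext1 j
  simp [hh, j.isLt]

lemma hadamard_local {F : ℂ × ℂ → ℂ} {x0 : ℂ × ℂ} (hF : AnalyticAt ℂ F x0)
    (h0 : ∀ᶠ z in 𝓝 x0.1, F (z, x0.2) = 0) :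
    ∃ g : ℂ × ℂ → ℂ, AnalyticAt ℂ g x0 ∧ ∀ᶠ x in 𝓝 x0, F x = (x.2 - x0.2) * g x := by
  obtain ⟨P, hP⟩ := hF
  let G : FormalMultilinearSeries ℂ (ℂ × ℂ) ℂ := fun n => ddMul (P (n+1))
  have hGr : 0 < G.radius := by
    obtain ⟨C, r, hC, hr, hb⟩ := P.le_mul_pow_of_radius_pos hP.radius_pos
    set ρ : NNReal := ⟨1/(2*r), by positivity⟩ with hρ
    have : (ρ : ENNReal) ≤ G.radius := by
      refine G.le_radius_of_bound (C * r) fun n => ?_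
      have h1 : ‖G n‖ ≤ (2:ℝ)^n * (C * r^(n+1)) := by
        refine (norm_ddMul_le _).trans ?_
        refine mul_le_mul ?_ (hb _) (norm_nonneg _) (by positivity)
        exact_mod_cast Nat.lt_two_pow_self
      calc ‖G n‖ * (ρ:ℝ)^n = ‖G n‖ * (1/(2*r))^n := rfl
        _ ≤ ((2:ℝ)^n * (C * r^(n+1))) * (1/(2*r))^n := by gcongr
        _ = C * r := by
          rw [div_pow, mul_pow]; field_simp; ring
    refine lt_of_lt_of_le ?_ this
    rw [ENNReal.coe_pos]
    exact (by positivity : (0:ℝ) < 1/(2*r))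
  have hG := (G.hasFPowerSeriesOnBall hGr).hasFPowerSeriesAt
  refine ⟨fun x => G.sum (x - x0), ?_, ?_⟩
  · have : AnalyticAt ℂ G.sum (x0 - x0) := by rw [sub_self]; exact hG.analyticAt
    exact AnalyticAt.fun_comp this (by fun_prop)
  · have t0 : Tendsto (fun x : ℂ × ℂ => x - x0) (𝓝 x0) (𝓝 0) := by
      have : ContinuousAt (fun x : ℂ × ℂ => x - x0) x0 := by fun_prop
      simpa [ContinuousAt] using this
    have t1 : Tendsto (fun x : ℂ × ℂ => projFst (x - x0)) (𝓝 x0) (𝓝 0) := by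
      have := (projFst.continuous.tendsto 0).comp t0
      rw [map_zero] at this
      exact this
    have t2 : Tendsto (fun x : ℂ × ℂ => x.1) (𝓝 x0) (𝓝 x0.1) := continuous_fst.tendsto x0
    filter_upwards [t0.eventually hP.eventually_hasSum, t1.eventually hP.eventually_hasSum,
      t0.eventually hG.eventually_hasSum, t2.eventually h0] with x s1 s2 s3 s4
    have e : x0 + projFst (x - x0) = (x.1, x0.2) := by ext <;> simp [projFst]
    rw [e, s4] at s2
    have s5 := s1.sub s2
    have s6 := s3.mul_left (x.2 - x0.2)
    simp only [zero_add, sub_zero, add_sub_cancel] at s5 s6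
    rw [← hasSum_nat_add_iff' 1] at s5
    have s7 : HasSum (fun n => P (n+1) (fun _ => x - x0) - P (n+1) (fun _ => projFst (x-x0))) (F x) := by
      have z : (P 0 fun _ => x - x0) = P 0 fun _ => projFst (x - x0) := by
        congr 1; ext1 i; exact i.elim0
      simpa [z] using s5
    refine s7.unique ?_
    have e8 : (fun n => P (n+1) (fun _ => x - x0) - P (n+1) (fun _ => projFst (x-x0))) =
        fun i => (x.2 - x0.2) * G i (fun _ => x - x0) :=
      funext fun n => (ddMul_apply (P (n+1)) (x - x0)).symm
    rw [e8]
    exact s6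

lemma hadamard_global {F : ℂ × ℂ → ℂ} {Ω S : Set ℂ} (hΩ : IsOpen Ω)
    (hF : AnalyticOnNhd ℂ F (Ω ×ˢ S)) (p0 : ℂ) (h0 : p0 ∈ S → ∀ z ∈ Ω, F (z, p0) = 0) :
    ∃ g : ℂ × ℂ → ℂ, AnalyticOnNhd ℂ g (Ω ×ˢ S) ∧
      ∀ x ∈ Ω ×ˢ S, F x = (x.2 - p0) * g x := by
  classical
  refine ⟨fun x => if x.2 = p0 then deriv (fun p => F (x.1, p)) p0 else F x / (x.2 - p0), ?_, ?_⟩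
  · rintro ⟨z, p⟩ hx
    by_cases hp : p = p0
    · subst hp
      obtain ⟨g, hg, hgF⟩ := hadamard_local (hF _ hx) (by
        filter_upwards [hΩ.mem_nhds hx.1] with z' hz'
        exact h0 hx.2 z' hz')
      refine hg.congr ?_
      have hga := hg.eventually_analyticAt
      filter_upwards [hgF.eventually_nhds, hga] with x hx1 hx2
      split_ifs with h
      · obtain ⟨z', p'⟩ := x
        simp only at h
        subst h
        have c : Tendsto (fun q : ℂ => (z', q)) (𝓝 p') (𝓝 (z', p')) :=
          (by fun_prop : Continuous (fun q : ℂ => (z', q))).tendsto p'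
        have hx3 := c.eventually hx1
        have : deriv (fun q => F (z', q)) p' = deriv (fun q => (q - p') * g (z', q)) p' :=
          Filter.EventuallyEq.deriv_eq hx3
        simp only
        rw [this]
        have hd : DifferentiableAt ℂ (fun q => g (z', q)) p' :=
          (hx2.fun_comp (f := fun q => (z', q)) (by fun_prop)).differentiableAt
        have := ((hasDerivAt_id p').sub_const p').mul hd.hasDerivAt
        have := this.deriv
        simp at this
        exact this.symm
      · have : F x = _ := hx1.self_of_nhds
        rw [this]
        rw [mul_div_cancel_left₀ _ (sub_ne_zero.2 h)]
    · have : AnalyticAt ℂ (fun x : ℂ × ℂ => F x / (x.2 - p0)) (z, p) :=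
        (hF _ hx).div (analyticAt_snd.sub analyticAt_const) (by simpa [sub_eq_zero] using hp)
      refine this.congr ?_
      have : ∀ᶠ x : ℂ × ℂ in 𝓝 (z, p), x.2 ≠ p0 :=
        (continuous_snd.tendsto (z,p)).eventually (isOpen_ne.mem_nhds hp)
      filter_upwards [this] with x hx
      simp [hx]
  · rintro ⟨z, p⟩ hx
    by_cases hp : p = p0
    · subst hp; simp [h0 hx.2 z hx.1]
    · simp only [hp, if_false]
      rw [mul_div_cancel₀ _ (sub_ne_zero.2 hp)]

section core
open Polynomial

lemma clear_finset {B k : Type*} [CommRing B] [CommRing k] (g : B →+* k) (M : Submonoid B)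
    (E : Finset k) (h : ∀ e ∈ E, ∃ b ∈ M, ∃ a, g a = g b * e) :
    ∃ b ∈ M, ∀ e ∈ E, ∃ a, g a = g b * e := by
  classical
  induction E using Finset.induction_on with
  | empty => exact ⟨1, M.one_mem, by simp⟩
  | insert x s hx ih =>
    obtain ⟨b, hb, hb'⟩ := ih fun e he => h e (Finset.mem_insert_of_mem he)
    obtain ⟨c, hc, a, ha⟩ := h x (Finset.mem_insert_self _ _)
    refine ⟨b * c, M.mul_mem hb hc, fun e he => ?_⟩
    rcases Finset.mem_insert.1 he with rfl | he
    · exact ⟨b * a, by rw [map_mul, map_mul, ha, mul_assoc]⟩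
    · obtain ⟨a', ha'⟩ := hb' e he
      exact ⟨a' * c, by rw [map_mul, map_mul, ha']; ring⟩

lemma clear_polys {B k J : Type*} [CommRing B] [CommRing k] [Fintype J] (g : B →+* k)
    (M : Submonoid B) (f : J → k[X]) (h : ∀ j n, ∃ b ∈ M, ∃ a, g a = g b * (f j).coeff n) :
    ∃ b ∈ M, ∀ j, ∃ F : B[X], F.map g = C (g b) * f j := by
  classical
  obtain ⟨b, hb, hb'⟩ := clear_finset g M (Finset.univ.biUnion fun j => (f j).coeffs) (by
    intro e he
    simp only [Finset.mem_biUnion, Finset.mem_univ, true_and, Polynomial.mem_coeffs_iff] at he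
    obtain ⟨j, n, hn, rfl⟩ := he
    exact h j n)
  refine ⟨b, hb, fun j => ?_⟩
  have : C (g b) * f j ∈ Polynomial.lifts g := by
    rw [Polynomial.lifts_iff_coeff_lifts]
    intro n
    rw [coeff_C_mul]
    by_cases hn : (f j).coeff n = 0
    · exact ⟨0, by simp [hn]⟩
    · obtain ⟨a, ha⟩ := hb' ((f j).coeff n) (by
        simp only [Finset.mem_biUnion, Finset.mem_univ, true_and, Polynomial.mem_coeffs_iff]
        exact ⟨j, n, by simpa using hn, rfl⟩)
      exact ⟨a, ha⟩
  exact (Polynomial.mem_lifts _).1 this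

/-- Reduced form and Bezout over a field. -/
lemma bezout_reduce {k I : Type*} [Field k] [Fintype I] (P : I → k[X]) (Q : k[X]) (hQ : Q ≠ 0) :
    ∃ (G v : k[X]) (P' s : I → k[X]) (t : k[X]), G ≠ 0 ∧ v.Monic ∧ Q = G * v ∧
      (∀ i, P i = G * P' i) ∧ ∑ i, s i * P' i + t * v = 1 := by
  classical
  let f : Option I → k[X] := fun o => o.elim Q P
  let J : Ideal k[X] := Ideal.span (Set.range f)
  obtain ⟨g, hg⟩ := (IsPrincipalIdealRing.principal J).principal
  have hg' : J = Ideal.span {g} := hg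
  have hdiv : ∀ o, g ∣ f o := by
    intro o
    rw [← Ideal.mem_span_singleton, ← hg']
    exact Ideal.subset_span ⟨o, rfl⟩
  have hgm : g ∈ J := by rw [hg']; exact Ideal.mem_span_singleton_self g
  obtain ⟨c, hc⟩ := (Ideal.mem_span_range_iff_exists_fun).1 hgm
  have hdQ : g ∣ Q := hdiv none
  have hdP : ∀ i, g ∣ P i := fun i => hdiv (some i)
  obtain ⟨v0, hv0⟩ := hdQ
  choose p0 hp0 using hdP
  have hg0 : g ≠ 0 := by rintro rfl; simp at hv0; exact hQ hv0
  have hv00 : v0 ≠ 0 := by rintro rfl; simp at hv0; exact hQ hv0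
  have hl : v0.leadingCoeff ≠ 0 := by simpa using hv00
  have hCC : C v0.leadingCoeff * C (v0.leadingCoeff⁻¹) = (1 : k[X]) := by
    rw [← C_mul, mul_inv_cancel₀ hl, C_1]
  refine ⟨g * C v0.leadingCoeff, v0 * C (v0.leadingCoeff⁻¹), fun i => p0 i * C (v0.leadingCoeff⁻¹),
    fun i => c (some i) * C v0.leadingCoeff, c none * C v0.leadingCoeff, ?_,
    monic_mul_leadingCoeff_inv hv00, ?_, ?_, ?_⟩
  · exact mul_ne_zero hg0 (by simpa using hv00)
  · rw [hv0]; linear_combination (-g * v0) * hCC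
  · intro i; rw [hp0 i]; linear_combination (-g * p0 i) * hCC
  · apply mul_left_cancel₀ hg0
    rw [Fintype.sum_option] at hc
    simp only [f, Option.elim] at hc
    have e1 : ∀ i, c (some i) * C v0.leadingCoeff * (p0 i * C v0.leadingCoeff⁻¹) = c (some i) * p0 i := by
      intro i; linear_combination (c (some i) * p0 i) * hCC
    rw [Finset.sum_congr rfl fun i _ => e1 i, mul_one]
    have e2 : ∑ i, c (some i) * P i = g * ∑ i, c (some i) * p0 i := by
      rw [Finset.mul_sum]; refine Finset.sum_congr rfl fun i _ => ?_
      rw [hp0 i]; ring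
    rw [e2] at hc
    linear_combination hc + c none * hv0 * (-1) + (g * c none * v0) * hCC

lemma integral_den {A S : Type*} [CommRing A] [IsDomain A] (ι : ℂ[X] →+* A)
    (hι : Function.Injective ι) (ev : S → A →+* ℂ) (pt : S → ℂ)
    (hev : ∀ p b, ev p (ι b) = b.eval (pt p))
    (φ : FractionRing ℂ[X] →+* FractionRing A)
    (hφ : ∀ b, φ (algebraMap ℂ[X] (FractionRing ℂ[X]) b) = algebraMap A _ (ι b))
    (c : FractionRing ℂ[X]) (hc : IsIntegral A (φ c)) :
    ∃ b : ℂ[X], (∀ p, b.eval (pt p) ≠ 0) ∧ ∃ a, algebraMap ℂ[X] (FractionRing ℂ[X]) a = algebraMap ℂ[X] (FractionRing ℂ[X]) b * c := by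
  obtain ⟨a, b, hab, rfl⟩ := IsFractionRing.exists_reduced_fraction (A := ℂ[X]) c
  refine ⟨b, fun p hp => ?_, a, (IsLocalization.mk'_spec' _ _ _).symm⟩
  have hb0 : (b : ℂ[X]) ≠ 0 := nonZeroDivisors.ne_zero b.2
  have hib : ι b ≠ 0 := by rwa [Ne, map_eq_zero_iff ι hι]
  have e : φ (IsLocalization.mk' _ a b) = IsLocalization.mk' (FractionRing A) (ι a)
      (⟨ι b, mem_nonZeroDivisors_of_ne_zero hib⟩ : nonZeroDivisors A) := by
    rw [IsLocalization.eq_mk'_iff_mul_eq, ← hφ, ← hφ, ← map_mul, IsLocalization.mk'_spec]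
  rw [e] at hc
  obtain ⟨f, hf, hf0⟩ := hc
  have h1 := scaleRoots_aeval_eq_zero_of_aeval_mk'_eq_zero (M := nonZeroDivisors A) hf0
  have h2 : (scaleRoots f (ι b)).eval (ι a) = 0 := by
    apply IsFractionRing.injective A (FractionRing A)
    rw [map_zero, ← h1]
    simp [aeval_algebraMap_apply, coe_aeval_eq_eval]
  have h3 := congrArg (ev p) h2
  rw [map_zero, ← eval_map_apply] at h3
  rw [map_scaleRoots _ _ _ (by simp [hf.leadingCoeff]), hev, hev, hp, scaleRoots_zero] at h3
  rw [(hf.map (ev p)).leadingCoeff, one_smul, eval_pow, eval_X] at h3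
  have ha : a.eval (pt p) = 0 := eq_zero_of_pow_eq_zero h3
  obtain ⟨x, y, hxy⟩ := hab.isCoprime
  have := congrArg (Polynomial.eval (pt p)) hxy
  simp [ha, hp] at this

lemma core {A S I : Type*} [CommRing A] [IsDomain A] [Fintype I] (ι : ℂ[X] →+* A)
    (hι : Function.Injective ι) (ev : S → A →+* ℂ) (pt : S → ℂ)
    (hev : ∀ p b, ev p (ι b) = b.eval (pt p))
    (hunit : ∀ b : ℂ[X], (∀ p, b.eval (pt p) ≠ 0) → IsUnit (ι b))
    (u : A[X]) (hu : u.Monic) (R : I → A[X]) (P : I → ℂ[X][X]) (Q : ℂ[X][X]) (hQ : Q ≠ 0)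
    (h : ∀ i, R i * Q.map ι = u * (P i).map ι) :
    ∃ (V : ℂ[X][X]) (d0 : ℂ[X]) (vA : A[X]), vA.Monic ∧ (∀ p, d0.eval (pt p) ≠ 0) ∧
      V.map ι = C (ι d0) * vA ∧ vA ∣ u ∧ (∀ i, u ∣ R i * vA) ∧
      ∃ d : ℂ[X], d ≠ 0 ∧ ∃ (s : I → ℂ[X][X]) (t : ℂ[X][X]),
        C (ι d) * u = vA * (∑ i, (s i).map ι * R i + t.map ι * u) := by
  classical
  let φ : FractionRing ℂ[X] →+* FractionRing A := IsFractionRing.map hι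
  have hφ : ∀ b, φ (algebraMap _ _ b) = algebraMap A _ (ι b) := fun b => IsLocalization.map_eq _ b
  have hφc : φ.comp (algebraMap _ _) = (algebraMap A (FractionRing A)).comp ι := RingHom.ext hφ
  let al : ℂ[X] →+* FractionRing ℂ[X] := algebraMap _ _
  let AL : A →+* FractionRing A := algebraMap _ _
  have hali : Function.Injective al := IsFractionRing.injective _ _
  have hALi : Function.Injective AL := IsFractionRing.injective _ _
  have hmm : ∀ F : ℂ[X][X], (F.map al).map φ = (F.map ι).map AL := by
    intro F; rw [Polynomial.map_map, Polynomial.map_map]; exact congrArg (fun g => F.map g) hφc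
  obtain ⟨G, v, P', s, t, hG, hv, hQe, hPe, hbez⟩ := bezout_reduce (fun i => (P i).map al) (Q.map al)
    (by rwa [Ne, Polynomial.map_eq_zero_iff hali])
  have hGφ : G.map φ ≠ 0 := by rwa [Ne, Polynomial.map_eq_zero_iff φ.injective]
  have hR : ∀ i, (R i).map AL * v.map φ = u.map AL * (P' i).map φ := by
    intro i
    apply mul_left_cancel₀ hGφ
    have e := congrArg (Polynomial.map AL) (h i)
    rw [Polynomial.map_mul, Polynomial.map_mul, ← hmm, ← hmm, hQe, hPe, Polynomial.map_mul, Polynomial.map_mul] at e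
    linear_combination e
  have hbez' : ∑ i, (s i).map φ * (P' i).map φ + t.map φ * v.map φ = 1 := by
    have := congrArg (Polynomial.map φ) hbez
    simpa [Polynomial.map_sum] using this
  have hueq : u.map AL = v.map φ * (∑ i, (s i).map φ * (R i).map AL + t.map φ * u.map AL) := by
    have : v.map φ * (∑ i, (s i).map φ * (R i).map AL) = u.map AL * ∑ i, (s i).map φ * (P' i).map φ := by
      rw [Finset.mul_sum, Finset.mul_sum]
      refine Finset.sum_congr rfl fun i _ => ?_
      linear_combination (s i).map φ * hR i
    rw [mul_add, this]
    linear_combination (-u.map AL) * hbez'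
  have hvu : v.map φ ∣ u.map AL := ⟨_, hueq⟩
  have hvm : (v.map φ).Monic := hv.map φ
  have h_integral : ∀ n, IsIntegral A (φ (v.coeff n)) := by
    intro n
    have := integralClosure.mem_lifts_of_monic_of_dvd_map (FractionRing A) hu hvm hvu
    rw [Polynomial.lifts_iff_coeff_lifts] at this
    obtain ⟨y, hy⟩ := this n
    rw [coeff_map] at hy
    rw [← hy]
    exact y.2
  let M : Submonoid ℂ[X] :=
    { carrier := {b | ∀ p, b.eval (pt p) ≠ 0}
      one_mem' := by intro p; simp
      mul_mem' := by intro a b ha hb p; rw [eval_mul]; exact mul_ne_zero (ha p) (hb p) }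
  obtain ⟨d0, hd0, hV⟩ := clear_polys al M (fun _ : Unit => v) (by
    intro _ n
    exact integral_den ι hι ev pt hev φ hφ _ (h_integral n))
  obtain ⟨V, hV⟩ := hV ()
  obtain ⟨e, he⟩ := (hunit d0 hd0).exists_left_inv
  have hVA : (V.map ι).map AL = C (AL (ι d0)) * v.map φ := by
    rw [← hmm, hV, Polynomial.map_mul, map_C]; congr 2; exact hφ d0
  have hvA : (C e * V.map ι).map AL = v.map φ := by
    rw [Polynomial.map_mul, hVA, map_C, ← mul_assoc, ← C_mul, ← map_mul, he]; simp
  obtain ⟨vA, hvAdef⟩ : ∃ vA, vA = C e * V.map ι := ⟨_, rfl⟩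
  rw [← hvAdef] at hvA
  have hmi := Polynomial.map_injective AL hALi
  have hvAm : vA.Monic := by
    exact (Function.Injective.monic_map_iff hALi).2 (by rw [hvA]; exact hvm)
  refine ⟨V, d0, vA, hvAm, hd0, ?_, ?_, ?_, ?_⟩
  · apply hmi
    rw [hVA, Polynomial.map_mul, map_C, hvA]
  · rw [← Polynomial.map_dvd_map AL hALi hvAm, hvA]; exact hvu
  · intro i
    rw [← Polynomial.map_dvd_map AL hALi hu, Polynomial.map_mul, hvA]; exact ⟨_, hR i⟩
  · obtain ⟨d, hd, hF⟩ := clear_polys al (nonZeroDivisors ℂ[X]) (fun o : Option I => o.elim t s) (by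
      intro j n
      obtain ⟨⟨a, b⟩, hab⟩ := IsLocalization.surj (nonZeroDivisors ℂ[X]) ((Option.elim j t s).coeff n)
      exact ⟨b, b.2, a, by rw [← hab, mul_comm]⟩)
    choose F hF using hF
    refine ⟨d, nonZeroDivisors.ne_zero hd, fun i => F (some i), F none, hmi ?_⟩
    have hFA : ∀ o, ((F o).map ι).map AL = C (AL (ι d)) * (Option.elim o t s).map φ := by
      intro o
      rw [← hmm, hF, Polynomial.map_mul, map_C]; congr 2; exact hφ d
    simp only [Polynomial.map_mul, Polynomial.map_add, Polynomial.map_sum, hFA, hvA, map_C, Option.elim]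
    nth_rewrite 1 [hueq]
    simp only [mul_assoc]
    rw [← Finset.mul_sum]
    ring
end core

section ring
open Polynomial

/-- The ring of analytic functions on `S`. -/
def anaAlg (S : Set ℂ) : Subalgebra ℂ (S → ℂ) where
  carrier := {f | ∃ g : ℂ → ℂ, AnalyticOnNhd ℂ g S ∧ ∀ x : S, g x = f x}
  mul_mem' := by
    rintro a b ⟨g, hg, hg'⟩ ⟨h, hh, hh'⟩
    exact ⟨fun x => g x * h x, hg.mul hh, fun x => by simp [hg', hh']⟩
  add_mem' := by
    rintro a b ⟨g, hg, hg'⟩ ⟨h, hh, hh'⟩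
    exact ⟨fun x => g x + h x, hg.add hh, fun x => by simp [hg', hh']⟩
  algebraMap_mem' := fun c => ⟨fun _ => c, analyticOnNhd_const, fun x => rfl⟩

/-- an analytic function as an element of the ring -/
def anaMk {S : Set ℂ} (g : ℂ → ℂ) (hg : AnalyticOnNhd ℂ g S) : anaAlg S :=
  ⟨fun x => g x, g, hg, fun _ => rfl⟩

/-- evaluation at a point -/
def anaEv {S : Set ℂ} (p : S) : anaAlg S →+* ℂ :=
  (Pi.evalRingHom (fun _ : S => ℂ) p).comp (anaAlg S).val.toRingHom

lemma anaEv_mk {S : Set ℂ} (p : S) (g : ℂ → ℂ) (hg : AnalyticOnNhd ℂ g S) :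
    anaEv p (anaMk g hg) = g p := rfl

lemma anaEv_alg {S : Set ℂ} (p : S) : (anaEv p).comp (algebraMap ℂ (anaAlg S)) = RingHom.id ℂ :=
  RingHom.ext fun _ => rfl

lemma ana_ext {S : Set ℂ} {a b : anaAlg S} (h : ∀ p, anaEv p a = anaEv p b) : a = b :=
  Subtype.ext (funext h)

lemma anaAlg_isDomain {S : Set ℂ} (hc : IsConnected S) :
    IsDomain (anaAlg S) := by
  have : Nontrivial (anaAlg S) := by
    obtain ⟨p, hp⟩ := hc.nonempty
    refine ⟨0, 1, fun h => ?_⟩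
    have := congrArg (anaEv ⟨p, hp⟩) h
    simp at this
  have : NoZeroDivisors (anaAlg S) := by
    refine ⟨?_⟩
    rintro ⟨a, g, hg, hga⟩ ⟨b, h, hh, hhb⟩ hab
    have : ∀ x ∈ S, g x * h x = 0 := by
      intro x hx
      have := congrArg (anaEv ⟨x, hx⟩) hab
      rw [map_mul, map_zero] at this
      rw [hga ⟨x, hx⟩, hhb ⟨x, hx⟩]
      exact this
    rcases AnalyticOnNhd.eq_zero_or_eq_zero_of_mul_eq_zero hg hh this hc.isPreconnected with h0 | h0
    · left; exact ana_ext fun p => (hga p).symm.trans (h0 p p.2)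
    · right; exact ana_ext fun p => (hhb p).symm.trans (h0 p p.2)
  exact NoZeroDivisors.to_isDomain _

/-- polynomials as analytic functions -/
noncomputable def polyToAna (S : Set ℂ) : ℂ[X] →+* anaAlg S :=
  (aeval (anaMk (S := S) (fun x => x) (fun _ _ => analyticAt_id))).toRingHom

lemma anaEv_polyToAna {S : Set ℂ} (p : S) (b : ℂ[X]) : anaEv p (polyToAna S b) = b.eval (p : ℂ) := by
  have : (anaEv p).comp (polyToAna S) = evalRingHom (p : ℂ) := by
    apply Polynomial.ringHom_ext
    · intro a
      simp [polyToAna]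
      exact RingHom.congr_fun (anaEv_alg p) a
    · simp [polyToAna]
      rfl
  exact RingHom.congr_fun this b

lemma anaEv_comp_polyToAna {S : Set ℂ} (p : S) : (anaEv p).comp (polyToAna S) = evalRingHom (p : ℂ) :=
  RingHom.ext fun b => anaEv_polyToAna p b

lemma polyToAna_inj {S : Set ℂ} (hS : S.Infinite) : Function.Injective (polyToAna S) := by
  rw [injective_iff_map_eq_zero]
  intro b hb
  refine Polynomial.eq_zero_of_infinite_isRoot b (hS.mono fun p hp => ?_)
  have := anaEv_polyToAna ⟨p, hp⟩ b
  rw [hb, map_zero] at this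
  exact this.symm

lemma polyToAna_isUnit {S : Set ℂ} (b : ℂ[X]) (hb : ∀ p : S, b.eval (p : ℂ) ≠ 0) :
    IsUnit (polyToAna S b) := by
  have hb' : AnalyticOnNhd ℂ (fun x => (b.eval x)⁻¹) S := by
    intro x hx
    have h1 : AnalyticAt ℂ (fun x => b.eval x) x := AnalyticAt.aeval_polynomial analyticAt_id b
    exact h1.fun_inv (hb ⟨x, hx⟩)
  refine IsUnit.of_mul_eq_one (anaMk (fun x => (b.eval x)⁻¹) hb') ?_
  · refine ana_ext fun p => ?_
    rw [map_mul, anaEv_polyToAna, anaEv_mk, map_one, mul_inv_cancel₀ (hb p)]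

lemma anaPoly_ext {S : Set ℂ} {F G : (anaAlg S)[X]} (h : ∀ p : S, F.map (anaEv p) = G.map (anaEv p)) :
    F = G := by
  ext1 n
  refine ana_ext fun p => ?_
  have := congrArg (fun q => q.coeff n) (h p)
  simpa [coeff_map] using this

/-- conversions between the two kinds of bivariate polynomials -/
noncomputable def toBi : MvPolynomial (Fin 2) ℂ →+* ℂ[X][X] :=
  (MvPolynomial.aeval (R := ℂ) (![X, C X] : Fin 2 → ℂ[X][X])).toRingHom

/-- conversions between the two kinds of bivariate polynomials -/
noncomputable def ofBi : ℂ[X][X] →+* MvPolynomial (Fin 2) ℂ :=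
  eval₂RingHom (aeval (R := ℂ) (MvPolynomial.X (R := ℂ) (1 : Fin 2))).toRingHom (MvPolynomial.X 0)

lemma toBi_eval (F : MvPolynomial (Fin 2) ℂ) (z p : ℂ) :
    ((toBi F).map (evalRingHom p)).eval z = MvPolynomial.eval ![z, p] F := by
  have : ((evalRingHom z).comp ((mapRingHom (evalRingHom p)).comp toBi)) = MvPolynomial.eval ![z, p] := by
    apply MvPolynomial.ringHom_ext
    · intro r
      simp [toBi, Polynomial.algebraMap_def]
    · intro i
      fin_cases i <;> simp [toBi]
  exact RingHom.congr_fun this F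

lemma ofBi_eval (F : ℂ[X][X]) (z p : ℂ) :
    MvPolynomial.eval ![z, p] (ofBi F) = (F.map (evalRingHom p)).eval z := by
  have : (MvPolynomial.eval ![z, p]).comp ofBi = (evalRingHom z).comp (mapRingHom (evalRingHom p)) := by
    apply Polynomial.ringHom_ext'
    · apply Polynomial.ringHom_ext
      · intro a; simp [ofBi]
      · simp [ofBi]
    · simp [ofBi]
  exact RingHom.congr_fun this F

lemma mv_analytic (F : MvPolynomial (Fin 2) ℂ) (x : ℂ × ℂ) :
    AnalyticAt ℂ (fun q : ℂ × ℂ => MvPolynomial.eval ![q.1, q.2] F) x := by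
  have := AnalyticAt.aeval_mvPolynomial (𝕜 := ℂ) (A := ℂ) (f := fun q : ℂ × ℂ => ![q.1, q.2]) (z := x) (by
    intro i
    fin_cases i
    · exact analyticAt_fst
    · exact analyticAt_snd) F
  exact this

lemma poly_punct (q : ℂ[X]) (hq : q ≠ 0) (z0 : ℂ) : ∀ᶠ z in 𝓝[≠] z0, q.eval z ≠ 0 := by
  have hfin : ({z | q.eval z = 0} \ {z0}).Finite :=
    (Polynomial.finite_setOfPred_isRoot hq).subset Set.sdiff_subset
  have := hfin.isClosed.isOpen_compl.mem_nhds (x := z0) (by simp)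
  filter_upwards [mem_nhdsWithin_of_mem_nhds this, self_mem_nhdsWithin] with z hz hz' h
  exact hz ⟨h, hz'⟩

lemma eq_of_punct {f g : ℂ → ℂ} {z0 : ℂ} (hf : ContinuousAt f z0) (hg : ContinuousAt g z0)
    (h : ∀ᶠ z in 𝓝[≠] z0, f z = g z) : f z0 = g z0 :=
  tendsto_nhds_unique_of_eventuallyEq (hf.tendsto.mono_left nhdsWithin_le_nhds)
    (hg.tendsto.mono_left nhdsWithin_le_nhds) h

lemma factor_lemma {Ω S : Set ℂ} (hΩ : IsOpen Ω) (hS : IsOpen S) (E F : ℂ × ℂ → ℂ)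
    (hE : AnalyticOnNhd ℂ E (Ω ×ˢ S)) (hF : AnalyticOnNhd ℂ F (Ω ×ˢ S))
    (hE0 : ∀ p ∈ S, ∀ z0 ∈ Ω, ∀ᶠ z in 𝓝[≠] z0, E (z, p) ≠ 0) (k : ℕ) :
    ∀ (d : ℂ[X]) (G : ℂ × ℂ → ℂ), d ≠ 0 → d.natDegree = k → AnalyticOnNhd ℂ G (Ω ×ˢ S) →
      (∀ z ∈ Ω, ∀ p ∈ S, d.eval p * F (z, p) = E (z, p) * G (z, p)) →
      ∃ h : ℂ × ℂ → ℂ, AnalyticOnNhd ℂ h (Ω ×ˢ S) ∧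
        ∀ z ∈ Ω, ∀ p ∈ S, F (z, p) = E (z, p) * h (z, p) := by
  have cz : ∀ f : ℂ × ℂ → ℂ, AnalyticOnNhd ℂ f (Ω ×ˢ S) → ∀ z ∈ Ω, ∀ p ∈ S,
      ContinuousAt (fun z => f (z, p)) z := by
    intro f hf z hz p hp
    exact (hf (z, p) ⟨hz, hp⟩).continuousAt.comp (f := fun z => (z, p)) (by fun_prop)
  have cp : ∀ f : ℂ × ℂ → ℂ, AnalyticOnNhd ℂ f (Ω ×ˢ S) → ∀ z ∈ Ω, ∀ p ∈ S,
      ContinuousAt (fun p => f (z, p)) p := by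
    intro f hf z hz p hp
    exact (hf (z, p) ⟨hz, hp⟩).continuousAt.comp (f := fun p => (z, p)) (by fun_prop)
  induction k with
  | zero =>
    intro d G hd hk hG h
    obtain ⟨c, rfl⟩ := Polynomial.natDegree_eq_zero.1 hk
    have hc : c ≠ 0 := by simpa using hd
    refine ⟨fun x => c⁻¹ * G x, fun x hx => analyticAt_const.mul (hG x hx), fun z hz p hp => ?_⟩
    have := h z hz p hp
    rw [eval_C] at this
    field_simp
    linear_combination this
  | succ k ih =>
    intro d G hd hk hG h
    obtain ⟨p0, hp0⟩ := IsAlgClosed.exists_root d (by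
      rw [Polynomial.degree_eq_natDegree hd, hk]; exact_mod_cast Nat.succ_ne_zero k)
    obtain ⟨d', rfl⟩ := Polynomial.dvd_iff_isRoot.2 hp0
    have hd' : d' ≠ 0 := right_ne_zero_of_mul hd
    have hk' : d'.natDegree = k := by
      rw [natDegree_mul (X_sub_C_ne_zero p0) hd', natDegree_X_sub_C] at hk; omega
    obtain ⟨g, hg, hGg⟩ := hadamard_global hΩ hG p0 (by
      intro hp z hz
      refine eq_of_punct (f := fun z => G (z, p0)) (g := fun _ => 0) (cz G hG z hz p0 hp)
        continuousAt_const ?_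
      filter_upwards [hE0 p0 hp z hz, mem_nhdsWithin_of_mem_nhds (hΩ.mem_nhds hz)] with z' h1 h2
      have := h z' h2 p0 hp
      simp at this
      exact this.resolve_left h1)
    refine ih d' g hd' hk' hg ?_
    have key : ∀ z ∈ Ω, ∀ p ∈ S, p ≠ p0 → d'.eval p * F (z, p) = E (z, p) * g (z, p) := by
      intro z hz p hp hne
      have h1 := h z hz p hp
      rw [hGg (z, p) ⟨hz, hp⟩] at h1
      simp only [eval_mul, eval_sub, eval_X, eval_C] at h1
      apply mul_left_cancel₀ (sub_ne_zero.2 hne)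
      linear_combination h1
    intro z hz p hp
    by_cases hne : p = p0
    · subst hne
      refine eq_of_punct (f := fun p => d'.eval p * F (z, p)) (g := fun p => E (z, p) * g (z, p))
        (d'.continuous.continuousAt.mul (cp F hF z hz p hp))
        ((cp E hE z hz p hp).mul (cp g hg z hz p hp)) ?_
      filter_upwards [self_mem_nhdsWithin, mem_nhdsWithin_of_mem_nhds (hS.mem_nhds hp)] with q h1 h2
      exact key z hz q h2 h1
    · exact key z hz p hp hne

end ring

lemma zeroOrder_zero_iff {g : ℂ → ℂ} {l : ℂ} (hg : AnalyticAt ℂ g l) :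
    ZeroOrder g l 0 ↔ g l ≠ 0 := by
  constructor
  · rintro ⟨h, _, hl, he⟩
    have := he.self_of_nhds
    simp at this
    rwa [this]
  · intro h
    exact ⟨g, hg, h, by simp⟩

lemma det_analytic {n : ℕ} {E : Type*} [NormedAddCommGroup E] [NormedSpace ℂ E]
    {M : E → Matrix (Fin n) (Fin n) ℂ} {x : E}
    (h : ∀ i j, AnalyticAt ℂ (fun q => M q i j) x) : AnalyticAt ℂ (fun q => (M q).det) x := by
  simp only [Matrix.det_apply']
  refine Finset.analyticAt_fun_sum _ fun σ _ => ?_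
  have h1 : AnalyticAt ℂ (fun q => ∏ i, M q (σ i) i) x :=
    Finset.analyticAt_fun_prod _ fun i _ => h _ _
  exact analyticAt_const.fun_mul h1

lemma adj_analytic {n : ℕ} {E : Type*} [NormedAddCommGroup E] [NormedSpace ℂ E]
    {M : E → Matrix (Fin n) (Fin n) ℂ} {x : E}
    (h : ∀ i j, AnalyticAt ℂ (fun q => M q i j) x) (i j : Fin n) :
    AnalyticAt ℂ (fun q => (M q).adjugate i j) x := by
  simp only [Matrix.adjugate_apply]
  refine det_analytic fun a b => ?_
  by_cases ha : a = j
  · subst ha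
    simp only [Matrix.updateRow_self]
    exact analyticAt_const
  · simp only [Matrix.updateRow_ne ha]
    exact h a b

open Polynomial in
theorem keldysh_rational_necessary_condition
    (n m : ℕ) (Ω Pdom : Set ℂ)
    (hΩo : IsOpen Ω) (hΩc : IsConnected Ω) (hPo : IsOpen Pdom) (hPc : IsConnected Pdom)
    (T : ℂ → ℂ → Matrix (Fin n) (Fin n) ℂ)
    (hT : ∀ i j, AnalyticOnNhd ℂ (fun q : ℂ × ℂ => T q.1 q.2 i j) (Ω ×ˢ Pdom))
    (hdet : ∀ p ∈ Pdom, ∃ z ∈ Ω, (T z p).det ≠ 0)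
    (hcount : ∀ p ∈ Pdom, EigCount (fun z => (T z p).det) Ω m)
    -- the parametric Keldysh decomposition data
    (α : ℕ → ℂ → ℂ) (R N : ℂ → ℂ → Matrix (Fin n) (Fin n) ℂ)
    (hα : ∀ j < m, AnalyticOnNhd ℂ (α j) Pdom)
    (hR : ∀ i j, AnalyticOnNhd ℂ (fun q : ℂ × ℂ => R q.1 q.2 i j) (Ω ×ˢ Pdom))
    (hN : ∀ i j, AnalyticOnNhd ℂ (fun q : ℂ × ℂ => N q.1 q.2 i j) (Ω ×ˢ Pdom))
    (hroots : ∀ p ∈ Pdom, ∀ z : ℂ, wpoly m α z p = 0 → z ∈ Ω)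
    (hmult : ∀ p ∈ Pdom, ∀ l ∈ Ω, ∀ k : ℕ,
      ZeroOrder (fun z => wpoly m α z p) l k ↔ ZeroOrder (fun z => (T z p).det) l k)
    (hRdeg : ∀ p ∈ Pdom, ∀ i j, PolyDegLt (fun z => R z p i j) m)
    (hdecomp : ∀ z ∈ Ω, ∀ p ∈ Pdom, (T z p).det ≠ 0 →
      (T z p)⁻¹ = (wpoly m α z p)⁻¹ • R z p + N z p)
    -- rationality of `H = R/u` in both variables
    (Pm : Fin n → Fin n → MvPolynomial (Fin 2) ℂ) (Q : MvPolynomial (Fin 2) ℂ)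
    (hQne : ∃ z ∈ Ω, ∃ p ∈ Pdom, MvPolynomial.eval ![z, p] Q ≠ 0)
    (hrat : ∀ z ∈ Ω, ∀ p ∈ Pdom, MvPolynomial.eval ![z, p] Q ≠ 0 → wpoly m α z p ≠ 0 →
      ∀ i j, R z p i j / wpoly m α z p =
        MvPolynomial.eval ![z, p] (Pm i j) / MvPolynomial.eval ![z, p] Q) :
    ∃ (uhat : MvPolynomial (Fin 2) ℂ) (h : ℂ → ℂ → ℂ),
      AnalyticOnNhd ℂ (fun q : ℂ × ℂ => h q.1 q.2) (Ω ×ˢ Pdom) ∧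
      (∀ z ∈ Ω, ∀ p ∈ Pdom, (T z p).det = MvPolynomial.eval ![z, p] uhat * h z p) ∧
      ∀ p ∈ Pdom, {z : ℂ | MvPolynomial.eval ![z, p] uhat = 0} =
        {z : ℂ | z ∈ Ω ∧ (T z p).det = 0} := by
  classical
  have hΩinf : Ω.Infinite := by
    obtain ⟨z, hz⟩ := hΩc.nonempty
    exact infinite_of_mem_nhds z (hΩo.mem_nhds hz)
  have hPinf : Pdom.Infinite := by
    obtain ⟨z, hz⟩ := hPc.nonempty
    exact infinite_of_mem_nhds z (hPo.mem_nhds hz)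
  haveI := anaAlg_isDomain hPc
  let xe := hΩinf.natEmbedding
  let x : ℕ → ℂ := fun k => xe k
  have hx : ∀ k, x k ∈ Ω := fun k => (xe k).2
  have hxi : Function.Injective x := fun a b h => xe.injective (Subtype.ext h)
  have slice : ∀ (f : ℂ × ℂ → ℂ), AnalyticOnNhd ℂ f (Ω ×ˢ Pdom) → ∀ z ∈ Ω,
      AnalyticOnNhd ℂ (fun p => f (z, p)) Pdom := by
    intro f hf z hz p hp
    exact (hf (z, p) ⟨hz, hp⟩).fun_comp (f := fun p => (z, p))
      (analyticAt_const.prod analyticAt_id)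
  have slice2 : ∀ (f : ℂ × ℂ → ℂ), AnalyticOnNhd ℂ f (Ω ×ˢ Pdom) → ∀ p ∈ Pdom, ∀ z ∈ Ω,
      AnalyticAt ℂ (fun z => f (z, p)) z := by
    intro f hf p hp z hz
    exact (hf (z, p) ⟨hz, hp⟩).fun_comp (f := fun z => (z, p))
      (analyticAt_id.prod analyticAt_const)
  -- the polynomial `u` over the ring of analytic functions
  let al : ℕ → anaAlg Pdom := fun j => if h : j < m then anaMk (α j) (hα j h) else 0
  let uA : (anaAlg Pdom)[X] := X ^ m + ∑ j ∈ Finset.range m, C (al j) * X ^ j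
  have huA : uA.Monic := by
    refine monic_X_pow_add ?_
    refine (degree_sum_le _ _).trans_lt ?_
    rw [Finset.sup_lt_iff (by exact WithBot.bot_lt_coe m)]
    intro j hj
    exact (degree_C_mul_X_pow_le _ _).trans_lt (by exact_mod_cast Finset.mem_range.1 hj)
  have huAe : ∀ (p : Pdom) (z : ℂ), (uA.map (anaEv p)).eval z = wpoly m α z p := by
    intro p z
    simp only [uA, wpoly, Polynomial.map_add, Polynomial.map_pow, map_X, Polynomial.map_sum,
      Polynomial.map_mul, map_C, eval_add, eval_pow, eval_X, eval_finset_sum, eval_mul, eval_C]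
    congr 1
    refine Finset.sum_congr rfl fun j hj => ?_
    have hj' := Finset.mem_range.1 hj
    simp only [al, hj', dif_pos, anaEv_mk]
  -- the polynomials `R`
  let RA : Fin n × Fin n → (anaAlg Pdom)[X] := fun ij => ∑ k ∈ Finset.range m,
    C (anaMk (fun p => R (x k) p ij.1 ij.2) (slice _ (hR ij.1 ij.2) (x k) (hx k))) *
      (Lagrange.basis (Finset.range m) x k).map (algebraMap ℂ (anaAlg Pdom))
  have hRAe : ∀ ij (p : Pdom) (z : ℂ), ((RA ij).map (anaEv p)).eval z = R z p ij.1 ij.2 := by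
    intro ij p z
    obtain ⟨q, hq, hqe⟩ := hRdeg p p.2 ij.1 ij.2
    have h1 := Lagrange.eq_interpolate_of_eval_eq (s := Finset.range m) (v := x)
      (fun k => R (x k) p ij.1 ij.2) hxi.injOn (f := q) (by simpa using hq) (fun k _ => (hqe (x k)).symm)
    have h2 : (RA ij).map (anaEv p) = q := by
      rw [h1, Lagrange.interpolate_apply]
      simp only [RA, Polynomial.map_sum, Polynomial.map_mul, map_C, anaEv_mk, Polynomial.map_map,
        anaEv_alg, Polynomial.map_id]
    rw [h2]; exact (hqe z).symm
  have hmapι : ∀ (F : ℂ[X][X]) (p : Pdom),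
      (F.map (polyToAna Pdom)).map (anaEv p) = F.map (evalRingHom (p : ℂ)) := by
    intro F p
    rw [Polynomial.map_map, anaEv_comp_polyToAna]
  have hQ0 : toBi Q ≠ 0 := by
    obtain ⟨z, _, p, _, hzp⟩ := hQne
    intro h0
    apply hzp
    rw [← toBi_eval, h0]; simp
  have hιi := polyToAna_inj hPinf
  have hrel : ∀ ij : Fin n × Fin n, RA ij * (toBi Q).map (polyToAna Pdom) =
      uA * (toBi (Pm ij.1 ij.2)).map (polyToAna Pdom) := by
    intro ij
    have hQ1 : (toBi Q).map (polyToAna Pdom) ≠ 0 := by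
      rwa [Ne, Polynomial.map_eq_zero_iff hιi]
    have h0 : (RA ij * (toBi Q).map (polyToAna Pdom) -
        uA * (toBi (Pm ij.1 ij.2)).map (polyToAna Pdom)) * ((toBi Q).map (polyToAna Pdom) * uA) = 0 := by
      refine anaPoly_ext fun p => ?_
      rw [Polynomial.map_zero]
      refine Polynomial.eq_zero_of_infinite_isRoot _ (hΩinf.mono fun z hz => ?_)
      simp only [Set.mem_setOf_eq, IsRoot.def]
      simp only [Polynomial.map_mul, Polynomial.map_sub, hmapι, eval_mul, eval_sub, hRAe, huAe,
        toBi_eval]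
      by_cases h1 : MvPolynomial.eval ![z, (p : ℂ)] Q = 0
      · simp [h1]
      by_cases h2 : wpoly m α z p = 0
      · simp [h2]
      have h3 := hrat z hz p p.2 h1 h2 ij.1 ij.2
      rw [div_eq_div_iff h2 h1] at h3
      rw [h3]; ring
    rcases mul_eq_zero.1 h0 with h1 | h1
    · exact sub_eq_zero.1 h1
    · exact absurd h1 (mul_ne_zero hQ1 huA.ne_zero)
  obtain ⟨V, d0, vA, hvAm, hd0, hV, hvu, huR, d, hd, s, t, hst⟩ :=
    core (polyToAna Pdom) hιi (fun p => anaEv p) (fun p : Pdom => (p : ℂ))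
      (fun p b => anaEv_polyToAna p b) (fun b hb => polyToAna_isUnit b hb) uA huA RA
      (fun ij => toBi (Pm ij.1 ij.2)) (toBi Q) hQ0 hrel
  -- pointwise consequences
  let v : ℂ → Pdom → ℂ := fun z p => (vA.map (anaEv p)).eval z
  have hVe : ∀ z (p : Pdom), MvPolynomial.eval ![z, (p : ℂ)] (ofBi V) = d0.eval (p : ℂ) * v z p := by
    intro z p
    rw [ofBi_eval, ← hmapι, hV]
    simp [v, anaEv_polyToAna]
  have hdetan : AnalyticOnNhd ℂ (fun q : ℂ × ℂ => (T q.1 q.2).det) (Ω ×ˢ Pdom) := fun q hq =>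
    det_analytic fun i j => hT i j q hq
  have huan : ∀ (p : Pdom) (z : ℂ), AnalyticAt ℂ (fun z => wpoly m α z p) z := by
    intro p z
    have h1 : AnalyticAt ℂ (fun z => (uA.map (anaEv p)).eval z) z :=
      AnalyticAt.aeval_polynomial analyticAt_id _
    simpa only [huAe] using h1
  have hiff : ∀ z ∈ Ω, ∀ p ∈ Pdom, (T z p).det = 0 ↔ wpoly m α z p = 0 := by
    intro z hz p hp
    have := hmult p hp z hz 0
    rw [zeroOrder_zero_iff (huan ⟨p, hp⟩ z), zeroOrder_zero_iff (slice2 _ hdetan p hp z hz)] at this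
    exact (not_iff_not.1 this).symm
  have hupunct : ∀ (p : Pdom) (z0 : ℂ), ∀ᶠ z in 𝓝[≠] z0, wpoly m α z p ≠ 0 := by
    intro p z0
    have := poly_punct (uA.map (anaEv p)) (huA.map _).ne_zero z0
    simpa only [huAe] using this
  let W : Fin n × Fin n → ℂ × ℂ → ℂ := fun ij q =>
    (T q.1 q.2).adjugate ij.1 ij.2 - (T q.1 q.2).det * N q.1 q.2 ij.1 ij.2
  have hWan : ∀ ij, AnalyticOnNhd ℂ (W ij) (Ω ×ˢ Pdom) := fun ij q hq =>
    (adj_analytic (fun i j => hT i j q hq) ij.1 ij.2).sub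
      ((hdetan q hq).mul (hN ij.1 ij.2 q hq))
  have hW : ∀ ij, ∀ z ∈ Ω, ∀ p ∈ Pdom,
      (T z p).det * R z p ij.1 ij.2 = wpoly m α z p * W ij (z, p) := by
    intro ij z hz p hp
    by_cases h0 : (T z p).det = 0
    · rw [h0, (hiff z hz p hp).1 h0]; ring
    · have h1 : wpoly m α z p ≠ 0 := fun h => h0 ((hiff z hz p hp).2 h)
      have h2 := congrFun (congrFun (hdecomp z hz p hp h0) ij.1) ij.2
      rw [Matrix.inv_def, Ring.inverse_eq_inv'] at h2
      simp only [Matrix.smul_apply, Matrix.add_apply, smul_eq_mul] at h2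
      simp only [W]
      field_simp at h2
      linear_combination (-1) * h2
  let G : ℂ × ℂ → ℂ := fun q => ∑ ij, MvPolynomial.eval ![q.1, q.2] (ofBi (s ij)) * W ij q +
    MvPolynomial.eval ![q.1, q.2] (ofBi t) * (T q.1 q.2).det
  have hGan : AnalyticOnNhd ℂ G (Ω ×ˢ Pdom) := by
    intro q hq
    refine AnalyticAt.fun_add ?_ ((mv_analytic _ q).fun_mul (hdetan q hq))
    exact Finset.analyticAt_fun_sum _ fun ij _ => (mv_analytic _ q).fun_mul (hWan ij q hq)
  have hEan : AnalyticOnNhd ℂ (fun q : ℂ × ℂ => MvPolynomial.eval ![q.1, q.2] (ofBi V)) (Ω ×ˢ Pdom) :=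
    fun q _ => mv_analytic _ q
  have hG0 : ∀ z ∈ Ω, ∀ p ∈ Pdom, wpoly m α z p ≠ 0 → (d * d0).eval p * (T z p).det =
      MvPolynomial.eval ![z, p] (ofBi V) * G (z, p) := by
    intro z hz p hp hu
    have h1 := congrArg (fun F => (F.map (anaEv ⟨p, hp⟩)).eval z) hst
    simp only [Polynomial.map_mul, Polynomial.map_add, Polynomial.map_sum, hmapι, eval_mul, eval_add,
      eval_finset_sum, hRAe, huAe, map_C, eval_C, anaEv_polyToAna, ← ofBi_eval] at h1
    have h2 : (∑ ij, MvPolynomial.eval ![z, p] (ofBi (s ij)) * R z p ij.1 ij.2) * (T z p).det =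
        wpoly m α z p * ∑ ij, MvPolynomial.eval ![z, p] (ofBi (s ij)) * W ij (z, p) := by
      rw [Finset.sum_mul, Finset.mul_sum]
      refine Finset.sum_congr rfl fun ij _ => ?_
      linear_combination MvPolynomial.eval ![z, p] (ofBi (s ij)) * hW ij z hz p hp
    rw [hVe z ⟨p, hp⟩]
    apply mul_left_cancel₀ hu
    simp only [G, eval_mul, v]
    linear_combination (d0.eval p * (T z p).det) * h1 +
      (d0.eval p * (vA.map (anaEv ⟨p, hp⟩)).eval z) * h2
  have hVpunct : ∀ p ∈ Pdom, ∀ z0 ∈ Ω, ∀ᶠ z in 𝓝[≠] z0,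
      MvPolynomial.eval ![z, p] (ofBi V) ≠ 0 := by
    intro p hp z0 _
    filter_upwards [poly_punct (vA.map (anaEv ⟨p, hp⟩)) (hvAm.map _).ne_zero z0] with z hz
    rw [hVe z ⟨p, hp⟩]
    exact mul_ne_zero (hd0 ⟨p, hp⟩) hz
  have hG : ∀ z ∈ Ω, ∀ p ∈ Pdom, (d * d0).eval p * (T z p).det =
      MvPolynomial.eval ![z, p] (ofBi V) * G (z, p) := by
    intro z hz p hp
    refine eq_of_punct (f := fun z => (d * d0).eval p * (T z p).det)
      (g := fun z => MvPolynomial.eval ![z, p] (ofBi V) * G (z, p))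
      (continuousAt_const.mul (slice2 _ hdetan p hp z hz).continuousAt)
      ((slice2 _ hEan p hp z hz).continuousAt.mul (slice2 _ hGan p hp z hz).continuousAt) ?_
    filter_upwards [hupunct ⟨p, hp⟩ z, mem_nhdsWithin_of_mem_nhds (hΩo.mem_nhds hz)] with z' h1 h2
    exact hG0 z' h2 p hp h1
  have hd00 : d0 ≠ 0 := by
    obtain ⟨p, hp⟩ := hPc.nonempty
    rintro rfl
    exact hd0 ⟨p, hp⟩ (by simp)
  obtain ⟨h, hh, hfac⟩ := factor_lemma hΩo hPo _ _ hEan hdetan hVpunct _ (d * d0) G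
    (mul_ne_zero hd hd00) rfl hGan hG
  refine ⟨ofBi V, fun z p => h (z, p), hh, hfac, fun p hp => ?_⟩
  ext z
  simp only [Set.mem_setOf_eq]
  constructor
  · intro hz
    rw [hVe z ⟨p, hp⟩] at hz
    have hv0 := (mul_eq_zero.1 hz).resolve_left (hd0 ⟨p, hp⟩)
    obtain ⟨w, hw⟩ := hvu
    have hu0 : wpoly m α z p = 0 := by
      rw [← huAe ⟨p, hp⟩ z, hw, Polynomial.map_mul, eval_mul]
      exact mul_eq_zero_of_left hv0 _
    have hzΩ := hroots p hp z hu0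
    exact ⟨hzΩ, (hiff z hzΩ p hp).2 hu0⟩
  · rintro ⟨hz, hdet0⟩
    rw [hVe z ⟨p, hp⟩]
    by_contra hne
    have hv0 : v z ⟨p, hp⟩ ≠ 0 := right_ne_zero_of_mul hne
    choose P' hP' using huR
    let M : ℂ → Matrix (Fin n) (Fin n) ℂ := fun z' => Matrix.of fun i j =>
      ((P' (i, j)).map (anaEv ⟨p, hp⟩)).eval z' / v z' ⟨p, hp⟩ + N z' p i j
    have hMan : AnalyticAt ℂ (fun z' => (M z').det) z := by
      refine det_analytic fun i j => ?_
      simp only [M, Matrix.of_apply]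
      have a1 : ∀ q : ℂ[X], AnalyticAt ℂ (fun z => q.eval z) z := fun q =>
        AnalyticAt.aeval_polynomial analyticAt_id q
      exact ((a1 _).fun_div (a1 _) hv0).fun_add (slice2 _ (hN i j) p hp z hz)
    have hvp : ∀ᶠ z' in 𝓝[≠] z, v z' ⟨p, hp⟩ ≠ 0 :=
      poly_punct (vA.map (anaEv ⟨p, hp⟩)) (hvAm.map _).ne_zero z
    have key : (T z p).det * (M z).det = 1 := by
      refine eq_of_punct (f := fun z' => (T z' p).det * (M z').det) (g := fun _ => 1)
        ((slice2 _ hdetan p hp z hz).continuousAt.mul hMan.continuousAt) continuousAt_const ?_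
      filter_upwards [hupunct ⟨p, hp⟩ z, hvp,
        mem_nhdsWithin_of_mem_nhds (hΩo.mem_nhds hz)] with z' h1 h2 h3
      have h4 : (T z' p).det ≠ 0 := fun h => h1 ((hiff z' h3 p hp).1 h)
      have h5 : M z' = (T z' p)⁻¹ := by
        rw [hdecomp z' h3 p hp h4]
        ext i j
        have h6 := congrArg (fun F => (F.map (anaEv ⟨p, hp⟩)).eval z') (hP' (i, j))
        simp only [Polynomial.map_mul, eval_mul, hRAe, huAe] at h6
        simp only [M, Matrix.of_apply, Matrix.add_apply, Matrix.smul_apply, smul_eq_mul]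
        congr 1
        rw [inv_mul_eq_div, div_eq_div_iff h2 h1]
        simp only [v]
        linear_combination (-1) * h6
      rw [h5, ← Matrix.det_mul, Matrix.mul_nonsing_inv _ (isUnit_iff_ne_zero.2 h4), Matrix.det_one]
    rw [hdet0, zero_mul] at key
    exact zero_ne_one key
end

section
/- Let Ω, Π ⊆ ℂ be domains and let f : ℂ×ℂ → ℂ be analytic on Ω×Π such that for every p ∈ Π, f(·,p) is not identically zero on Ω, its zero set in Ω is finite, and the sum over these zeros of the orders of vanishing equals m. Then there exist unique functions α_0, …, α_{m−1} : ℂ → ℂ analytic on Π and a unique function h analytic on Ω×Π with h(z,p) ≠ 0 for all (z,p) ∈ Ω×Π, such that for all (z,p) ∈ Ω×Π, f(z,p) = (z^m + α_{m−1}(p) z^{m−1} + ⋯ + α_1(p) z + α_0(p)) · h(z,p). -/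
section WP
open Metric Set Filter Topology

namespace WP

lemma wpA {K : Type*} [TopologicalSpace K] [CompactSpace K] (F : K → ℂ → ℂ) (p₀ : ℂ) (ρ : ℝ)
    (hρ : 0 < ρ)
    (hc : ContinuousOn (fun q : K × ℂ => F q.1 q.2) (univ ×ˢ closedBall p₀ ρ))
    (hd : ∀ k, DifferentiableOn ℂ (F k) (closedBall p₀ ρ)) :
    ∃ Φ : ℂ → C(K, ℂ), AnalyticAt ℂ Φ p₀ ∧ ∀ p ∈ ball p₀ ρ, ∀ k, Φ p k = F k p := by
  classical
  have hk : ∀ q ∈ closedBall p₀ ρ, Continuous (fun k => F k q) := by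
    intro q hq
    exact hc.comp_continuous (f := fun k : K => (k, q)) (by fun_prop) (fun k => ⟨trivial, hq⟩)
  let G : ℂ → C(K, ℂ) := fun q => if h : q ∈ closedBall p₀ ρ then ⟨fun k => F k q, hk q h⟩ else 0
  have hG : ∀ q ∈ closedBall p₀ ρ, ∀ k, G q k = F k q := by
    intro q hq k
    simp only [G, dif_pos hq]; rfl
  have hGc : ContinuousOn G (closedBall p₀ ρ) := by
    rw [continuousOn_iff_continuous_domRestrict]
    apply ContinuousMap.continuous_of_continuous_uncurry
    have : Continuous (fun x : closedBall p₀ ρ × K => F x.2 x.1) :=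
      hc.comp_continuous (f := fun x : closedBall p₀ ρ × K => (x.2, (x.1 : ℂ))) (by fun_prop)
        (fun k => ⟨trivial, k.1.2⟩)
    convert this using 2 with x
    exact hG _ x.1.2 _
  have hGi : CircleIntegrable G p₀ ρ :=
    (hGc.mono sphere_subset_closedBall).circleIntegrable hρ.le
  lift ρ to NNReal using hρ.le
  refine ⟨fun p => (2 * Real.pi * Complex.I : ℂ)⁻¹ • ∮ q in C(p₀, ρ), (q - p)⁻¹ • G q, ?_, ?_⟩
  · exact (hasFPowerSeriesOn_cauchy_integral hGi (by exact_mod_cast hρ)).analyticAt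
  · intro p hp k
    have hci : CircleIntegrable (fun q => (q - p)⁻¹ • G q) p₀ ρ := by
      apply ContinuousOn.circleIntegrable hρ.le
      refine ContinuousOn.smul (f := fun q : ℂ => (q - p)⁻¹)
        (ContinuousOn.inv₀ (f := fun q : ℂ => q - p) (by fun_prop) ?_) (hGc.mono sphere_subset_closedBall)
      intro q hq h0
      rw [sub_eq_zero] at h0
      subst h0
      simp only [mem_sphere, mem_ball] at hq hp
      linarith
    have h1 : (ContinuousMap.evalCLM ℂ k) (∮ q in C(p₀, ρ), (q - p)⁻¹ • G q)
        = ∮ q in C(p₀, ρ), (q - p)⁻¹ • F k q := by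
      have h2 := hci.out
      rw [circleIntegral, ← ContinuousLinearMap.intervalIntegral_comp_comm _ h2, circleIntegral]
      apply intervalIntegral.integral_congr
      intro θ _
      have : G (circleMap p₀ ρ θ) k = F k (circleMap p₀ ρ θ) :=
        hG _ (sphere_subset_closedBall (circleMap_mem_sphere _ hρ.le _)) _
      simp [ContinuousMap.evalCLM_apply, this]
    have h3 := DiffContOnCl.two_pi_i_inv_smul_circleIntegral_sub_inv_smul (c := p₀) (w := p)
      (f := F k) (R := ρ) (DifferentiableOn.diffContOnCl_ball (U := closedBall p₀ ρ) (hd k) subset_rfl) hp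
    rw [← h1] at h3
    rw [← h3]
    rfl

lemma wpB (F : ℂ → ℂ → ℂ) (c : ℂ) (R : ℝ) (p₀ : ℂ)
    (hF : ∀ w ∈ sphere c R, AnalyticAt ℂ (fun q : ℂ × ℂ => F q.1 q.2) (w, p₀)) :
    ∃ Φ : ℂ → C(sphere c R, ℂ), AnalyticAt ℂ Φ p₀ ∧
      ∀ᶠ p in 𝓝 p₀, ∀ w (hw : w ∈ sphere c R), Φ p ⟨w, hw⟩ = F w p := by
  have ho := isOpen_analyticAt ℂ (fun q : ℂ × ℂ => F q.1 q.2)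
  obtain ⟨u, v, hu, hv, hsu, hpv, huv⟩ := generalized_tube_lemma (isCompact_sphere c R)
    (isCompact_singleton (x := p₀)) ho (by
      rintro ⟨w, p⟩ ⟨hw, hp⟩
      simp only [mem_singleton_iff] at hp
      subst hp
      exact hF w hw)
  obtain ⟨ρ, hρ, hb⟩ := Metric.nhds_basis_closedBall.mem_iff.1 (hv.mem_nhds (hpv rfl))
  have hA : ∀ w ∈ sphere c R, ∀ p ∈ closedBall p₀ ρ,
      AnalyticAt ℂ (fun q : ℂ × ℂ => F q.1 q.2) (w, p) :=
    fun w hw p hp => huv ⟨hsu hw, hb hp⟩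
  obtain ⟨Φ, h1, h2⟩ := wpA (K := sphere c R) (fun w p => F w p) p₀ ρ hρ (by
      rintro ⟨w, p⟩ ⟨-, hp⟩
      have := (hA w w.2 p hp).continuousAt
      exact (ContinuousAt.comp (f := fun q : sphere c R × ℂ => ((q.1 : ℂ), q.2)) (x := (w, p)) this
        (by fun_prop)).continuousWithinAt) (by
      intro w p hp
      have := (hA w w.2 p hp).differentiableAt
      exact (DifferentiableAt.comp (f := fun q : ℂ => ((w : ℂ), q)) p this
        (by fun_prop)).differentiableWithinAt)
  refine ⟨Φ, h1, ?_⟩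
  filter_upwards [ball_mem_nhds p₀ hρ] with p hp w hw
  exact h2 p hp ⟨w, hw⟩

lemma wpL (c : ℂ) (R : ℝ) (hR : 0 < R) : ∃ L : C(sphere c R, ℂ) →L[ℂ] ℂ,
    ∀ (φ : C(sphere c R, ℂ)) (g : ℂ → ℂ), (∀ w (hw : w ∈ sphere c R), φ ⟨w, hw⟩ = g w) →
      L φ = ∮ w in C(c, R), g w := by
  classical
  let E : C(sphere c R, ℂ) → ℂ → ℂ := fun φ w => if h : w ∈ sphere c R then φ ⟨w, h⟩ else 0
  have hE : ∀ φ w (hw : w ∈ sphere c R), E φ w = φ ⟨w, hw⟩ := fun φ w hw => dif_pos hw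
  have hEi : ∀ φ, CircleIntegrable (E φ) c R := by
    intro φ
    apply ContinuousOn.circleIntegrable hR.le
    rw [continuousOn_iff_continuous_domRestrict]
    convert φ.continuous using 1
    ext w
    exact hE φ w w.2
  let L0 : C(sphere c R, ℂ) →ₗ[ℂ] ℂ :=
    { toFun := fun φ => ∮ w in C(c, R), E φ w
      map_add' := by
        intro φ ψ
        rw [← circleIntegral.integral_add (hEi φ) (hEi ψ)]
        apply circleIntegral.integral_congr hR.le
        intro w hw
        simp only [hE _ w hw]; rfl
      map_smul' := by
        intro a φ
        simp only [RingHom.id_apply]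
        rw [← circleIntegral.integral_smul]
        apply circleIntegral.integral_congr hR.le
        intro w hw
        simp only [hE _ w hw]; rfl }
  refine ⟨L0.mkContinuous (2 * Real.pi * R) ?_, ?_⟩
  · intro φ
    show ‖∮ w in C(c, R), E φ w‖ ≤ _
    apply circleIntegral.norm_integral_le_of_norm_le_const hR.le
    intro w hw
    rw [hE _ w hw]
    exact φ.norm_coe_le_norm _
  · intro φ g hg
    show (∮ w in C(c, R), E φ w) = _
    apply circleIntegral.integral_congr hR.le
    intro w hw
    show E φ w = g w
    rw [hE _ w hw, hg]

lemma wpC (F : ℂ → ℂ → ℂ) (c : ℂ) (R : ℝ) (hR : 0 < R) (p₀ : ℂ)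
    (hF : ∀ w ∈ sphere c R, AnalyticAt ℂ (fun q : ℂ × ℂ => F q.1 q.2) (w, p₀)) :
    AnalyticAt ℂ (fun p => ∮ w in C(c, R), F w p) p₀ := by
  obtain ⟨L, hL⟩ := wpL c R hR
  obtain ⟨Φ, h1, h2⟩ := wpB F c R p₀ hF
  refine ((L.analyticAt _).comp h1).congr ?_
  filter_upwards [h2] with p hp
  exact hL _ _ hp

lemma wpD (F : ℂ → ℂ → ℂ) (c : ℂ) (R : ℝ) (hR : 0 < R) (p₀ z₀ : ℂ) (hz₀ : z₀ ∈ ball c R)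
    (hF : ∀ w ∈ sphere c R, AnalyticAt ℂ (fun q : ℂ × ℂ => F q.1 q.2) (w, p₀)) :
    AnalyticAt ℂ (fun q : ℂ × ℂ => ∮ w in C(c, R), (w - q.1)⁻¹ * F w q.2) (z₀, p₀) := by
  obtain ⟨L, hL⟩ := wpL c R hR
  obtain ⟨Φ, h1, h2⟩ := wpB F c R p₀ hF
  obtain ⟨Ψ, h3, h4⟩ := wpB (fun w z => (w - z)⁻¹) c R z₀ (by
    intro w hw
    refine AnalyticAt.inv (analyticAt_fst.sub analyticAt_snd) ?_
    intro h0
    simp only [sub_eq_zero] at h0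
    subst h0
    simp only [mem_sphere, mem_ball] at hw hz₀
    linarith)
  have h5 : AnalyticAt ℂ (fun q : ℂ × ℂ => Ψ q.1 * Φ q.2) (z₀, p₀) :=
    (AnalyticAt.comp (f := Prod.fst) (x := (z₀, p₀)) h3 analyticAt_fst).mul
    (AnalyticAt.comp (f := Prod.snd) (x := (z₀, p₀)) h1 analyticAt_snd)
  refine ((L.analyticAt _).comp h5).congr ?_
  filter_upwards [continuousAt_fst.eventually h4, continuousAt_snd.eventually h2] with q hq hq'
  apply hL
  intro w hw
  simp [hq, hq']

lemma wpFac (g : ℂ → ℂ) (Ω : Set ℂ) (hg : AnalyticOnNhd ℂ g Ω)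
    (Z : Finset ℂ) (ord : ℂ → ℕ) (h0 : ∀ z ∈ Ω, g z = 0 ↔ z ∈ Z)
    (hZ : ∀ z ∈ Z, ZeroOrder g z (ord z)) :
    ∃ u : ℂ → ℂ, AnalyticOnNhd ℂ u Ω ∧ (∀ z ∈ Ω, u z ≠ 0) ∧
      ∀ z ∈ Ω, g z = (∏ w ∈ Z, (z - w) ^ ord w) * u z := by
  classical
  choose! H hHa hHn hHe using hZ
  let u : ℂ → ℂ := fun z => if z ∈ Z then H z z / ∏ w ∈ Z.erase z, (z - w) ^ ord w
    else g z / ∏ w ∈ Z, (z - w) ^ ord w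
  have hprod : ∀ (S : Finset ℂ) (z : ℂ), z ∉ S → ∏ w ∈ S, (z - w) ^ ord w ≠ 0 := by
    intro S z hz
    refine Finset.prod_ne_zero_iff.2 fun w hw => pow_ne_zero _ (sub_ne_zero.2 ?_)
    rintro rfl
    exact hz hw
  have hprodA : ∀ (S : Finset ℂ) (z : ℂ), AnalyticAt ℂ (fun z => ∏ w ∈ S, (z - w) ^ ord w) z := by
    intro S z
    fun_prop
  refine ⟨u, ?_, ?_, ?_⟩
  · intro z hz
    by_cases hzZ : z ∈ Z
    · have h1 : AnalyticAt ℂ (fun y => H z y / ∏ w ∈ Z.erase z, (y - w) ^ ord w) z :=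
        (hHa z hzZ).div (hprodA _ _) (hprod _ _ (by simp))
      refine h1.congr ?_
      have h2 : ∀ᶠ y in 𝓝 z, y ∉ Z.erase z := by
        have : IsClosed ((Z.erase z : Finset ℂ) : Set ℂ) := (Z.erase z).finite_toSet.isClosed
        exact this.isOpen_compl.mem_nhds (by simp)
      filter_upwards [h2, hHe z hzZ] with y hy hy2
      by_cases hyz : y = z
      · subst hyz
        simp only [u, if_pos hzZ]
      · have hyZ : y ∉ Z := fun h => hy (Finset.mem_erase.2 ⟨hyz, h⟩)
        simp only [u, if_neg hyZ]
        rw [hy2, ← Finset.mul_prod_erase Z _ hzZ, mul_div_mul_left]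
        exact pow_ne_zero _ (sub_ne_zero.2 hyz)
    · have h1 : AnalyticAt ℂ (fun y => g y / ∏ w ∈ Z, (y - w) ^ ord w) z :=
        (hg z hz).div (hprodA _ _) (hprod _ _ hzZ)
      refine h1.congr ?_
      have h2 : ∀ᶠ y in 𝓝 z, y ∉ Z := by
        have : IsClosed (Z : Set ℂ) := Z.finite_toSet.isClosed
        exact this.isOpen_compl.mem_nhds (by simpa using hzZ)
      filter_upwards [h2] with y hy
      simp only [u, if_neg hy]
  · intro z hz
    by_cases hzZ : z ∈ Z
    · simp only [u, if_pos hzZ]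
      exact div_ne_zero (hHn z hzZ) (hprod _ _ (by simp))
    · simp only [u, if_neg hzZ]
      exact div_ne_zero (fun h => hzZ ((h0 z hz).1 h)) (hprod _ _ hzZ)
  · intro z hz
    by_cases hzZ : z ∈ Z
    · have hk : ord z ≠ 0 := by
        intro hk
        have := (hHe z hzZ).self_of_nhds
        rw [(h0 z hz).2 hzZ, hk, pow_zero, one_mul] at this
        exact hHn z hzZ this.symm
      rw [(h0 z hz).2 hzZ, Finset.prod_eq_zero hzZ (by simp [hk]), zero_mul]
    · simp only [u, if_neg hzZ]
      rw [mul_div_cancel₀]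
      exact hprod _ _ hzZ

lemma wpCauchy (c : ℂ) (R : ℝ) (hR : 0 < R) (w : ℂ) (hw : w ∉ sphere c R) (k : ℕ) :
    (∮ z in C(c, R), z ^ k / (z - w)) =
      2 * Real.pi * Complex.I * (if dist w c < R then w ^ k else 0) := by
  split_ifs with h
  · have := DiffContOnCl.circleIntegral_sub_inv_smul (f := fun z : ℂ => z ^ k) (c := c) (R := R)
      (w := w) (Differentiable.diffContOnCl (by fun_prop)) h
    simp only [smul_eq_mul] at this
    rw [← this]
    congr 1; ext z; rw [div_eq_inv_mul]
  · rw [mul_zero]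
    apply DiffContOnCl.circleIntegral_eq_zero hR.le
    apply DifferentiableOn.diffContOnCl_ball (U := closedBall c R) _ subset_rfl
    intro z hz
    apply DifferentiableAt.differentiableWithinAt
    apply DifferentiableAt.fun_div (by fun_prop) (by fun_prop)
    rw [sub_ne_zero]
    rintro rfl
    simp only [mem_sphere, mem_closedBall] at hw hz
    exact h (lt_of_le_of_ne hz hw)

lemma wpCount (g : ℂ → ℂ) (Ω : Set ℂ) (hΩ : IsOpen Ω) (hg : AnalyticOnNhd ℂ g Ω)
    (Z : Finset ℂ) (ord : ℂ → ℕ) (h0 : ∀ z ∈ Ω, g z = 0 ↔ z ∈ Z)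
    (hZ : ∀ z ∈ Z, ZeroOrder g z (ord z)) (c : ℂ) (R : ℝ) (hR : 0 < R)
    (hcR : closedBall c R ⊆ Ω) (hs : ∀ z ∈ sphere c R, g z ≠ 0) (k : ℕ) :
    (∮ z in C(c, R), z ^ k * (deriv g z / g z)) =
      2 * Real.pi * Complex.I * ∑ w ∈ Z with dist w c < R, ord w * w ^ k := by
  obtain ⟨u, hu, hu0, hgu⟩ := wpFac g Ω hg Z ord h0 hZ
  have hsZ : ∀ z ∈ sphere c R, z ∉ Z := fun z hz hzZ =>
    hs z hz ((h0 z (hcR (sphere_subset_closedBall hz))).2 hzZ)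
  have hld : EqOn (fun z => z ^ k * (deriv g z / g z))
      (fun z => (∑ w ∈ Z, (ord w : ℂ) * (z ^ k / (z - w))) + z ^ k * (deriv u z / u z))
      (sphere c R) := by
    intro z hz
    have hzΩ := hcR (sphere_subset_closedBall hz)
    have hne : ∀ w ∈ Z, z - w ≠ 0 := by
      intro w hw
      rw [sub_ne_zero]
      rintro rfl
      exact hsZ _ hz hw
    have e1 : g =ᶠ[𝓝 z] (fun z => (∏ w ∈ Z, (z - w) ^ ord w) * u z) := by
      filter_upwards [hΩ.mem_nhds hzΩ] with y hy using hgu y hy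
    have e2 : deriv g z / g z = ∑ w ∈ Z, (ord w : ℂ) * (1 / (z - w)) + deriv u z / u z := by
      rw [e1.deriv_eq, e1.eq_of_nhds, ← logDeriv_apply, ← logDeriv_apply,
        logDeriv_mul (f := fun z => ∏ w ∈ Z, (z - w) ^ ord w), logDeriv_prod]
      · congr 1
        refine Finset.sum_congr rfl fun w hw => ?_
        rw [logDeriv_fun_pow (by fun_prop)]
        simp [logDeriv_apply]
      · exact fun w hw => pow_ne_zero _ (hne w hw)
      · intro w hw; fun_prop
      · exact Finset.prod_ne_zero_iff.2 fun w hw => pow_ne_zero _ (hne w hw)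
      · exact hu0 z hzΩ
      · fun_prop
      · exact (hu z hzΩ).differentiableAt
    simp only [e2, mul_add, Finset.mul_sum]
    congr 1
    refine Finset.sum_congr rfl fun w hw => ?_
    ring
  rw [circleIntegral.integral_congr hR.le hld]
  have hci : ∀ w ∈ Z, CircleIntegrable (fun z => (ord w : ℂ) * (z ^ k / (z - w))) c R := by
    intro w hw
    apply ContinuousOn.circleIntegrable hR.le
    apply ContinuousOn.mul (by fun_prop)
    apply ContinuousOn.div (by fun_prop) (by fun_prop)
    intro z hz
    rw [sub_ne_zero]
    rintro rfl
    exact hsZ _ hz hw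
  have hd : DifferentiableOn ℂ (fun z => z ^ k * (deriv u z / u z)) (closedBall c R) := by
    intro z hz
    have := hu z (hcR hz)
    have h1 := this.deriv.differentiableAt
    have h2 := this.differentiableAt
    exact (DifferentiableAt.mul (by fun_prop)
      (h1.fun_div h2 (hu0 z (hcR hz)))).differentiableWithinAt
  rw [circleIntegral.integral_add (f := fun z => (∑ w ∈ Z, (ord w : ℂ) * (z ^ k / (z - w))))
    (CircleIntegrable.fun_sum _ hci)
    ((hd.continuousOn.mono sphere_subset_closedBall).circleIntegrable hR.le),
    circleIntegral.integral_fun_sum hci,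
    DiffContOnCl.circleIntegral_eq_zero hR.le (hd.diffContOnCl_ball subset_rfl), add_zero,
    Finset.sum_filter, Finset.mul_sum]
  refine Finset.sum_congr rfl fun w hw => ?_
  rw [circleIntegral.integral_const_mul, wpCauchy c R hR w (fun h => hsZ w h hw)]
  split_ifs <;> ring

lemma wpNewton (m : ℕ) (V : ℂ → Fin m → ℂ) (p₀ : ℂ)
    (h : ∀ k, AnalyticAt ℂ (fun p => ∑ i, V p i ^ k) p₀) (k : ℕ) :
    AnalyticAt ℂ (fun p => MvPolynomial.aeval (V p) (MvPolynomial.esymm (Fin m) ℂ k)) p₀ := by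
  induction k using Nat.strong_induction_on with
  | _ k ih =>
  rcases Nat.eq_zero_or_pos k with rfl | hk
  · simp only [MvPolynomial.esymm_zero, map_one]
    exact analyticAt_const
  · have key : ∀ p, MvPolynomial.aeval (V p) (MvPolynomial.esymm (Fin m) ℂ k) =
        (k : ℂ)⁻¹ * ((-1) ^ (k + 1) * ∑ a ∈ Finset.HasAntidiagonal.antidiagonal k with a.1 < k,
          (-1) ^ a.1 * MvPolynomial.aeval (V p) (MvPolynomial.esymm (Fin m) ℂ a.1) *
            ∑ i, V p i ^ a.2) := by
      intro p
      have := congrArg (MvPolynomial.aeval (V p)) (MvPolynomial.mul_esymm_eq_sum (Fin m) ℂ k)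
      simp only [map_mul, map_sum, map_pow, map_neg, map_one, map_natCast, MvPolynomial.psum,
        MvPolynomial.aeval_X] at this
      rw [← this, inv_mul_cancel_left₀]
      exact_mod_cast hk.ne'
    simp only [key]
    refine analyticAt_const.mul (analyticAt_const.mul (Finset.analyticAt_fun_sum _ ?_))
    intro a ha
    exact (analyticAt_const.mul (ih a.1 (Finset.mem_filter.1 ha).2)).mul (h a.2)

lemma wpEnum (m : ℕ) (Z : Finset ℂ) (ord : ℂ → ℕ) (hm : ∑ z ∈ Z, ord z = m) :
    ∃ v : Fin m → ℂ, (∀ k : ℕ, ∑ i, v i ^ k = ∑ w ∈ Z, (ord w : ℂ) * w ^ k) ∧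
      ∏ i, (Polynomial.X - Polynomial.C (v i)) =
        ∏ w ∈ Z, (Polynomial.X - Polynomial.C w) ^ ord w := by
  subst hm
  let e : Fin (∑ z ∈ Z, ord z) ≃ (Σ z : Z, Fin (ord z)) :=
    Fintype.equivOfCardEq (by simp [Finset.sum_attach Z ord])
  refine ⟨fun i => (e i).1, ?_, ?_⟩
  · intro k
    rw [e.sum_comp (fun x => (x.1 : ℂ) ^ k), Fintype.sum_sigma]
    simp [Finset.sum_attach Z (fun w => (ord w : ℂ) * w ^ k)]
  · rw [e.prod_comp (fun x => (Polynomial.X - Polynomial.C (x.1 : ℂ))), Fintype.prod_sigma]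
    simp [Finset.prod_attach Z (fun w => (Polynomial.X - Polynomial.C w) ^ ord w)]

lemma wpCoeff (m : ℕ) (v : Fin m → ℂ) (j : ℕ) (hj : j ≤ m) :
    (∏ i, (Polynomial.X - Polynomial.C (v i))).coeff j =
      (-1) ^ (m - j) * MvPolynomial.aeval v (MvPolynomial.esymm (Fin m) ℂ (m - j)) := by
  have := Multiset.prod_X_sub_C_coeff (Finset.univ.val.map v) (k := j) (by simpa using hj)
  rw [Multiset.map_map] at this
  rw [MvPolynomial.aeval_esymm_eq_multiset_esymm]
  have e : ∏ i, (Polynomial.X - Polynomial.C (v i)) =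
      (Multiset.map ((fun t => Polynomial.X - Polynomial.C t) ∘ v) Finset.univ.val).prod := rfl
  rw [e, this]
  simp

lemma wpDeriv (f : ℂ → ℂ → ℂ) (z p : ℂ) (hf : AnalyticAt ℂ (fun q : ℂ × ℂ => f q.1 q.2) (z, p)) :
    AnalyticAt ℂ (fun q : ℂ × ℂ => deriv (fun y => f y q.2) q.1) (z, p) := by
  have h1 : AnalyticAt ℂ (fun q => fderiv ℂ (fun q : ℂ × ℂ => f q.1 q.2) q ((1 : ℂ), (0 : ℂ))) (z, p) :=
    ((ContinuousLinearMap.apply ℂ ℂ ((1 : ℂ), (0 : ℂ))).analyticAt _).comp hf.fderiv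
  refine h1.congr ?_
  filter_upwards [hf.eventually_analyticAt] with q hq
  have h2 : HasDerivAt (fun y : ℂ => (y, q.2)) ((1 : ℂ), (0 : ℂ)) q.1 :=
    (hasDerivAt_id q.1).prodMk (hasDerivAt_const q.1 q.2)
  exact (HasFDerivAt.comp_hasDerivAt (f := fun y : ℂ => (y, q.2)) q.1
    hq.differentiableAt.hasFDerivAt h2).deriv.symm

lemma wpSlice (f : ℂ → ℂ → ℂ) (z p : ℂ) (hf : AnalyticAt ℂ (fun q : ℂ × ℂ => f q.1 q.2) (z, p)) :
    AnalyticAt ℂ (fun z => f z p) z :=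
  AnalyticAt.comp (f := fun y : ℂ => (y, p)) (x := z) hf (analyticAt_id.prod analyticAt_const)

lemma wpNat (N : ℂ → ℕ) (p₀ : ℂ) (h : ContinuousAt (fun p => (N p : ℂ)) p₀) :
    ∀ᶠ p in 𝓝 p₀, N p = N p₀ := by
  filter_upwards [h.eventually (ball_mem_nhds _ one_pos)] with p hp
  rw [dist_eq_norm] at hp
  by_contra hne
  have h1 : (1 : ℤ) ≤ |(N p : ℤ) - N p₀| := Int.one_le_abs (by omega)
  have h2 : ‖(N p : ℂ) - N p₀‖ = ((|(N p : ℤ) - N p₀| : ℤ) : ℝ) := by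
    have := Complex.norm_intCast ((N p : ℤ) - N p₀)
    push_cast at this ⊢
    exact this
  rw [h2] at hp
  have h3 : (1 : ℝ) ≤ ((|(N p : ℤ) - N p₀| : ℤ) : ℝ) := by exact_mod_cast h1
  linarith

/-- A common radius for the finitely many zeros. -/
lemma wpRadius (Ω : Set ℂ) (hΩ : IsOpen Ω) (Z : Finset ℂ) (hZ : (Z : Set ℂ) ⊆ Ω) :
    ∃ r : ℝ, 0 < r ∧ ∀ z ∈ Z, closedBall z r ⊆ Ω ∧ ∀ w ∈ Z, w ≠ z → 2 * r < dist w z := by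
  have h1 : ∀ᶠ r in 𝓝[>] (0 : ℝ), ∀ z ∈ Z, closedBall z r ⊆ Ω ∧
      ∀ w ∈ Z, w ≠ z → 2 * r < dist w z := by
    rw [Filter.eventually_all_finset]
    intro z hz
    refine Filter.Eventually.and ?_ ?_
    · obtain ⟨ρ, hρ, hb⟩ := Metric.nhds_basis_closedBall.mem_iff.1 (hΩ.mem_nhds (hZ hz))
      filter_upwards [Ioc_mem_nhdsGT hρ] with r hr
      exact (closedBall_subset_closedBall hr.2).trans hb
    · rw [Filter.eventually_all_finset]
      intro w hw
      by_cases hwz : w = z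
      · simp [hwz]
      · have := dist_pos.2 hwz
        filter_upwards [Ioo_mem_nhdsGT (half_pos this)] with r hr _
        linarith [hr.2]
  obtain ⟨r, hr1, hr2⟩ := (h1.and self_mem_nhdsWithin).exists
  exact ⟨r, hr2, hr1⟩

lemma wpPow (m : ℕ) (Ω Pdom : Set ℂ) (hΩo : IsOpen Ω) (hPo : IsOpen Pdom)
    (f : ℂ → ℂ → ℂ)
    (hf : AnalyticOnNhd ℂ (fun q : ℂ × ℂ => f q.1 q.2) (Ω ×ˢ Pdom))
    (Z : ℂ → Finset ℂ) (ord : ℂ → ℂ → ℕ)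
    (hZΩ : ∀ p ∈ Pdom, (Z p : Set ℂ) ⊆ Ω)
    (h0 : ∀ p ∈ Pdom, ∀ z ∈ Ω, f z p = 0 ↔ z ∈ Z p)
    (hZ : ∀ p ∈ Pdom, ∀ z ∈ Z p, ZeroOrder (fun z => f z p) z (ord p z))
    (hm : ∀ p ∈ Pdom, ∑ z ∈ Z p, ord p z = m) (p₀ : ℂ) (hp₀ : p₀ ∈ Pdom) (k : ℕ) :
    AnalyticAt ℂ (fun p => ∑ w ∈ Z p, (ord p w : ℂ) * w ^ k) p₀ := by
  classical
  obtain ⟨r, hr, hrZ⟩ := wpRadius Ω hΩo (Z p₀) (hZΩ p₀ hp₀)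
  have hs0 : ∀ z ∈ Z p₀, ∀ y ∈ sphere z r, f y p₀ ≠ 0 := by
    intro z hz y hy hy0
    have hyZ := (h0 p₀ hp₀ y ((hrZ z hz).1 (sphere_subset_closedBall hy))).1 hy0
    have hyz : y ≠ z := by
      rintro rfl
      simp at hy; linarith
    have := (hrZ z hz).2 y hyZ hyz
    rw [mem_sphere] at hy
    linarith
  have hP : ∀ᶠ p in 𝓝 p₀, p ∈ Pdom := hPo.mem_nhds hp₀
  have hs : ∀ᶠ p in 𝓝 p₀, ∀ z ∈ Z p₀, ∀ y ∈ sphere z r, f y p ≠ 0 := by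
    rw [Filter.eventually_all_finset]
    intro z hz
    apply IsCompact.eventually_forall_of_forall_eventually (isCompact_sphere z r)
    intro y hy
    have := (hf (y, p₀) ⟨(hrZ z hz).1 (sphere_subset_closedBall hy), hp₀⟩).continuousAt
    exact (continuous_swap.continuousAt (x := (p₀, y))).eventually
      (this.eventually_ne (hs0 z hz y hy))
  let N : ℂ → ℕ → ℂ → ℂ := fun z k p => ∑ w ∈ Z p with dist w z < r, (ord p w : ℂ) * w ^ k
  have hN : ∀ z ∈ Z p₀, ∀ k, AnalyticAt ℂ (N z k) p₀ := by
    intro z hz k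
    have h1 : AnalyticAt ℂ (fun p => (2 * Real.pi * Complex.I)⁻¹ *
        ∮ y in C(z, r), y ^ k * (deriv (fun y => f y p) y / f y p)) p₀ := by
      refine analyticAt_const.mul (wpC (fun y p => y ^ k * (deriv (fun y => f y p) y / f y p))
        z r hr p₀ ?_)
      intro y hy
      have := hf (y, p₀) ⟨(hrZ z hz).1 (sphere_subset_closedBall hy), hp₀⟩
      exact (analyticAt_fst.pow k).mul ((wpDeriv f y p₀ this).div this (hs0 z hz y hy))
    refine h1.congr ?_
    filter_upwards [hP, hs] with p hp hsp
    rw [wpCount (fun y => f y p) Ω hΩo (fun y hy => wpSlice f y p (hf _ ⟨hy, hp⟩)) (Z p) (ord p)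
      (h0 p hp) (hZ p hp) z r hr (hrZ z hz).1 (hsp z hz) k, inv_mul_cancel_left₀]
    simp [Real.pi_ne_zero]
  have hN0 : ∀ᶠ p in 𝓝 p₀, ∀ z ∈ Z p₀, ∑ w ∈ Z p with dist w z < r, ord p w = ord p₀ z := by
    rw [Filter.eventually_all_finset]
    intro z hz
    have h1 := wpNat (fun p => ∑ w ∈ Z p with dist w z < r, ord p w) p₀ (by
      have := (hN z hz 0).continuousAt
      simpa [N] using this)
    have h2 : (Z p₀).filter (fun w => dist w z < r) = {z} := by
      ext w
      simp only [Finset.mem_filter, Finset.mem_singleton]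
      constructor
      · rintro ⟨hw, hwz⟩
        by_contra hne
        have := (hrZ z hz).2 w hw hne
        linarith
      · rintro rfl
        exact ⟨hz, by simpa using hr⟩
    filter_upwards [h1] with p hp
    rw [hp, h2, Finset.sum_singleton]
  refine (Finset.analyticAt_fun_sum (Z p₀) (fun z hz => hN z hz k)).congr ?_
  filter_upwards [hP, hN0] with p hp hNp
  have hdisj : ((Z p₀ : Finset ℂ) : Set ℂ).PairwiseDisjoint
      (fun z => (Z p).filter (fun w => dist w z < r)) := by
    intro z hz z' hz' hne
    rw [Function.onFun, Finset.disjoint_left]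
    intro w hw hw'
    have h1 := (Finset.mem_filter.1 hw).2
    have h2 := (Finset.mem_filter.1 hw').2
    have h3 := (hrZ z' hz').2 z hz hne
    have h4 := dist_triangle_left z z' w
    linarith
  have hsub : (Z p₀).biUnion (fun z => (Z p).filter (fun w => dist w z < r)) ⊆ Z p :=
    Finset.biUnion_subset.2 fun z _ => Finset.filter_subset _ _
  have hz0 : ∀ w ∈ Z p, w ∉ (Z p₀).biUnion (fun z => (Z p).filter (fun w => dist w z < r)) →
      ord p w = 0 := by
    have e1 : ∑ w ∈ (Z p₀).biUnion (fun z => (Z p).filter (fun w => dist w z < r)), ord p w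
        = ∑ w ∈ Z p, ord p w := by
      rw [Finset.sum_biUnion hdisj, hm p hp, ← hm p₀ hp₀]
      exact Finset.sum_congr rfl hNp
    have e2 := Finset.sum_sdiff (f := ord p) hsub
    have e3 : ∑ w ∈ Z p \ (Z p₀).biUnion (fun z => (Z p).filter (fun w => dist w z < r)),
        ord p w = 0 := by omega
    intro w hw hw'
    exact Finset.sum_eq_zero_iff.1 e3 w (Finset.mem_sdiff.2 ⟨hw, hw'⟩)
  show ∑ z ∈ Z p₀, ∑ w ∈ Z p with dist w z < r, (ord p w : ℂ) * w ^ k = _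
  rw [← Finset.sum_biUnion hdisj]
  apply Finset.sum_subset hsub
  intro w hw hw'
  simp [hz0 w hw hw']

/-- The frozen polynomial as an honest polynomial. -/
noncomputable def wpQ (m : ℕ) (a : ℕ → ℂ) : Polynomial ℂ :=
  Polynomial.X ^ m + ∑ j ∈ Finset.range m, Polynomial.C (a j) * Polynomial.X ^ j

lemma wpQ_deg (m : ℕ) (a : ℕ → ℂ) :
    (∑ j ∈ Finset.range m, Polynomial.C (a j) * Polynomial.X ^ j).degree < (m : WithBot ℕ) := by
  rw [← Polynomial.mem_degreeLT]
  refine Submodule.sum_mem _ fun j hj => ?_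
  rw [Polynomial.mem_degreeLT]
  refine (Polynomial.degree_C_mul_X_pow_le j (a j)).trans_lt ?_
  exact_mod_cast Finset.mem_range.1 hj

lemma wpQ_monic (m : ℕ) (a : ℕ → ℂ) : (wpQ m a).Monic :=
  Polynomial.monic_X_pow_add (wpQ_deg m a)

lemma wpQ_natDegree (m : ℕ) (a : ℕ → ℂ) : (wpQ m a).natDegree = m := by
  apply Polynomial.natDegree_eq_of_degree_eq_some
  rw [wpQ, Polynomial.degree_add_eq_left_of_degree_lt]
  · simp
  · rw [Polynomial.degree_X_pow]; exact wpQ_deg m a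

lemma wpQ_coeff (m : ℕ) (a : ℕ → ℂ) (j : ℕ) (hj : j < m) : (wpQ m a).coeff j = a j := by
  rw [wpQ, Polynomial.coeff_add, Polynomial.coeff_X_pow, if_neg hj.ne, zero_add,
    Polynomial.finsetSum_coeff]
  simp [Polynomial.coeff_X_pow, hj]

lemma wpQ_eval (m : ℕ) (α : ℕ → ℂ → ℂ) (z p : ℂ) :
    (wpQ m (fun j => α j p)).eval z = wpoly m α z p := by
  simp [wpQ, wpoly, Polynomial.eval_finsetSum]

lemma wpQ_of_coeff (m : ℕ) (P : Polynomial ℂ) (hP : P.Monic) (hd : P.natDegree = m) :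
    wpQ m (fun j => P.coeff j) = P := by
  conv_rhs => rw [P.as_sum_range_C_mul_X_pow, hd, Finset.sum_range_succ]
  have : P.coeff m = 1 := by rw [← hd]; exact hP
  rw [this, wpQ]
  simp [add_comm]

lemma wpUnique (g : ℂ → ℂ) (Ω : Set ℂ) (hΩ : IsOpen Ω) (hg : AnalyticOnNhd ℂ g Ω)
    (Z : Finset ℂ) (ord : ℂ → ℕ) (hZΩ : (Z : Set ℂ) ⊆ Ω)
    (hZ : ∀ z ∈ Z, ZeroOrder g z (ord z)) (Q : Polynomial ℂ) (hQ : Q.Monic)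
    (hd : Q.natDegree = ∑ z ∈ Z, ord z) (h' : ℂ → ℂ) (hh' : AnalyticOnNhd ℂ h' Ω)
    (hne : ∀ z ∈ Ω, h' z ≠ 0) (hgQ : ∀ z ∈ Ω, g z = Q.eval z * h' z) :
    ∏ w ∈ Z, (Polynomial.X - Polynomial.C w) ^ ord w = Q := by
  have hmon : (∏ w ∈ Z, (Polynomial.X - Polynomial.C w) ^ ord w).Monic :=
    Polynomial.monic_prod_of_monic _ _ fun w _ => (Polynomial.monic_X_sub_C w).pow _
  refine (Polynomial.eq_of_monic_of_dvd_of_natDegree_le hmon hQ ?_ ?_).symm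
  · apply Finset.prod_dvd_of_coprime
    · intro w _ w' _ hww
      exact (Polynomial.isCoprime_X_sub_C_of_isUnit_sub (sub_ne_zero.2 hww).isUnit).pow
    · intro w hw
      have hwΩ := hZΩ hw
      have h1 : analyticOrderAt g w = ord w := (hg w hwΩ).analyticOrderAt_eq_natCast.2 (hZ w hw)
      obtain ⟨R, hR, hRd⟩ := Polynomial.exists_eq_pow_rootMultiplicity_mul_and_not_dvd Q hQ.ne_zero w
      have h2 : analyticOrderAt g w = Q.rootMultiplicity w := by
        rw [(hg w hwΩ).analyticOrderAt_eq_natCast]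
        refine ⟨fun z => R.eval z * h' z, ?_, ?_, ?_⟩
        · exact (AnalyticAt.aeval_polynomial analyticAt_id R).mul (hh' w hwΩ)
        · refine mul_ne_zero ?_ (hne w hwΩ)
          rwa [Polynomial.dvd_iff_isRoot] at hRd
        · filter_upwards [hΩ.mem_nhds hwΩ] with z hz
          rw [hgQ z hz]
          conv_lhs => rw [hR]
          simp [mul_assoc]
      have h3 : ord w = Q.rootMultiplicity w := by
        rw [h1] at h2; exact_mod_cast h2
      rw [h3]
      exact Polynomial.pow_rootMultiplicity_dvd Q w
  · rw [hd, Polynomial.natDegree_prod_of_monic _ _ fun w _ => (Polynomial.monic_X_sub_C w).pow _]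
    simp

lemma wpMain
    (m : ℕ) (Ω Pdom : Set ℂ)
    (hΩo : IsOpen Ω) (hPo : IsOpen Pdom)
    (f : ℂ → ℂ → ℂ)
    (hf : AnalyticOnNhd ℂ (fun q : ℂ × ℂ => f q.1 q.2) (Ω ×ˢ Pdom))
    (hcount : ∀ p ∈ Pdom, EigCount (fun z => f z p) Ω m) :
    ∃ (α : ℕ → ℂ → ℂ) (h : ℂ → ℂ → ℂ),
      (∀ j < m, AnalyticOnNhd ℂ (α j) Pdom) ∧
      AnalyticOnNhd ℂ (fun q : ℂ × ℂ => h q.1 q.2) (Ω ×ˢ Pdom) ∧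
      (∀ z ∈ Ω, ∀ p ∈ Pdom, h z p ≠ 0) ∧
      (∀ z ∈ Ω, ∀ p ∈ Pdom, f z p = wpoly m α z p * h z p) ∧
      ∀ (α' : ℕ → ℂ → ℂ) (h' : ℂ → ℂ → ℂ),
        (∀ j < m, AnalyticOnNhd ℂ (α' j) Pdom) →
        AnalyticOnNhd ℂ (fun q : ℂ × ℂ => h' q.1 q.2) (Ω ×ˢ Pdom) →
        (∀ z ∈ Ω, ∀ p ∈ Pdom, h' z p ≠ 0) →
        (∀ z ∈ Ω, ∀ p ∈ Pdom, f z p = wpoly m α' z p * h' z p) →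
        (∀ j < m, ∀ p ∈ Pdom, α j p = α' j p) ∧
        ∀ z ∈ Ω, ∀ p ∈ Pdom, h z p = h' z p := by
  classical
  choose! Z ord hZΩ h0 hZ hm using hcount
  have hsl : ∀ p ∈ Pdom, AnalyticOnNhd ℂ (fun z => f z p) Ω :=
    fun p hp z hz => wpSlice f z p (hf _ ⟨hz, hp⟩)
  have hV := fun p (hp : p ∈ Pdom) => wpEnum m (Z p) (ord p) (hm p hp)
  choose! V hV1 hV2 using hV
  have hU := fun p (hp : p ∈ Pdom) =>
    wpFac (fun z => f z p) Ω (hsl p hp) (Z p) (ord p) (h0 p hp) (hZ p hp)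
  choose! u hua hun huf using hU
  let P : ℂ → Polynomial ℂ := fun p => ∏ i, (Polynomial.X - Polynomial.C (V p i))
  let α : ℕ → ℂ → ℂ := fun j p => (P p).coeff j
  have hPQ : ∀ p, wpQ m (fun j => α j p) = P p := fun p =>
    wpQ_of_coeff m (P p) (Polynomial.monic_prod_of_monic _ _ fun w _ => Polynomial.monic_X_sub_C _)
      (by simp [P])
  have hwp : ∀ p ∈ Pdom, ∀ z, wpoly m α z p = ∏ w ∈ Z p, (z - w) ^ ord p w := by
    intro p hp z
    rw [← wpQ_eval, hPQ]
    simp only [P]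
    rw [hV2 p hp, Polynomial.eval_prod]
    simp
  have hfac : ∀ z ∈ Ω, ∀ p ∈ Pdom, f z p = wpoly m α z p * u p z := by
    intro z hz p hp
    rw [hwp p hp]
    exact huf p hp z hz
  have hα : ∀ j < m, AnalyticOnNhd ℂ (α j) Pdom := by
    intro j hj p₀ hp₀
    simp only [α, P]
    simp only [wpCoeff m _ j hj.le]
    refine analyticAt_const.mul (wpNewton m V p₀ ?_ _)
    intro k
    refine (wpPow m Ω Pdom hΩo hPo f hf Z ord hZΩ h0 hZ hm p₀ hp₀ k).congr ?_
    filter_upwards [hPo.mem_nhds hp₀] with p hp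
    rw [hV1 p hp]
  have hwa : ∀ z, ∀ p ∈ Pdom, AnalyticAt ℂ (fun q : ℂ × ℂ => wpoly m α q.1 q.2) (z, p) := by
    intro z p hp
    unfold wpoly
    refine (analyticAt_fst.pow m).add (Finset.analyticAt_fun_sum _ ?_)
    intro j hj
    exact (AnalyticAt.comp (f := Prod.snd) (x := (z, p)) (hα j (Finset.mem_range.1 hj) p hp)
      analyticAt_snd).mul (analyticAt_fst.pow j)
  have hw0 : ∀ z ∈ Ω, ∀ p ∈ Pdom, f z p ≠ 0 → wpoly m α z p ≠ 0 := by
    intro z hz p hp h1 h2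
    apply h1
    rw [hfac z hz p hp, h2, zero_mul]
  refine ⟨α, fun z p => u p z, hα, ?_, fun z hz p hp => hun p hp z hz, hfac, ?_⟩
  · rintro ⟨z₀, p₀⟩ ⟨hz₀, hp₀⟩
    simp only at hz₀ hp₀
    obtain ⟨r, hr, hrZ⟩ := wpRadius Ω hΩo (insert z₀ (Z p₀)) (by
      rw [Finset.coe_insert]
      exact Set.insert_subset hz₀ (hZΩ p₀ hp₀))
    have hr1 := (hrZ z₀ (Finset.mem_insert_self _ _)).1
    have hs0 : ∀ y ∈ sphere z₀ r, f y p₀ ≠ 0 := by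
      intro y hy hy0
      have hyZ := (h0 p₀ hp₀ y (hr1 (sphere_subset_closedBall hy))).1 hy0
      have hyz : y ≠ z₀ := by
        rintro rfl
        simp at hy; linarith
      have := (hrZ z₀ (Finset.mem_insert_self _ _)).2 y (Finset.mem_insert_of_mem hyZ) hyz
      rw [mem_sphere] at hy
      linarith
    have hs : ∀ᶠ p in 𝓝 p₀, ∀ y ∈ sphere z₀ r, f y p ≠ 0 := by
      apply IsCompact.eventually_forall_of_forall_eventually (isCompact_sphere z₀ r)
      intro y hy
      have := (hf (y, p₀) ⟨hr1 (sphere_subset_closedBall hy), hp₀⟩).continuousAt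
      exact (continuous_swap.continuousAt (x := (p₀, y))).eventually
        (this.eventually_ne (hs0 y hy))
    have hD := wpD (fun y p => f y p / wpoly m α y p) z₀ r hr p₀ z₀ (mem_ball_self hr) (by
      intro y hy
      have hyΩ := hr1 (sphere_subset_closedBall hy)
      exact (hf (y, p₀) ⟨hyΩ, hp₀⟩).div (hwa y p₀ hp₀) (hw0 y hyΩ p₀ hp₀ (hs0 y hy)))
    refine ((analyticAt_const (v := (2 * Real.pi * Complex.I : ℂ)⁻¹)).mul hD).congr ?_
    filter_upwards [continuousAt_fst.eventually (ball_mem_nhds z₀ hr),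
      continuousAt_snd.eventually hs, continuousAt_snd.eventually (hPo.mem_nhds hp₀)] with q hq1 hq2 hq3
    have hC := DiffContOnCl.two_pi_i_inv_smul_circleIntegral_sub_inv_smul (c := z₀) (w := q.1)
      (f := u q.2) (R := r) (DifferentiableOn.diffContOnCl_ball (U := closedBall z₀ r)
        (fun z hz => (hua q.2 hq3 z (hr1 hz)).differentiableAt.differentiableWithinAt) subset_rfl) hq1
    simp only [smul_eq_mul] at hC
    show _ = u q.2 q.1
    rw [← hC, Pi.mul_apply]
    congr 1
    apply circleIntegral.integral_congr hr.le
    intro y hy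
    have hyΩ := hr1 (sphere_subset_closedBall hy)
    simp only
    rw [hfac y hyΩ q.2 hq3, mul_div_cancel_left₀ _ (hw0 y hyΩ q.2 hq3 (hq2 y hy))]
  · intro α' h' hα' hh' hn' hf'
    have hQ : ∀ p ∈ Pdom, P p = wpQ m (fun j => α' j p) := by
      intro p hp
      simp only [P]
      rw [hV2 p hp]
      refine wpUnique (fun z => f z p) Ω hΩo (hsl p hp) (Z p) (ord p) (hZΩ p hp) (hZ p hp) _
        (wpQ_monic _ _) (by rw [wpQ_natDegree, hm p hp]) (fun z => h' z p)
        (fun z hz => wpSlice h' z p (hh' _ ⟨hz, hp⟩)) (fun z hz => hn' z hz p hp) ?_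
      intro z hz
      rw [wpQ_eval]
      exact hf' z hz p hp
    refine ⟨?_, ?_⟩
    · intro j hj p hp
      simp only [α]
      rw [hQ p hp, wpQ_coeff m _ j hj]
    · intro z hz p hp
      have hev : ∀ᶠ y in 𝓝[≠] z, u p y = h' y p := by
        have hcl : IsClosed (((Z p).erase z : Finset ℂ) : Set ℂ) :=
          ((Z p).erase z).finite_toSet.isClosed
        have h2 : ∀ᶠ y in 𝓝 z, y ∉ (Z p).erase z := hcl.isOpen_compl.mem_nhds (by simp)
        filter_upwards [nhdsWithin_le_nhds h2, nhdsWithin_le_nhds (hΩo.mem_nhds hz),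
          self_mem_nhdsWithin] with y hy1 hy2 hy3
        have hyZ : y ∉ Z p := fun h => hy1 (Finset.mem_erase.2 ⟨hy3, h⟩)
        have hfy : f y p ≠ 0 := fun h => hyZ ((h0 p hp y hy2).1 h)
        have e1 : wpoly m α' y p = wpoly m α y p := by
          rw [← wpQ_eval, ← wpQ_eval, ← hQ p hp, hPQ]
        have e2 := hf' y hy2 p hp
        rw [hfac y hy2 p hp, e1] at e2
        exact mul_left_cancel₀ (hw0 y hy2 p hp hfy) e2
      exact ((ContinuousAt.eventuallyEq_nhds_iff_eventuallyEq_nhdsNE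
        (hua p hp z hz).continuousAt
        (wpSlice h' z p (hh' _ ⟨hz, hp⟩)).continuousAt).1 hev).eq_of_nhds

end WP

end WP

/-- **Global Weierstrass preparation** (Lemma B.6): if `f` is analytic on `Ω × Π` and for
every `p ∈ Π` the function `f(·,p)` has exactly `m` zeros in `Ω` counting orders, then
`f(z,p) = (z^m + α_{m-1}(p) z^{m-1} + ⋯ + α_0(p)) · h(z,p)` with unique coefficients `α j`
analytic on `Π` and a unique nonvanishing analytic `h` on `Ω × Π`. -/
theorem global_weierstrass_preparation
    (m : ℕ) (Ω Pdom : Set ℂ)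
    (hΩo : IsOpen Ω) (hΩc : IsConnected Ω) (hPo : IsOpen Pdom) (hPc : IsConnected Pdom)
    (f : ℂ → ℂ → ℂ)
    (hf : AnalyticOnNhd ℂ (fun q : ℂ × ℂ => f q.1 q.2) (Ω ×ˢ Pdom))
    (hne : ∀ p ∈ Pdom, ∃ z ∈ Ω, f z p ≠ 0)
    (hcount : ∀ p ∈ Pdom, EigCount (fun z => f z p) Ω m) :
    ∃ (α : ℕ → ℂ → ℂ) (h : ℂ → ℂ → ℂ),
      (∀ j < m, AnalyticOnNhd ℂ (α j) Pdom) ∧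
      AnalyticOnNhd ℂ (fun q : ℂ × ℂ => h q.1 q.2) (Ω ×ˢ Pdom) ∧
      (∀ z ∈ Ω, ∀ p ∈ Pdom, h z p ≠ 0) ∧
      (∀ z ∈ Ω, ∀ p ∈ Pdom, f z p = wpoly m α z p * h z p) ∧
      ∀ (α' : ℕ → ℂ → ℂ) (h' : ℂ → ℂ → ℂ),
        (∀ j < m, AnalyticOnNhd ℂ (α' j) Pdom) →
        AnalyticOnNhd ℂ (fun q : ℂ × ℂ => h' q.1 q.2) (Ω ×ˢ Pdom) →
        (∀ z ∈ Ω, ∀ p ∈ Pdom, h' z p ≠ 0) →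
        (∀ z ∈ Ω, ∀ p ∈ Pdom, f z p = wpoly m α' z p * h' z p) →
        (∀ j < m, ∀ p ∈ Pdom, α j p = α' j p) ∧
        ∀ z ∈ Ω, ∀ p ∈ Pdom, h z p = h' z p := by
  exact WP.wpMain m Ω Pdom hΩo hPo f hf hcount
end
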